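/- Let N be the dimension of ℙ(H_d), 𝒟 = d_1⋯d_n, and D = max_i d_i. The expectation, for g uniformly distributed in ℙ(H_d), of ln κ̃(g), is at most 2 ln N + 4 ln n + 2 ln 𝒟 + ln D + 6. -/

import Mathlib

open MvPolynomial Finset ENNReal

/-- Bombieri–Weyl inner product of two polynomials (intended for homogeneous
polynomials of the same degree `d`): `⟨Σ aⱼ xʲ, Σ bⱼ xʲ⟩_W = Σ aⱼ bⱼ / binom(d, j)`
where `binom(d, j) = d! / (j₀! ⋯ jₙ!)`. -/
noncomputable def bwInner {m : ℕ} (p q : MvPolynomial (Fin m) ℝ) : ℝ :=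
  ∑ j ∈ p.support ∪ q.support,
    (p.coeff j * q.coeff j) / (Nat.multinomial Finset.univ j : ℝ)

/-- Bombieri–Weyl norm of one polynomial. -/
noncomputable def bwNorm {m : ℕ} (p : MvPolynomial (Fin m) ℝ) : ℝ :=
  Real.sqrt (bwInner p p)

/-- Bombieri–Weyl norm `‖f‖_W` of a system `f = (f_1, …, f_n)`. -/
noncomputable def bwNormSys {n : ℕ} (f : Fin n → MvPolynomial (Fin (n + 1)) ℝ) : ℝ :=
  Real.sqrt (∑ i, bwInner (f i) (f i))

/-- Distance (w.r.t. the Bombieri–Weyl norm) from a system `f` to a set `S` of systems. -/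
noncomputable def bwDist {n : ℕ} (f : Fin n → MvPolynomial (Fin (n + 1)) ℝ)
    (S : Set (Fin n → MvPolynomial (Fin (n + 1)) ℝ)) : ℝ :=
  sInf ((fun g => bwNormSys (f - g)) '' S)

/-- The unit sphere `Sⁿ ⊆ ℝ^{n+1}`. -/
def unitSphere (n : ℕ) : Set (Fin (n + 1) → ℝ) := {x | ∑ k, x k ^ 2 = 1}

/-- `f` belongs to `H_d`: each component is homogeneous of degree `d i`. -/
def IsSystem {n : ℕ} (d : Fin n → ℕ) (f : Fin n → MvPolynomial (Fin (n + 1)) ℝ) : Prop :=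
  ∀ i, (f i).IsHomogeneous (d i)

/-- The derivative `Df(x)` restricted to the tangent space `T_x Sⁿ = x^⊥` is singular,
i.e. it kills some nonzero tangent vector `v`. -/
def SingularAt {n : ℕ} (f : Fin n → MvPolynomial (Fin (n + 1)) ℝ)
    (x : Fin (n + 1) → ℝ) : Prop :=
  ∃ v : Fin (n + 1) → ℝ, v ≠ 0 ∧ (∑ k, v k * x k = 0) ∧
    ∀ i, ∑ k, MvPolynomial.eval x (MvPolynomial.pderiv k (f i)) * v k = 0

/-- `Σ_ℝ(x)`: the systems in `H_d` having `x` as a multiple zero. -/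
def SigmaRx {n : ℕ} (d : Fin n → ℕ) (x : Fin (n + 1) → ℝ) :
    Set (Fin n → MvPolynomial (Fin (n + 1)) ℝ) :=
  {g | IsSystem d g ∧ (∀ i, MvPolynomial.eval x (g i) = 0) ∧ SingularAt g x}

/-- `Σ_ℝ = ⋃_{x ∈ Sⁿ} Σ_ℝ(x)`: the systems in `H_d` with a multiple zero on `Sⁿ`. -/
def SigmaR {n : ℕ} (d : Fin n → ℕ) : Set (Fin n → MvPolynomial (Fin (n + 1)) ℝ) :=
  ⋃ x ∈ unitSphere n, SigmaRx d x

/-- The smallest singular value of `diag(1/√dᵢ) · Df(x)|_{T_x Sⁿ}`, i.e.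
`inf {‖diag(1/√dᵢ)·Df(x) v‖₂ : v ⊥ x, ‖v‖₂ = 1}`.  This equals
`‖f‖_W · μ̃_norm(f,x)⁻¹`, where `μ̃_norm(f,x) = ‖f‖_W ‖(Df(x)|_{T_x Sⁿ})⁻¹ diag(√dᵢ)‖`
(spectral norm, `+∞` when `Df(x)|_{T_x Sⁿ}` is singular); it is `0` exactly
when `μ̃_norm(f,x) = +∞`. -/
noncomputable def sigmaMin {n : ℕ} (d : Fin n → ℕ)
    (f : Fin n → MvPolynomial (Fin (n + 1)) ℝ) (x : Fin (n + 1) → ℝ) : ℝ :=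
  sInf ((fun v => Real.sqrt (∑ i,
      ((∑ k, MvPolynomial.eval x (MvPolynomial.pderiv k (f i)) * v k) / Real.sqrt (d i)) ^ 2)) ''
    {v : Fin (n + 1) → ℝ | (∑ k, v k * x k = 0) ∧ ∑ k, v k ^ 2 = 1})

/-- `κ̃(f, x) = ‖f‖_W / (‖f‖_W² μ̃_norm(f,x)⁻² + ‖f(x)‖₂²)^{1/2}` as an extended
nonnegative real (value `+∞` when `f` has `x` as multiple zero), using
`‖f‖_W² μ̃_norm(f,x)⁻² = (sigmaMin d f x)²`. -/
noncomputable def kappaAt {n : ℕ} (d : Fin n → ℕ)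
    (f : Fin n → MvPolynomial (Fin (n + 1)) ℝ) (x : Fin (n + 1) → ℝ) : ℝ≥0∞ :=
  ENNReal.ofReal (bwNormSys f) /
    ENNReal.ofReal (Real.sqrt (sigmaMin d f x ^ 2 + ∑ i, (MvPolynomial.eval x (f i)) ^ 2))

/-- `κ̃(f) = max_{x ∈ Sⁿ} κ̃(f, x)`. -/
noncomputable def kappa {n : ℕ} (d : Fin n → ℕ)
    (f : Fin n → MvPolynomial (Fin (n + 1)) ℝ) : ℝ≥0∞ :=
  ⨆ x ∈ unitSphere n, kappaAt d f x


open MeasureTheory Metric RealInnerProductSpace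

namespace KappaAverage

open ProbabilityTheory

/-- Weighted form of the area inequality: no injectivity is needed. -/
theorem lintegral_image_le_lintegral_abs_det_fderiv_mul {E : Type*} [NormedAddCommGroup E]
    [NormedSpace ℝ E] [FiniteDimensional ℝ E] [MeasurableSpace E] [BorelSpace E]
    (μ : Measure E) [μ.IsAddHaarMeasure] {s : Set E} {f : E → E} {f' : E → E →L[ℝ] E}
    (hs : MeasurableSet s) (hfm : Measurable f) (hf' : ∀ x ∈ s, HasFDerivWithinAt f (f' x) s x)
    {g : E → ℝ≥0∞} (hg : Measurable g) :
    ∫⁻ x in f '' s, g x ∂μ ≤ ∫⁻ x in s, ENNReal.ofReal |(f' x).det| * g (f x) ∂μ := by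
  have hdet : AEMeasurable (fun x => ENNReal.ofReal |(f' x).det|) (μ.restrict s) :=
    aemeasurable_ofReal_abs_det_fderivWithin μ hs hf'
  set ν : Measure E :=
    ((μ.restrict s).withDensity fun x => ENNReal.ofReal |(f' x).det|).map f with hν
  have hle : μ.restrict (f '' s) ≤ ν := by
    refine Measure.le_iff.2 fun t ht => ?_
    have hms : MeasurableSet (s ∩ f ⁻¹' t) := hs.inter (hfm ht)
    have himg : t ∩ f '' s = f '' (s ∩ f ⁻¹' t) := by
      rw [Set.image_inter_preimage, Set.inter_comm]
    rw [Measure.restrict_apply ht, himg, hν, Measure.map_apply hfm ht]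
    refine (addHaar_image_le_lintegral_abs_det_fderiv μ hms
      fun x hx => (hf' x hx.1).mono Set.inter_subset_left).trans ?_
    refine le_trans ?_ (withDensity_apply_le _ _)
    rw [Measure.restrict_restrict (hfm ht), Set.inter_comm]
  calc ∫⁻ x in f '' s, g x ∂μ ≤ ∫⁻ x, g x ∂ν := lintegral_mono' hle le_rfl
    _ = ∫⁻ x, g (f x) ∂((μ.restrict s).withDensity fun x => ENNReal.ofReal |(f' x).det|) :=
        lintegral_map hg hfm
    _ = _ := by
        exact lintegral_withDensity_eq_lintegral_mul₀ hdet (hg.comp hfm).aemeasurable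

/-- The block determinant behind the area inequality: a shear composed with a Schur complement. -/
theorem det_shear {V X : Type*} [NormedAddCommGroup V] [NormedSpace ℝ V] [FiniteDimensional ℝ V]
    [NormedAddCommGroup X] [NormedSpace ℝ X] [FiniteDimensional ℝ X]
    (K : V →L[ℝ] X) (P : X →L[ℝ] V) (A : X →L[ℝ] V) (R : X →L[ℝ] X) (T : V × X →L[ℝ] V × X)
    (hT : ∀ v x, T (v, x) = (v - A x - P (K v + R x), K v + R x)) :
    T.det = (R + K ∘L A).det := by
  classical
  have h1 : (T : V × X →ₗ[ℝ] V × X) =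
      ((LinearMap.fst ℝ V X - (P : X →ₗ[ℝ] V) ∘ₗ LinearMap.snd ℝ V X).prod (LinearMap.snd ℝ V X)) ∘ₗ
      ((LinearMap.fst ℝ V X - (A : X →ₗ[ℝ] V) ∘ₗ LinearMap.snd ℝ V X).prod
        ((K : V →ₗ[ℝ] X) ∘ₗ LinearMap.fst ℝ V X + (R : X →ₗ[ℝ] X) ∘ₗ LinearMap.snd ℝ V X)) := by
    apply LinearMap.ext
    rintro ⟨v, x⟩
    simp [hT]
  let bV := Module.finBasis ℝ V
  let bX := Module.finBasis ℝ X
  have key : ∀ (A' : X →ₗ[ℝ] V) (K' : V →ₗ[ℝ] X) (R' : X →ₗ[ℝ] X),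
      LinearMap.det ((LinearMap.fst ℝ V X - A' ∘ₗ LinearMap.snd ℝ V X).prod
        (K' ∘ₗ LinearMap.fst ℝ V X + R' ∘ₗ LinearMap.snd ℝ V X)) =
      LinearMap.det (R' + K' ∘ₗ A') := by
    intro A' K' R'
    rw [← LinearMap.det_toMatrix (bV.prod bX), ← LinearMap.det_toMatrix bX]
    have : LinearMap.toMatrix (bV.prod bX) (bV.prod bX)
        ((LinearMap.fst ℝ V X - A' ∘ₗ LinearMap.snd ℝ V X).prod
        (K' ∘ₗ LinearMap.fst ℝ V X + R' ∘ₗ LinearMap.snd ℝ V X)) =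
        Matrix.fromBlocks 1 (-LinearMap.toMatrix bX bV A') (LinearMap.toMatrix bV bX K')
          (LinearMap.toMatrix bX bX R') := by
      ext i j
      rcases i with i | i <;> rcases j with j | j <;>
        simp [LinearMap.toMatrix_apply, Matrix.one_apply, Finsupp.single_apply, eq_comm]
    rw [this, Matrix.det_fromBlocks_one₁₁, map_add, LinearMap.toMatrix_comp bX bV bX]
    simp
  change LinearMap.det (T : V × X →ₗ[ℝ] V × X) = LinearMap.det (R + K ∘L A : X →L[ℝ] X).toLinearMap
  rw [h1, LinearMap.det_comp, key]
  have h2 := key P 0 LinearMap.id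
  simp only [LinearMap.zero_comp, zero_add, LinearMap.id_comp, add_zero, LinearMap.det_id] at h2
  rw [h2, one_mul]
  rfl

/-- An inequality of Kac-Rice type: the weight of the set of those `f` which solve the affine
equations `K θ f = k θ` for some parameter `θ`, under side conditions recorded by `S`. -/
theorem lintegral_image_fst_mul_le {V X : Type*} [NormedAddCommGroup V] [NormedSpace ℝ V]
    [FiniteDimensional ℝ V] [MeasurableSpace V] [BorelSpace V]
    [NormedAddCommGroup X] [NormedSpace ℝ X] [FiniteDimensional ℝ X] [MeasurableSpace X]
    [BorelSpace X] (μ : Measure V) [μ.IsAddHaarMeasure] (ν : Measure X) [ν.IsAddHaarMeasure]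
    {Ω : Set X} (hΩ : IsOpen Ω) (K : X → V →L[ℝ] X) (P : X → X →L[ℝ] V) (k : X → X)
    (hK : ∀ θ ∈ Ω, DifferentiableAt ℝ K θ) (hP : ∀ θ ∈ Ω, DifferentiableAt ℝ P θ)
    (hk : ∀ θ ∈ Ω, DifferentiableAt ℝ k θ)
    (hKm : Measurable K) (hPm : Measurable P) (hkm : Measurable k)
    (hKP : ∀ θ ∈ Ω, ∀ x, K θ (P θ x) = x) {S : Set (V × X)} (hS : MeasurableSet S)
    (hSΩ : ∀ p ∈ S, p.2 ∈ Ω ∧ K p.2 p.1 = k p.2)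
    {w : V → ℝ≥0∞} (hw : Measurable w) {ψ : X → ℝ≥0∞} (hψ : Measurable ψ) :
    (∫⁻ f in Prod.fst '' S, w f ∂μ) * ∫⁻ c, ψ c ∂ν ≤
      ∫⁻ θ, ∫⁻ h, Set.indicator {p : V × X | (p.1 - P p.2 (K p.2 p.1 - k p.2), p.2) ∈ S}
        (fun p => ENNReal.ofReal |(fderiv ℝ (fun θ' => K θ' (p.1 - P p.2 (K p.2 p.1 - k p.2)) - k θ')
          p.2).det| * (w (p.1 - P p.2 (K p.2 p.1 - k p.2)) * ψ (K p.2 p.1))) (h, θ) ∂μ ∂ν := by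
  set F : V × X → V := fun p => p.1 - P p.2 (K p.2 p.1 - k p.2) with hF
  set s : Set (V × X) := {p : V × X | (F p, p.2) ∈ S} with hs
  have hcm : Measurable fun p : V × X => K p.2 p.1 :=
    (ContinuousLinearMap.apply ℝ X : V →L[ℝ] _).continuous₂.measurable.comp
      (measurable_fst.prodMk (hKm.comp measurable_snd))
  have hFm : Measurable F := by
    refine measurable_fst.sub ?_
    exact (ContinuousLinearMap.apply ℝ V : X →L[ℝ] _).continuous₂.measurable.comp
      ((hcm.sub (hkm.comp measurable_snd)).prodMk (hPm.comp measurable_snd))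
  have hsm : MeasurableSet s := (hFm.prodMk measurable_snd) hS
  set Ψ : V × X → V × X := fun p => (F p, K p.2 p.1) with hΨ
  have hΨm : Measurable Ψ := hFm.prodMk hcm
  set Ψ' : V × X → V × X →L[ℝ] V × X := fun p => fderiv ℝ Ψ p with hΨ'
  have hdiff : ∀ p ∈ s, HasFDerivAt Ψ (Ψ' p) p ∧ (Ψ' p).det =
      (fderiv ℝ (fun θ' => K θ' (F p) - k θ') p.2).det := by
    rintro ⟨h, θ⟩ hp
    have hθ : θ ∈ Ω := (hSΩ _ hp).1
    obtain ⟨K', hK'⟩ := hK θ hθ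
    obtain ⟨P', hP'⟩ := hP θ hθ
    obtain ⟨k', hk'⟩ := hk θ hθ
    have hc : HasFDerivAt (fun p : V × X => K p.2 p.1)
        ((K θ) ∘L (ContinuousLinearMap.fst ℝ V X) +
          (K' ∘L (ContinuousLinearMap.snd ℝ V X)).flip h) (h, θ) :=
      HasFDerivAt.clm_apply (c := fun p : V × X => K p.2) (u := fun p : V × X => p.1)
        (HasFDerivAt.comp (h, θ) (g := K) (f := Prod.snd) hK' hasFDerivAt_snd) hasFDerivAt_fst
    have hk2 : HasFDerivAt (fun p : V × X => k p.2) (k' ∘L (ContinuousLinearMap.snd ℝ V X)) (h, θ) :=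
      HasFDerivAt.comp (h, θ) (g := k) (f := Prod.snd) hk' hasFDerivAt_snd
    have hP2 := HasFDerivAt.clm_apply (c := fun p : V × X => P p.2)
        (u := fun p : V × X => K p.2 p.1 - k p.2)
        (HasFDerivAt.comp (h, θ) (g := P) (f := Prod.snd) hP' hasFDerivAt_snd) (hc.sub hk2)
    have hΨd := (hasFDerivAt_fst.sub hP2).prodMk hc
    have hfd : HasFDerivAt Ψ (Ψ' (h, θ)) (h, θ) := by
      have : DifferentiableAt ℝ Ψ (h, θ) := hΨd.differentiableAt
      exact this.hasFDerivAt
    refine ⟨hfd, ?_⟩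
    have hM : HasFDerivAt (fun θ' => K θ' (F (h, θ)) - k θ') (K'.flip (F (h, θ)) - k') θ := by
      have := (hK'.clm_apply (hasFDerivAt_const (F (h, θ)) θ)).sub hk'
      refine this.congr_fderiv ?_
      ext; simp
    rw [hM.fderiv]
    have hKP' : ∀ x t, K' t (P θ x) + K θ (P' t x) = 0 := by
      intro x t
      have h1 := hK'.clm_apply (hP'.clm_apply (hasFDerivAt_const x θ))
      have h2 : HasFDerivAt (fun θ => K θ (P θ x)) (0 : X →L[ℝ] X) θ :=
        (hasFDerivAt_const x θ).congr_of_eventuallyEq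
          (Filter.eventually_of_mem (hΩ.mem_nhds hθ) fun y hy => hKP y hy x)
      have h3 := DFunLike.congr_fun (h1.unique h2) t
      simpa [add_comm] using h3
    have hdet := det_shear (K θ) (P θ) (P'.flip (K θ h - k θ) - P θ ∘L k') (K'.flip h)
      (Ψ' (h, θ)) (by
        intro v x
        rw [hfd.unique hΨd]
        simp only [ContinuousLinearMap.prod_apply, _root_.sub_apply,
          _root_.add_apply, ContinuousLinearMap.comp_apply,
          ContinuousLinearMap.coe_fst', ContinuousLinearMap.coe_snd',
          ContinuousLinearMap.flip_apply, map_add, map_sub, Prod.mk.injEq, and_true]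
        abel)
    rw [hdet]
    congr 1
    ext t
    simp only [_root_.sub_apply,
          _root_.add_apply, ContinuousLinearMap.comp_apply,
          ContinuousLinearMap.flip_apply, map_sub, hKP θ hθ, hF]
    have := hKP' (K θ h - k θ) t
    simp only [map_sub] at this ⊢
    rw [← sub_eq_zero, ← this]
    abel
  have himg : Ψ '' s = (Prod.fst '' S) ×ˢ (Set.univ : Set X) := by
    ext ⟨f, c⟩
    simp only [Set.mem_image, Set.mem_prod, Set.mem_univ, and_true]
    constructor
    · rintro ⟨⟨h, θ⟩, hp, heq⟩
      exact ⟨_, hp, (Prod.ext_iff.1 heq).1⟩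
    · rintro ⟨⟨f', θ⟩, hp, rfl⟩
      obtain ⟨hθ, hKf⟩ := hSΩ _ hp
      simp only at hθ hKf ⊢
      have h1 : F (f' + P θ (c - k θ), θ) = f' := by
        simp only [hF, map_add, hKP θ hθ, hKf]
        simp
      refine ⟨(f' + P θ (c - k θ), θ), ?_, ?_⟩
      · simp only [hs, Set.mem_ofPred_eq, h1]; exact hp
      · simp only [hΨ, h1, map_add, hKP θ hθ, hKf]
        simp
  have hg : Measurable fun q : V × X => w q.1 * ψ q.2 :=
    (hw.comp measurable_fst).mul (hψ.comp measurable_snd)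
  have main := lintegral_image_le_lintegral_abs_det_fderiv_mul (μ.prod ν) hsm hΨm
    (fun p hp => (hdiff p hp).1.hasFDerivWithinAt) hg
  rw [himg, ← Measure.prod_restrict, lintegral_prod_mul hw.aemeasurable hψ.aemeasurable,
    Measure.restrict_univ] at main
  refine main.trans ?_
  have hdm : AEMeasurable (fun p => ENNReal.ofReal |(Ψ' p).det|) ((μ.prod ν).restrict s) :=
    aemeasurable_ofReal_abs_det_fderivWithin _ hsm fun p hp => (hdiff p hp).1.hasFDerivWithinAt
  have hdm' : AEMeasurable (s.indicator fun p => ENNReal.ofReal |(Ψ' p).det| *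
      (w (Ψ p).1 * ψ (Ψ p).2)) (μ.prod ν) :=
    (aemeasurable_indicator_iff hsm).2 (hdm.mul (hg.comp hΨm).aemeasurable)
  rw [← lintegral_indicator hsm, lintegral_prod_symm _ hdm']
  refine lintegral_mono fun θ => lintegral_mono fun h => ?_
  by_cases hp : (h, θ) ∈ s
  · rw [Set.indicator_of_mem hp, Set.indicator_of_mem hp, (hdiff _ hp).2]
  · rw [Set.indicator_of_notMem hp]; exact zero_le

theorem integral_sq_gaussianReal : ∫ x, x ^ 2 ∂(gaussianReal 0 1) = 1 := by
  have h := variance_eq_sub (IsGaussian.memLp_two_id (μ := gaussianReal 0 1))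
  rw [variance_id_gaussianReal] at h
  simp only [Pi.pow_apply, id_eq] at h
  rw [integral_id_gaussianReal] at h
  simpa using h.symm

theorem integrable_sq_gaussianReal : Integrable (fun x : ℝ => x ^ 2) (gaussianReal 0 1) :=
  (IsGaussian.memLp_two_id (μ := gaussianReal 0 1)).integrable_sq

theorem lintegral_sq_gaussianReal : ∫⁻ x, ENNReal.ofReal (x ^ 2) ∂(gaussianReal 0 1) = 1 := by
  rw [← ofReal_integral_eq_lintegral_ofReal integrable_sq_gaussianReal
    (Filter.Eventually.of_forall fun _ => sq_nonneg _), integral_sq_gaussianReal, ENNReal.ofReal_one]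

section Gaussian

variable {V : Type*} [NormedAddCommGroup V] [InnerProductSpace ℝ V] [FiniteDimensional ℝ V]
  [MeasurableSpace V] [BorelSpace V]

/-- The unnormalized standard Gaussian density. -/
noncomputable def gaussWeight {V : Type*} [NormedAddCommGroup V] (v : V) : ℝ≥0∞ := ENNReal.ofReal (Real.exp (-(1 / 2) * ‖v‖ ^ 2))

theorem measurable_gaussWeight {V : Type*} [NormedAddCommGroup V] [MeasurableSpace V]
    [BorelSpace V] : Measurable (gaussWeight : V → ℝ≥0∞) := by
  unfold gaussWeight; fun_prop

/-- The total mass of the unnormalized standard Gaussian density in dimension `k`. -/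
noncomputable def gaussMass (k : ℕ) : ℝ≥0∞ := ENNReal.ofReal ((2 * Real.pi) ^ ((k : ℝ) / 2))

theorem gaussMass_ne_zero (k : ℕ) : gaussMass k ≠ 0 := by
  simp only [gaussMass, ne_eq, ENNReal.ofReal_eq_zero, not_le]; positivity

theorem gaussMass_ne_top (k : ℕ) : gaussMass k ≠ ⊤ := ENNReal.ofReal_ne_top

theorem lintegral_gaussWeight : ∫⁻ v : V, gaussWeight v = gaussMass (Module.finrank ℝ V) := by
  unfold gaussWeight gaussMass
  rw [← ofReal_integral_eq_lintegral_ofReal, GaussianFourier.integral_rexp_neg_mul_sq_norm (by norm_num)]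
  · congr 2; ring
  · by_contra h
    have h1 := GaussianFourier.integral_rexp_neg_mul_sq_norm (V := V) (b := 1 / 2) (by norm_num)
    rw [integral_undef h] at h1
    have : 0 < (Real.pi / (1 / 2)) ^ (Module.finrank ℝ V / 2 : ℝ) := by positivity
    linarith
  · exact Filter.Eventually.of_forall fun _ => (Real.exp_pos _).le

theorem withDensity_gaussWeight :
    (volume : Measure V).withDensity gaussWeight =
      gaussMass (Module.finrank ℝ V) • stdGaussian V := by
  have : IsFiniteMeasure ((volume : Measure V).withDensity gaussWeight) :=
    isFiniteMeasure_withDensity (by rw [lintegral_gaussWeight]; exact gaussMass_ne_top _)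
  have : IsFiniteMeasure (gaussMass (Module.finrank ℝ V) • stdGaussian V) :=
    Measure.smul_finite _ (gaussMass_ne_top _)
  apply Measure.ext_of_charFun
  ext t
  have h1 : charFun (gaussMass (Module.finrank ℝ V) • stdGaussian V) t =
      ((2 * Real.pi) ^ ((Module.finrank ℝ V : ℝ) / 2) : ℝ) * Complex.exp (-‖t‖ ^ 2 / 2) := by
    rw [charFun_apply, integral_smul_measure, ← charFun_apply, charFun_stdGaussian, gaussMass,
      ENNReal.toReal_ofReal (by positivity), Complex.real_smul]
  rw [h1, charFun_apply, integral_withDensity_eq_integral_toReal_smul measurable_gaussWeight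
    (Filter.Eventually.of_forall fun _ => ENNReal.ofReal_lt_top)]
  have h2 := GaussianFourier.integral_cexp_neg_mul_sq_norm_add (V := V) (b := 1 / 2)
    (by norm_num) Complex.I t
  have h3 : ∀ v : V, (gaussWeight v).toReal • Complex.exp (⟪v, t⟫ * Complex.I) =
      Complex.exp (-(1 / 2) * ‖v‖ ^ 2 + Complex.I * ⟪t, v⟫) := by
    intro v
    rw [gaussWeight, ENNReal.toReal_ofReal (Real.exp_pos _).le, Complex.real_smul,
      Complex.ofReal_exp, ← Complex.exp_add, real_inner_comm]
    congr 1
    push_cast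
    ring
  simp_rw [h3]
  rw [h2]
  congr 1
  · rw [Complex.ofReal_cpow (by positivity)]
    congr 1
    · push_cast; field_simp
    · push_cast; rfl
  · congr 1
    rw [Complex.I_sq]; ring

theorem lintegral_gaussWeight_mul (G : V → ℝ≥0∞) :
    ∫⁻ v, gaussWeight v * G v =
      gaussMass (Module.finrank ℝ V) * ∫⁻ v, G v ∂(stdGaussian V) := by
  have := lintegral_withDensity_eq_lintegral_mul_non_measurable (volume : Measure V)
    (f := gaussWeight) measurable_gaussWeight
    (Filter.Eventually.of_forall fun _ => ENNReal.ofReal_lt_top) G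
  simp only [Pi.mul_apply] at this
  rw [← this, withDensity_gaussWeight, lintegral_smul_measure, smul_eq_mul]

/-- Coordinates of a standard Gaussian vector along an orthonormal family are independent
standard Gaussians. -/
theorem map_inner_stdGaussian {ι : Type*} [Fintype ι] {u : ι → V} (hu : Orthonormal ℝ u) :
    (stdGaussian V).map (fun h a => ⟪u a, h⟫) = Measure.pi fun _ : ι => gaussianReal 0 1 := by
  classical
  let L : V → EuclideanSpace ℝ ι := fun h => WithLp.toLp 2 fun a => ⟪u a, h⟫
  have hLm : Measurable L := by
    have : Continuous L := by
      apply (PiLp.continuous_toLp 2 _).comp; fun_prop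
    exact this.measurable
  have h1 : (stdGaussian V).map L = stdGaussian (EuclideanSpace ℝ ι) := by
    have : IsProbabilityMeasure ((stdGaussian V).map L) :=
      Measure.isProbabilityMeasure_map hLm.aemeasurable
    apply Measure.ext_of_charFun
    ext t
    rw [charFun_apply, integral_map hLm.aemeasurable (by fun_prop)]
    have : ∀ h, ⟪L h, t⟫ = ⟪h, ∑ a, t a • u a⟫ := by
      intro h
      simp only [L, PiLp.inner_apply, inner_sum, inner_smul_right, real_inner_comm h]
      simp [mul_comm]
    simp_rw [this]
    rw [← charFun_apply, charFun_stdGaussian, charFun_stdGaussian]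
    congr 3
    have h2 : ‖∑ a, t a • u a‖ ^ 2 = ‖t‖ ^ 2 := by
      rw [← real_inner_self_eq_norm_sq, hu.inner_sum, EuclideanSpace.real_norm_sq_eq]
      simp [sq]
    exact_mod_cast h2
  have h2 : (fun h a => ⟪u a, h⟫ : V → ι → ℝ) = (WithLp.ofLp) ∘ L := rfl
  rw [h2, ← Measure.map_map (by fun_prop) hLm, h1, ← map_pi_eq_stdGaussian,
    Measure.map_map (by fun_prop) (by fun_prop)]
  simp [Function.comp_def]

/-- The same with a doubly indexed family. -/
theorem map_inner_stdGaussian_prod {ι κ : Type*} [Fintype ι] [Fintype κ] {u : ι → κ → V}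
    (hu : Orthonormal ℝ fun p : ι × κ => u p.1 p.2) :
    (stdGaussian V).map (fun h a b => ⟪u a b, h⟫) =
      Measure.pi fun _ : ι => Measure.pi fun _ : κ => gaussianReal 0 1 := by
  have h1 := map_inner_stdGaussian hu
  have h2 := Measure.infinitePi_map_curry (fun (_ : ι) (_ : κ) => gaussianReal 0 1)
  simp only [Measure.infinitePi_eq_pi] at h2
  rw [← h2, ← h1, Measure.map_map (by fun_prop) (by fun_prop)]
  rfl

theorem lintegral_norm_sq_stdGaussian :
    ∫⁻ h, ENNReal.ofReal (‖h‖ ^ 2) ∂(stdGaussian V) = Module.finrank ℝ V := by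
  have b := stdOrthonormalBasis ℝ V
  have h1 := map_inner_stdGaussian b.orthonormal
  have h2 : ∀ h : V, ENNReal.ofReal (‖h‖ ^ 2) = ∑ i, ENNReal.ofReal (⟪b i, h⟫ ^ 2) := by
    intro h
    rw [← b.sum_sq_inner_right, ENNReal.ofReal_sum_of_nonneg fun _ _ => sq_nonneg _]
  simp_rw [h2]
  rw [lintegral_finsetSum _ (by fun_prop)]
  have h3 : ∀ i, ∫⁻ h, ENNReal.ofReal (⟪b i, h⟫ ^ 2) ∂(stdGaussian V) = 1 := by
    intro i
    have h4 : ∫⁻ x : Fin (Module.finrank ℝ V) → ℝ, ENNReal.ofReal ((x i) ^ 2)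
        ∂(Measure.pi fun _ => gaussianReal 0 1) = 1 :=
      ((measurePreserving_eval (fun _ : Fin (Module.finrank ℝ V) => gaussianReal 0 1) i).lintegral_comp
        (f := fun y => ENNReal.ofReal (y ^ 2)) (by fun_prop)).trans lintegral_sq_gaussianReal
    rw [← h1, lintegral_map (by fun_prop) (by fun_prop)] at h4
    exact h4
  simp [h3]

theorem lintegral_norm_le_stdGaussian {a : ℝ} (ha : 0 < a) :
    ∫⁻ h : V, Set.indicator {h : V | ‖h‖ ≤ a} 1 h ∂(stdGaussian V) ≥
      1 - Module.finrank ℝ V / ENNReal.ofReal (a ^ 2) := by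
  have hm : MeasurableSet {h : V | ‖h‖ ≤ a} := measurableSet_le measurable_norm measurable_const
  rw [lintegral_indicator_one hm]
  have h1 := meas_ge_le_lintegral_div (μ := stdGaussian V) (f := fun h => ENNReal.ofReal (‖h‖ ^ 2))
    (by fun_prop) (ε := ENNReal.ofReal (a ^ 2)) (by simp; positivity) ENNReal.ofReal_ne_top
  rw [lintegral_norm_sq_stdGaussian] at h1
  have h2 : {h : V | ‖h‖ ≤ a}ᶜ ⊆ {x | ENNReal.ofReal (a ^ 2) ≤ ENNReal.ofReal (‖x‖ ^ 2)} := by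
    intro x hx
    simp only [Set.mem_compl_iff, Set.mem_ofPred_eq, not_le] at hx ⊢
    exact ENNReal.ofReal_le_ofReal (by gcongr)
  have h3 := prob_add_prob_compl (μ := stdGaussian V) hm
  rw [ge_iff_le, tsub_le_iff_right, ← h3]
  gcongr
  exact (measure_mono h2).trans h1

end Gaussian

section Determinant

open Matrix

/-- Expected value of the determinant of a Gaussian rank-one perturbation. -/
theorem lintegral_det_add_vecMulVec {n : ℕ} {M : Matrix (Fin n) (Fin n) ℝ} (hM : M.PosDef) :
    ∫⁻ g, ENNReal.ofReal (M + vecMulVec g g).det ∂(Measure.pi fun _ : Fin n => gaussianReal 0 1) =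
      ENNReal.ofReal (M.det + ∑ k, M.adjugate k k) := by
  have hdet : ∀ g : Fin n → ℝ, (M + vecMulVec g g).det =
      M.det + ∑ k, ∑ l, M.adjugate k l * (g k * g l) := by
    intro g
    rw [vecMulVec_eq Unit, det_add_replicateCol_mul_replicateRow hM.det_pos.ne'.isUnit, det_unique (n := Unit)]
    simp only [Matrix.add_apply, one_apply_eq, mul_add, mul_one]
    congr 1
    have : M.adjugate = M.det • M⁻¹ := by
      rw [Matrix.inv_def, Ring.inverse_eq_inv', smul_smul, mul_inv_cancel₀ hM.det_pos.ne', one_smul]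
    simp only [this, Matrix.mul_apply, replicateRow_apply, replicateCol_apply, Matrix.smul_apply, smul_eq_mul]
    rw [Finset.sum_comm, Finset.mul_sum]
    refine Finset.sum_congr rfl fun k _ => ?_
    rw [Finset.sum_mul, Finset.mul_sum]
    refine Finset.sum_congr rfl fun l _ => ?_
    ring
  set γ := Measure.pi fun _ : Fin n => gaussianReal 0 1 with hγ
  have hint : ∀ k l, Integrable (fun g : Fin n → ℝ => g k * g l) γ ∧
      ∫ g, g k * g l ∂γ = if k = l then 1 else 0 := by
    intro k l
    by_cases h : k = l
    · subst h
      have hp := measurePreserving_eval (fun _ : Fin n => gaussianReal 0 1) k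
      simp only [if_true, ← sq]
      constructor
      · exact hp.integrable_comp_of_integrable integrable_sq_gaussianReal
      · rw [← integral_sq_gaussianReal, ← hp.map_eq, integral_map hp.measurable.aemeasurable
          (by fun_prop)]
    · have hind : IndepFun (fun g : Fin n → ℝ => g k) (fun g => g l) γ :=
        (iIndepFun_pi (X := fun _ => id) fun _ => aemeasurable_id).indepFun h
      have hi : ∀ k, Integrable (fun g : Fin n → ℝ => g k) γ := fun k =>
        (measurePreserving_eval (fun _ : Fin n => gaussianReal 0 1) k).integrable_comp_of_integrable
          (g := id) IsGaussian.integrable_id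
      refine ⟨hind.integrable_mul (hi k) (hi l), ?_⟩
      have h1 := hind.integral_mul_eq_mul_integral (hi k).aestronglyMeasurable (hi l).aestronglyMeasurable
      have h0 : ∫ g, g k ∂γ = 0 := by
        have hp := measurePreserving_eval (fun _ : Fin n => gaussianReal 0 1) k
        rw [← integral_id_gaussianReal (μ := 0) (v := 1), ← hp.map_eq,
          integral_map hp.measurable.aemeasurable (by fun_prop)]
      rw [if_neg h]
      simpa [h0] using h1
  simp_rw [hdet]
  have hI : Integrable (fun g : Fin n → ℝ => M.det + ∑ k, ∑ l, M.adjugate k l * (g k * g l)) γ :=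
    (integrable_const _).add (integrable_finsetSum _ fun k _ => integrable_finsetSum _ fun l _ =>
      (hint k l).1.const_mul _)
  rw [← ofReal_integral_eq_lintegral_ofReal hI]
  · congr 1
    have hI2 : Integrable (fun g : Fin n → ℝ => ∑ k, ∑ l, M.adjugate k l * (g k * g l)) γ :=
      integrable_finsetSum _ fun k _ => integrable_finsetSum _ fun l _ => (hint k l).1.const_mul _
    rw [integral_add (integrable_const _) hI2, integral_finsetSum (μ := γ) univ
      (f := fun k (g : Fin n → ℝ) => ∑ l, M.adjugate k l * (g k * g l))
      fun k _ => integrable_finsetSum _ fun l _ => (hint k l).1.const_mul _]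
    simp only [integral_const, probReal_univ, one_smul]
    congr 1
    refine Finset.sum_congr rfl fun k _ => ?_
    rw [integral_finsetSum _ fun l _ => (hint k l).1.const_mul _]
    simp_rw [integral_const_mul, (hint k _).2]
    simp
  · refine Filter.Eventually.of_forall fun g => ?_
    simp only [Pi.zero_apply]
    rw [← hdet]
    have : (vecMulVec g g).PosSemidef := by
      simpa using posSemidef_vecMulVec_self_star g
    exact (hM.add_posSemidef this).det_pos.le

/-- Regularized Gram determinant of `r` standard Gaussian vectors in dimension `n`. -/
noncomputable def gramDet (n r : ℕ) (ρ : ℝ) (G : Fin r → Fin n → ℝ) : ℝ :=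
  (ρ • (1 : Matrix (Fin n) (Fin n) ℝ) + ∑ l, vecMulVec (G l) (G l)).det

theorem continuous_gramDet (n r : ℕ) (ρ : ℝ) : Continuous (gramDet n r ρ) := by
  unfold gramDet
  refine Continuous.matrix_det ?_
  refine continuous_const.add (continuous_finsetSum _ fun l _ => ?_)
  exact (continuous_apply l).matrix_vecMulVec (continuous_apply l)

theorem posDef_gram {n r : ℕ} {ρ : ℝ} (hρ : 0 < ρ) (G : Fin r → Fin n → ℝ) :
    (ρ • (1 : Matrix (Fin n) (Fin n) ℝ) + ∑ l, vecMulVec (G l) (G l)).PosDef := by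
  refine (PosDef.smul PosDef.one hρ).add_posSemidef (posSemidef_sum _ fun l _ => ?_)
  simpa using posSemidef_vecMulVec_self_star (G l)

theorem lintegral_gramDet_le {ρ : ℝ} (hρ : 0 < ρ) (r : ℕ) : ∀ n : ℕ, r ≤ n →
    ∫⁻ G, ENNReal.ofReal (gramDet n r ρ G) ∂(Measure.pi fun _ : Fin r => Measure.pi
      fun _ : Fin n => gaussianReal 0 1) ≤
      ENNReal.ofReal (n.descFactorial r * (ρ ^ (n - r) * (1 + ρ) ^ r)) := by
  induction r with
  | zero =>
    intro n _
    simp [gramDet]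
  | succ r ih =>
    intro n hn
    obtain ⟨n, rfl⟩ : ∃ n', n = n' + 1 := ⟨n - 1, by omega⟩
    have hrn : r ≤ n := by omega
    set γ := Measure.pi fun _ : Fin (n + 1) => gaussianReal 0 1 with hγ
    have hmp := (measurePreserving_piFinSuccAbove (fun _ : Fin (r + 1) => γ) 0).symm
    rw [← hmp.lintegral_comp (continuous_gramDet _ _ _).measurable.ennreal_ofReal]
    have hmeas : Measurable fun x => ENNReal.ofReal (gramDet (n + 1) (r + 1) ρ
        ((MeasurableEquiv.piFinSuccAbove (fun _ : Fin (r + 1) => Fin (n + 1) → ℝ) 0).symm x)) := ((continuous_gramDet (n + 1) (r + 1) ρ).measurable.comp hmp.measurable).ennreal_ofReal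
    rw [lintegral_prod_symm _ hmeas.aemeasurable]
    have hin : ∀ G : Fin r → Fin (n + 1) → ℝ, ∫⁻ g, ENNReal.ofReal (gramDet (n + 1) (r + 1) ρ
        ((MeasurableEquiv.piFinSuccAbove (fun _ : Fin (r + 1) => Fin (n + 1) → ℝ) 0).symm (g, G))) ∂γ =
        ENNReal.ofReal (gramDet (n + 1) r ρ G) +
          ∑ k : Fin (n + 1), ENNReal.ofReal (gramDet n r ρ fun l i => G l (k.succAbove i)) := by
      intro G
      have h1 : ∀ g, gramDet (n + 1) (r + 1) ρ
        ((MeasurableEquiv.piFinSuccAbove (fun _ : Fin (r + 1) => Fin (n + 1) → ℝ) 0).symm (g, G)) =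
          ((ρ • 1 + ∑ l, vecMulVec (G l) (G l)) + vecMulVec g g).det := by
        intro g
        rw [gramDet, Fin.sum_univ_succ]
        simp only [MeasurableEquiv.piFinSuccAbove_symm_apply, Fin.insertNthEquiv_apply,
          Fin.insertNth_zero', Fin.cons_zero, Fin.cons_succ]
        congr 1
        abel
      have h2 : ∀ k : Fin (n + 1), (ρ • (1 : Matrix (Fin (n + 1)) (Fin (n + 1)) ℝ) +
          ∑ l, vecMulVec (G l) (G l)).adjugate k k = gramDet n r ρ fun l i => G l (k.succAbove i) := by
        intro k
        rw [adjugate_fin_succ_eq_det_submatrix, gramDet]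
        rw [Even.neg_one_pow ⟨_, rfl⟩, one_mul]
        congr 1
        ext i j
        simp [Matrix.sum_apply, vecMulVec_apply, Matrix.one_apply]
      simp_rw [h1]
      rw [lintegral_det_add_vecMulVec (posDef_gram hρ G), ENNReal.ofReal_add
        (posDef_gram hρ G).det_pos.le, ENNReal.ofReal_sum_of_nonneg]
      · simp_rw [h2]; rfl
      · intro k _; rw [h2]; exact (posDef_gram hρ _).det_pos.le
      · refine Finset.sum_nonneg fun k _ => ?_
        rw [h2]; exact (posDef_gram hρ _).det_pos.le
    simp_rw [hin]
    rw [lintegral_add_left (continuous_gramDet _ _ _).measurable.ennreal_ofReal]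
    have hmpk : ∀ k : Fin (n + 1), MeasurePreserving
        (fun (G : Fin r → Fin (n + 1) → ℝ) (l : Fin r) (i : Fin n) => G l (k.succAbove i))
        (Measure.pi fun _ : Fin r => γ)
        (Measure.pi fun _ : Fin r => Measure.pi fun _ : Fin n => gaussianReal 0 1) := by
      intro k
      refine measurePreserving_pi (fun _ => γ) _ (f := fun _ g i => g (k.succAbove i)) fun _ => ?_
      exact measurePreserving_snd.comp
        (measurePreserving_piFinSuccAbove (fun _ : Fin (n + 1) => gaussianReal 0 1) k)
    have hmk : ∀ k : Fin (n + 1), Measurable fun G : Fin r → Fin (n + 1) → ℝ =>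
        ENNReal.ofReal (gramDet n r ρ fun l i => G l (k.succAbove i)) := fun k =>
      ((continuous_gramDet _ _ _).measurable.comp (hmpk k).measurable).ennreal_ofReal
    rw [lintegral_finsetSum _ fun k _ => hmk k]
    have hk : ∀ k : Fin (n + 1), ∫⁻ G, ENNReal.ofReal (gramDet n r ρ fun l i => G l (k.succAbove i))
        ∂(Measure.pi fun _ : Fin r => γ) ≤
        ENNReal.ofReal (n.descFactorial r * (ρ ^ (n - r) * (1 + ρ) ^ r)) := by
      intro k
      refine le_trans (le_of_eq ?_) (ih n hrn)
      exact (hmpk k).lintegral_comp (f := fun G => ENNReal.ofReal (gramDet n r ρ G))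
        (continuous_gramDet _ _ _).measurable.ennreal_ofReal
    refine (add_le_add (ih (n + 1) (by omega)) (Finset.sum_le_sum fun k _ => hk k)).trans ?_
    rw [Finset.sum_const, Finset.card_univ, Fintype.card_fin, nsmul_eq_mul,
      ← ENNReal.ofReal_natCast (n + 1), ← ENNReal.ofReal_mul (by positivity),
      ← ENNReal.ofReal_add (by positivity) (by positivity)]
    refine ENNReal.ofReal_le_ofReal ?_
    have e1 : n + 1 - r = (n - r) + 1 := by omega
    have e2 : n + 1 - (r + 1) = n - r := by omega
    rw [e1, e2, Nat.succ_descFactorial_succ]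
    have e3 : ((n + 1).descFactorial r : ℝ) ≤ (n + 1 : ℕ) * n.descFactorial r := by
      have := Nat.descFactorial_succ (n + 1) r
      rw [Nat.succ_descFactorial_succ] at this
      have h4 : (n + 1).descFactorial r ≤ (n + 1) * n.descFactorial r := by
        rw [this]; exact Nat.le_mul_of_pos_left _ (by omega)
      exact_mod_cast h4
    push_cast at e3 ⊢
    calc ((n + 1).descFactorial r : ℝ) * (ρ ^ (n - r + 1) * (1 + ρ) ^ r) +
          (n + 1) * (n.descFactorial r * (ρ ^ (n - r) * (1 + ρ) ^ r))
        ≤ ((n + 1) * n.descFactorial r) * (ρ ^ (n - r + 1) * (1 + ρ) ^ r) +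
          (n + 1) * (n.descFactorial r * (ρ ^ (n - r) * (1 + ρ) ^ r)) := by gcongr
      _ = _ := by ring

end Determinant

section Determinant

open Matrix
open scoped MatrixOrder Matrix.Norms.L2Operator

theorem abs_det_le_of_abs_quadratic_le {ι : Type*} [Fintype ι] [DecidableEq ι]
    {H M : Matrix ι ι ℝ} (hH : H.IsSymm) (hM : M.PosDef)
    (h : ∀ ξ : ι → ℝ, |ξ ⬝ᵥ H *ᵥ ξ| ≤ ξ ⬝ᵥ M *ᵥ ξ) : |H.det| ≤ M.det := by
  obtain ⟨C, hC⟩ : ∃ C : Matrix ι ι ℝ, M = Cᵀ * C := by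
    obtain ⟨C, hC⟩ := CStarAlgebra.nonneg_iff_eq_star_mul_self.mp hM.posSemidef.nonneg
    exact ⟨C, by simpa [star_eq_conjTranspose] using hC⟩
  have hdetM : M.det = C.det ^ 2 := by rw [hC, det_mul, det_transpose]; ring
  have hCdet : C.det ≠ 0 := fun h0 => hM.det_pos.ne' (by rw [hdetM, h0]; simp)
  have hCu : IsUnit C.det := hCdet.isUnit
  set H' := C⁻¹ᵀ * H * C⁻¹ with hH'
  have hsymm : H'.IsHermitian := by
    rw [IsHermitian, conjTranspose_eq_transpose_of_trivial, hH', transpose_mul, transpose_mul,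
      transpose_transpose, hH.eq, Matrix.mul_assoc]
  have hev : ∀ i, |hsymm.eigenvalues i| ≤ 1 := by
    intro i
    set v : ι → ℝ := ⇑(hsymm.eigenvectorBasis i) with hv
    have h1 : H' *ᵥ v = hsymm.eigenvalues i • v := hsymm.mulVec_eigenvectorBasis i
    have h2 : v ⬝ᵥ v = 1 := by
      have := hsymm.eigenvectorBasis.orthonormal.1 i
      have h3 : ‖hsymm.eigenvectorBasis i‖ ^ 2 = 1 := by rw [this]; norm_num
      rw [EuclideanSpace.real_norm_sq_eq] at h3
      rw [← h3]; simp [dotProduct, sq, hv]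
    have h4 : v ⬝ᵥ H' *ᵥ v = hsymm.eigenvalues i := by
      rw [h1, dotProduct_smul, h2, smul_eq_mul, mul_one]
    have h5 : v ⬝ᵥ H' *ᵥ v = (C⁻¹ *ᵥ v) ⬝ᵥ H *ᵥ (C⁻¹ *ᵥ v) := by
      rw [hH', ← mulVec_mulVec, ← mulVec_mulVec, dotProduct_mulVec, vecMul_transpose]
    have h6 : (C⁻¹ *ᵥ v) ⬝ᵥ M *ᵥ (C⁻¹ *ᵥ v) = 1 := by
      rw [hC, ← mulVec_mulVec, dotProduct_mulVec, vecMul_transpose, mulVec_mulVec, mul_nonsing_inv _ hCu, one_mulVec, h2]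
    rw [← h4, h5, ← h6]
    exact h _
  have hdetH : H.det = H'.det * M.det := by
    rw [hH', det_mul, det_mul, det_transpose, hdetM, det_nonsing_inv, Ring.inverse_eq_inv']
    field_simp
  rw [hdetH, abs_mul, abs_of_pos hM.det_pos]
  have : |H'.det| ≤ 1 := by
    rw [hsymm.det_eq_prod_eigenvalues, Finset.abs_prod]
    exact Finset.prod_le_one (fun _ _ => abs_nonneg _) fun i _ => by simpa using hev i
  exact mul_le_of_le_one_left hM.det_pos.le this

theorem sq_det_le_gramDet {n : ℕ} {ρ : ℝ} (hρ : 0 < ρ) (G : Fin n → Fin n → ℝ) :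
    (Matrix.of G).det ^ 2 ≤ gramDet n n ρ G := by
  set A : Matrix (Fin n) (Fin n) ℝ := Matrix.of G
  have hA : ∑ l, vecMulVec (G l) (G l) = Aᵀ * A := by
    ext i j
    simp [Matrix.sum_apply, vecMulVec_apply, Matrix.mul_apply, A]
  have hdet : A.det ^ 2 = (Aᵀ * A).det := by rw [det_mul, det_transpose]; ring
  rw [hdet]
  refine (le_abs_self _).trans ?_
  have hq : ∀ ξ : Fin n → ℝ, 0 ≤ ξ ⬝ᵥ (Aᵀ * A) *ᵥ ξ := fun ξ => by
    rw [← mulVec_mulVec, dotProduct_mulVec, vecMul_transpose]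
    exact Finset.sum_nonneg fun _ _ => mul_self_nonneg _
  refine abs_det_le_of_abs_quadratic_le (by simp [Matrix.IsSymm]) (posDef_gram hρ G) fun ξ => ?_
  rw [abs_of_nonneg (hq ξ), hA, Matrix.add_mulVec, dotProduct_add, smul_mulVec, one_mulVec,
    dotProduct_smul]
  have : 0 ≤ ξ ⬝ᵥ ξ := Finset.sum_nonneg fun _ _ => mul_self_nonneg _
  have := mul_nonneg hρ.le this
  simpa using this

theorem lintegral_sq_det_le (n : ℕ) :
    ∫⁻ G, ENNReal.ofReal ((Matrix.of G).det ^ 2) ∂(Measure.pi fun _ : Fin n => Measure.pi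
      fun _ : Fin n => gaussianReal 0 1) ≤ ENNReal.ofReal (n.factorial) := by
  have h1 : ∀ ρ : ℝ, 0 < ρ → ∫⁻ G, ENNReal.ofReal ((Matrix.of G).det ^ 2) ∂(Measure.pi
      fun _ : Fin n => Measure.pi fun _ : Fin n => gaussianReal 0 1) ≤
      ENNReal.ofReal (n.factorial * (1 + ρ) ^ n) := fun ρ hρ => by
    refine (lintegral_mono fun G => ENNReal.ofReal_le_ofReal (sq_det_le_gramDet hρ G)).trans ?_
    simpa [Nat.descFactorial_self] using lintegral_gramDet_le hρ n n le_rfl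
  have h2 : Filter.Tendsto (fun ρ : ℝ => ENNReal.ofReal (n.factorial * (1 + ρ) ^ n))
      (nhdsWithin 0 (Set.Ioi 0)) (nhds (ENNReal.ofReal (n.factorial))) := by
    have : Continuous fun ρ : ℝ => ENNReal.ofReal (n.factorial * (1 + ρ) ^ n) :=
      ENNReal.continuous_ofReal.comp (by fun_prop)
    have := (this.tendsto 0).mono_left (nhdsWithin_le_nhds (s := Set.Ioi 0))
    simpa using this
  exact ge_of_tendsto h2 (Filter.eventually_of_mem self_mem_nhdsWithin h1)

end Determinant

section Adjugate

open Matrix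

theorem sq_det_le_adjugate {n : ℕ} (B : Matrix (Fin n) (Fin n) ℝ) {v : Fin n → ℝ}
    (hv : v ⬝ᵥ v = 1) :
    B.det ^ 2 ≤ ((B *ᵥ v) ⬝ᵥ (B *ᵥ v)) * ∑ k, ∑ l, B.adjugate k l ^ 2 := by
  have h1 : B.adjugate *ᵥ (B *ᵥ v) = B.det • v := by
    rw [mulVec_mulVec, adjugate_mul, smul_mulVec, one_mulVec]
  have h2 : B.det ^ 2 = ∑ k, (B.adjugate *ᵥ (B *ᵥ v)) k ^ 2 := by
    rw [h1]
    simp only [Pi.smul_apply, smul_eq_mul, mul_pow, ← Finset.mul_sum]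
    have : ∑ k, v k ^ 2 = 1 := by rw [← hv]; simp [dotProduct, sq]
    rw [this, mul_one]
  rw [h2, Finset.mul_sum]
  refine Finset.sum_le_sum fun k _ => ?_
  have := Finset.sum_mul_sq_le_sq_mul_sq univ (B.adjugate k) (B *ᵥ v)
  have h3 : (B *ᵥ v) ⬝ᵥ (B *ᵥ v) = ∑ i, (B *ᵥ v) i ^ 2 := by simp [dotProduct, sq]
  rw [h3, mul_comm]
  exact this

variable {V : Type*} [NormedAddCommGroup V] [InnerProductSpace ℝ V] [FiniteDimensional ℝ V]
  [MeasurableSpace V] [BorelSpace V]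

theorem lintegral_sq_adjugate_le {n : ℕ} {b : Fin n → Fin n → V}
    (hb : Orthonormal ℝ fun p : Fin n × Fin n => b p.1 p.2) (k l : Fin n) :
    ∫⁻ h, ENNReal.ofReal ((Matrix.of fun i j => ⟪b i j, h⟫).adjugate k l ^ 2) ∂(stdGaussian V) ≤
      ENNReal.ofReal ((n - 1).factorial) := by
  obtain ⟨n, rfl⟩ : ∃ n', n = n' + 1 := ⟨n - 1, by have := k.2; omega⟩
  have hb' : Orthonormal ℝ fun p : Fin n × Fin n => b (l.succAbove p.1) (k.succAbove p.2) :=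
    hb.comp (fun p : Fin n × Fin n => (l.succAbove p.1, k.succAbove p.2)) fun p q hpq => by
      simp only [Prod.mk.injEq, Fin.succAbove_right_inj] at hpq
      exact Prod.ext hpq.1 hpq.2
  have h1 : ∀ h : V, (Matrix.of fun i j => ⟪b i j, h⟫).adjugate k l ^ 2 =
      (Matrix.of fun i j => ⟪b (l.succAbove i) (k.succAbove j), h⟫).det ^ 2 := by
    intro h
    rw [adjugate_fin_succ_eq_det_submatrix, mul_pow, ← pow_mul, Even.neg_one_pow (by simp), one_mul]
    rfl
  simp_rw [h1]
  have h2 := map_inner_stdGaussian_prod (u := fun p q => b (l.succAbove p) (k.succAbove q)) hb'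
  have hm : Measurable fun G : Fin n → Fin n → ℝ => ENNReal.ofReal ((Matrix.of G).det ^ 2) := by
    have : Continuous fun G : Fin n → Fin n → ℝ => (Matrix.of G).det ^ 2 :=
      (Continuous.matrix_det (continuous_id (X := Fin n → Fin n → ℝ))).pow 2
    exact this.measurable.ennreal_ofReal
  have h3 := lintegral_sq_det_le n
  rw [← h2, lintegral_map hm (by fun_prop)] at h3
  exact h3

theorem ofReal_sq_sqrt_sum_sq {n : ℕ} (A : Fin n → Fin n → ℝ) :
    ENNReal.ofReal (√(∑ k, ∑ l, A k l ^ 2) ^ 2) = ∑ k, ∑ l, ENNReal.ofReal (A k l ^ 2) := by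
  rw [Real.sq_sqrt (Finset.sum_nonneg fun _ _ => Finset.sum_nonneg fun _ _ => sq_nonneg _),
    ENNReal.ofReal_sum_of_nonneg fun _ _ => Finset.sum_nonneg fun _ _ => sq_nonneg _]
  refine Finset.sum_congr rfl fun k _ => ?_
  rw [ENNReal.ofReal_sum_of_nonneg fun _ _ => sq_nonneg _]

theorem lintegral_norm_mul_adjugate_le {n : ℕ} {b : Fin n → Fin n → V}
    (hb : Orthonormal ℝ fun p : Fin n × Fin n => b p.1 p.2) :
    ∫⁻ h, ENNReal.ofReal (‖h‖ * √(∑ k, ∑ l, (Matrix.of fun i j => ⟪b i j, h⟫).adjugate k l ^ 2))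
      ∂(stdGaussian V) ≤ ENNReal.ofReal (√(Module.finrank ℝ V) * √(n * n.factorial)) := by
  have hadj : Continuous fun h : V => (Matrix.of fun i j => ⟪b i j, h⟫).adjugate := by
    refine Continuous.matrix_adjugate ?_
    exact continuous_pi fun i => continuous_pi fun j => (by fun_prop : Continuous fun h => ⟪b i j, h⟫)
  have hadj' : ∀ k l, Continuous fun h : V => (Matrix.of fun i j => ⟪b i j, h⟫).adjugate k l :=
    fun k l => hadj.matrix_elem k l
  simp_rw [ENNReal.ofReal_mul (norm_nonneg _)]
  have hm : Measurable fun h : V => ENNReal.ofReal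
      (√(∑ k, ∑ l, (Matrix.of fun i j => ⟪b i j, h⟫).adjugate k l ^ 2)) := by
    refine (Continuous.measurable ?_).ennreal_ofReal
    exact Real.continuous_sqrt.comp (continuous_finsetSum _ fun k _ => continuous_finsetSum _
      fun l _ => (hadj' k l).pow 2)
  have := ENNReal.lintegral_mul_le_Lp_mul_Lq (stdGaussian V) (p := 2) (q := 2)
    (by constructor <;> norm_num) (f := fun h => ENNReal.ofReal ‖h‖)
    (g := fun h => ENNReal.ofReal
      (√(∑ k, ∑ l, (Matrix.of fun i j => ⟪b i j, h⟫).adjugate k l ^ 2))) (by fun_prop)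
    hm.aemeasurable
  refine this.trans ?_
  rw [ENNReal.ofReal_mul (Real.sqrt_nonneg _)]
  have hsq : ∀ x : ℝ, 0 ≤ x → ENNReal.ofReal x ^ (2 : ℝ) = ENNReal.ofReal (x ^ 2) := by
    intro x hx
    rw [ENNReal.ofReal_rpow_of_nonneg hx (by norm_num)]; norm_num
  have hrt : ∀ x : ℝ, 0 ≤ x → ENNReal.ofReal x ^ (1 / 2 : ℝ) = ENNReal.ofReal (√x) := by
    intro x hx
    rw [ENNReal.ofReal_rpow_of_nonneg hx (by norm_num), Real.sqrt_eq_rpow]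
  simp_rw [hsq _ (norm_nonneg _), hsq _ (Real.sqrt_nonneg _)]
  rw [← hrt _ (by positivity), ← hrt _ (by positivity)]
  gcongr
  · rw [lintegral_norm_sq_stdGaussian]; simp
  · have h1 : ∀ h : V, ENNReal.ofReal
        (√(∑ k, ∑ l, (Matrix.of fun i j => ⟪b i j, h⟫).adjugate k l ^ 2) ^ 2) =
        ∑ k, ∑ l, ENNReal.ofReal ((Matrix.of fun i j => ⟪b i j, h⟫).adjugate k l ^ 2) := by
      intro h
      exact ofReal_sq_sqrt_sum_sq _
    simp_rw [h1]
    have hm2 : ∀ k l, Measurable fun h : V =>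
        ENNReal.ofReal ((Matrix.of fun i j => ⟪b i j, h⟫).adjugate k l ^ 2) := fun k l =>
      ((hadj' k l).pow 2).measurable.ennreal_ofReal
    rw [lintegral_finsetSum _ fun k _ => Finset.measurable_fun_sum _ fun l _ => hm2 k l]
    simp_rw [fun k => lintegral_finsetSum (μ := stdGaussian V) univ (f := fun l (h : V) =>
      ENNReal.ofReal ((Matrix.of fun i j => ⟪b i j, h⟫).adjugate k l ^ 2)) fun l _ => hm2 k l]
    refine (Finset.sum_le_sum fun k _ => Finset.sum_le_sum fun l _ =>
      lintegral_sq_adjugate_le hb k l).trans (le_of_eq ?_)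
    simp only [Finset.sum_const, Finset.card_univ, Fintype.card_fin, nsmul_eq_mul]
    rw [← ENNReal.ofReal_natCast n, ← ENNReal.ofReal_mul (by positivity),
      ← ENNReal.ofReal_mul (by positivity)]
    congr 1
    rcases n with _ | n
    · simp
    · simp [Nat.factorial_succ]

end Adjugate

section RadialIntegrals

open Real Set

theorem two_pow_mul_sq_Gamma_half_le : ∀ n : ℕ, 1 ≤ n →
    2 ^ n * Gamma ((n : ℝ) / 2) ^ 2 ≤ 2 * π * Gamma n := by
  intro n
  induction n using Nat.strong_induction_on with
  | _ n ih =>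
    intro hn
    rcases n with _ | _ | _ | n
    · omega
    · have := Real.Gamma_one_half_eq
      simp only [zero_add, Nat.cast_one, Gamma_one, this, pow_one]
      rw [Real.sq_sqrt pi_pos.le]; simp
    · norm_num
      nlinarith [Real.pi_gt_three]
    · have h := ih (n + 1) (by omega) (by omega)
      have e1 : ((n + 1 + 1 + 1 : ℕ) : ℝ) / 2 = ((n + 1 : ℕ) : ℝ) / 2 + 1 := by push_cast; ring
      have e2 : ((n + 1 + 1 + 1 : ℕ) : ℝ) = ((n + 1 : ℕ) : ℝ) + 1 + 1 := by push_cast; ring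
      have hp : (0 : ℝ) < ((n + 1 : ℕ) : ℝ) := by positivity
      have hG := Real.Gamma_pos_of_pos hp
      rw [e1, e2, Real.Gamma_add_one (by positivity), Real.Gamma_add_one (by positivity),
        Real.Gamma_add_one (by positivity)]
      set x : ℝ := ((n + 1 : ℕ) : ℝ)
      calc 2 ^ (n + 1 + 1 + 1) * (x / 2 * Gamma (x / 2)) ^ 2
          = x ^ 2 * (2 ^ (n + 1) * Gamma (x / 2) ^ 2) := by ring
        _ ≤ x ^ 2 * (2 * π * Gamma x) := by gcongr
        _ ≤ 2 * π * ((x + 1) * (x * Gamma x)) := by nlinarith [mul_pos (mul_pos pi_pos hp) hG]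

theorem lintegral_conformal_factor_pow {n : ℕ} (hn : 1 ≤ n) :
    ∫⁻ y : EuclideanSpace ℝ (Fin n), ENNReal.ofReal ((2 / (1 + ‖y‖ ^ 2)) ^ n) =
      ENNReal.ofReal (2 ^ n * π ^ ((n : ℝ) / 2) * Gamma ((n : ℝ) / 2) / Gamma n) := by
  have hn0 : (0 : ℝ) < n := by positivity
  have hG := Real.Gamma_pos_of_pos hn0
  have hG2 := Real.Gamma_pos_of_pos (half_pos hn0)
  have h1 : ∀ (a r : ℝ), 0 < a → 0 < r → ∫⁻ t in Ioi (0 : ℝ),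
      ENNReal.ofReal (t ^ (a - 1) * exp (-(r * t))) = ENNReal.ofReal ((1 / r) ^ a * Gamma a) := by
    intro a r ha hr
    have h := Real.integral_rpow_mul_exp_neg_mul_Ioi ha hr
    have hne : (1 / r) ^ a * Gamma a ≠ 0 := by
      have := Real.Gamma_pos_of_pos ha; positivity
    rw [← h, ofReal_integral_eq_lintegral_ofReal]
    · exact not_imp_comm.1 integral_undef (by rw [h]; exact hne)
    · filter_upwards [ae_restrict_mem measurableSet_Ioi] with t ht
      have : (0 : ℝ) < t := ht
      positivity
  have h2 : ∀ t : ℝ, 0 < t → ∫⁻ y : EuclideanSpace ℝ (Fin n),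
      ENNReal.ofReal (exp (-t * ‖y‖ ^ 2)) = ENNReal.ofReal ((π / t) ^ ((n : ℝ) / 2)) := by
    intro t ht
    have h := GaussianFourier.integral_rexp_neg_mul_sq_norm (V := EuclideanSpace ℝ (Fin n)) ht
    rw [finrank_euclideanSpace_fin] at h
    have hne : (π / t) ^ ((n : ℝ) / 2) ≠ 0 := by have := pi_pos; positivity
    rw [← h, ofReal_integral_eq_lintegral_ofReal]
    · exact not_imp_comm.1 integral_undef (by rw [h]; exact hne)
    · filter_upwards with t; positivity
  have h3 : ∀ y : EuclideanSpace ℝ (Fin n), ENNReal.ofReal ((2 / (1 + ‖y‖ ^ 2)) ^ n) =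
      ENNReal.ofReal (2 ^ n / Gamma n) * ∫⁻ t in Ioi (0 : ℝ),
        ENNReal.ofReal (t ^ ((n : ℝ) - 1) * exp (-((1 + ‖y‖ ^ 2) * t))) := by
    intro y
    rw [h1 _ _ hn0 (by positivity), ← ENNReal.ofReal_mul (by positivity)]
    congr 1
    rw [Real.rpow_natCast]
    field_simp
    rw [← mul_pow, mul_one_div]
  simp_rw [h3]
  rw [lintegral_const_mul _ (by fun_prop), lintegral_lintegral_swap (by fun_prop)]
  have h4 : ∀ t ∈ Ioi (0 : ℝ), ∫⁻ y : EuclideanSpace ℝ (Fin n),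
      ENNReal.ofReal (t ^ ((n : ℝ) - 1) * exp (-((1 + ‖y‖ ^ 2) * t))) =
      ENNReal.ofReal (π ^ ((n : ℝ) / 2)) *
        ENNReal.ofReal (t ^ ((n : ℝ) / 2 - 1) * exp (-(1 * t))) := by
    intro t ht
    have ht : 0 < t := ht
    have : ∀ y : EuclideanSpace ℝ (Fin n), ENNReal.ofReal
        (t ^ ((n : ℝ) - 1) * exp (-((1 + ‖y‖ ^ 2) * t))) =
        ENNReal.ofReal (t ^ ((n : ℝ) - 1) * exp (-t)) * ENNReal.ofReal (exp (-t * ‖y‖ ^ 2)) := by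
      intro y
      rw [← ENNReal.ofReal_mul (by positivity), mul_assoc, ← Real.exp_add]
      ring_nf
    simp_rw [this]
    rw [lintegral_const_mul _ (by fun_prop), h2 t ht, ← ENNReal.ofReal_mul (by positivity),
      ← ENNReal.ofReal_mul (by positivity)]
    congr 1
    rw [Real.div_rpow pi_pos.le ht.le, show (n : ℝ) - 1 = ((n : ℝ) / 2 - 1) + (n : ℝ) / 2 by ring,
      Real.rpow_add ht, one_mul]
    have := Real.rpow_pos_of_pos ht ((n : ℝ) / 2)
    field_simp
  rw [setLIntegral_congr_fun measurableSet_Ioi h4, lintegral_const_mul _ (by fun_prop),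
    h1 _ _ (half_pos hn0) one_pos, ← ENNReal.ofReal_mul (by positivity),
    ← ENNReal.ofReal_mul (by positivity)]
  congr 1
  simp
  ring

theorem lintegral_norm_div_pow {n : ℕ} (hn : 1 ≤ n) {a : ℝ} (ha : 0 ≤ a) :
    ∫⁻ z : EuclideanSpace ℝ (Fin n),
      {z | ‖z‖ ≤ a}.indicator (fun z => ENNReal.ofReal (‖z‖ / ‖z‖ ^ n)) z =
      ENNReal.ofReal (a * (2 * π ^ ((n : ℝ) / 2) / Gamma ((n : ℝ) / 2))) := by
  have : Nonempty (Fin n) := ⟨⟨0, hn⟩⟩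
  have hn0 : (0 : ℝ) < n := by positivity
  have hG2 := Real.Gamma_pos_of_pos (half_pos hn0)
  set f : ℝ → ℝ := (Iic a).indicator fun r => r / r ^ n with hf
  have h1 : ∀ y ∈ Ioi (0 : ℝ), y ^ (n - 1) • f y = (Iic a).indicator (fun _ => (1 : ℝ)) y := by
    intro y hy
    have hy : 0 < y := hy
    by_cases h : y ∈ Iic a
    · simp only [hf, indicator_of_mem h, smul_eq_mul]
      obtain ⟨n, rfl⟩ : ∃ k, n = k + 1 := ⟨n - 1, by omega⟩
      simp only [Nat.add_sub_cancel]
      field_simp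
      ring
    · simp [hf, indicator_of_notMem h]
  have h2 : ∫ y in Ioi (0 : ℝ), y ^ (n - 1) • f y = a := by
    rw [setIntegral_congr_fun measurableSet_Ioi h1, setIntegral_indicator measurableSet_Iic]
    simp [Ioi_inter_Iic, ha]
  have h2' : IntegrableOn (fun y => y ^ (n - 1) • f y) (Ioi 0) := by
    rw [integrableOn_congr_fun h1 measurableSet_Ioi]
    rw [IntegrableOn, integrable_indicator_iff measurableSet_Iic]
    rw [IntegrableOn, Measure.restrict_restrict measurableSet_Iic]
    refine integrable_const_iff.2 (Or.inr ?_)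
    rw [isFiniteMeasure_restrict, Iic_inter_Ioi]
    simp
  have hint : Integrable (fun z : EuclideanSpace ℝ (Fin n) => f ‖z‖) := by
    rw [integrable_fun_norm_addHaar]
    simpa using h2'
  have h3 := integral_fun_norm_addHaar (volume : Measure (EuclideanSpace ℝ (Fin n))) f
  rw [finrank_euclideanSpace_fin, h2] at h3
  have h4 : ∀ z : EuclideanSpace ℝ (Fin n), {z : EuclideanSpace ℝ (Fin n) | ‖z‖ ≤ a}.indicator
      (fun z => ENNReal.ofReal (‖z‖ / ‖z‖ ^ n)) z = ENNReal.ofReal (f ‖z‖) := by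
    intro z
    by_cases h : ‖z‖ ≤ a
    · rw [indicator_of_mem (by exact h)]; simp [hf, h]
    · rw [indicator_of_notMem (by exact h)]; simp [hf, h]
  simp_rw [h4]
  rw [← ofReal_integral_eq_lintegral_ofReal hint, h3]
  · congr 1
    rw [Measure.real, EuclideanSpace.volume_ball]
    simp only [Fintype.card_fin, ENNReal.ofReal_one, one_pow, one_mul]
    rw [ENNReal.toReal_ofReal (by positivity), Real.Gamma_add_one (by positivity)]
    have : √π ^ n = π ^ ((n : ℝ) / 2) := by
      rw [Real.sqrt_eq_rpow, ← Real.rpow_natCast, ← Real.rpow_mul pi_pos.le]; ring_nf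
    rw [this]
    simp only [nsmul_eq_mul, smul_eq_mul]
    field_simp
  · filter_upwards with z
    simp only [hf]
    by_cases h : ‖z‖ ∈ Iic a
    · rw [indicator_of_mem h]; exact div_nonneg (norm_nonneg z) (pow_nonneg (norm_nonneg z) n)
    · rw [indicator_of_notMem h]; rfl

end RadialIntegrals

section Kernel

variable {n : ℕ} {d : Fin n → ℕ} {V : Type*} [NormedAddCommGroup V] [InnerProductSpace ℝ V]

/-- Reproducing vectors of the space of polynomial systems: `⟪f, k i x⟫` is the value at `x` of the
`i`-th polynomial of the system `f`. -/
structure IsKernel (d : Fin n → ℕ) (k : Fin n → EuclideanSpace ℝ (Fin (n + 1)) → V) : Prop where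
  contDiff : ∀ i, ContDiff ℝ 2 (k i)
  inner_eq : ∀ i j x y, ⟪k i x, k j y⟫ = if i = j then ⟪x, y⟫ ^ d i else 0

/-- Second derivative of `k` along the great circle through `x` with velocity `v`. -/
noncomputable def accel {E : Type*} [NormedAddCommGroup E] [InnerProductSpace ℝ E]
    (k : E → V) (x v : E) : V :=
  fderiv ℝ (fderiv ℝ k) x v v - ‖v‖ ^ 2 • fderiv ℝ k x x

theorem hasDerivAt_fderiv_comp {E : Type*} [NormedAddCommGroup E] [InnerProductSpace ℝ E]
    {k : E → V} (hk : ContDiff ℝ 2 k) {c c₁ : ℝ → E} {c₂ : E} {t : ℝ}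
    (hc : HasDerivAt c (c₁ t) t) (hc₁ : HasDerivAt c₁ c₂ t) :
    HasDerivAt (fun s => fderiv ℝ k (c s) (c₁ s))
      (accel k (c t) (c₁ t) + fderiv ℝ k (c t) (c₂ + ‖c₁ t‖ ^ 2 • c t)) t := by
  have h1 : ContDiff ℝ 1 (fderiv ℝ k) := hk.fderiv_right (by norm_num)
  have h2 : HasFDerivAt (fderiv ℝ k) (fderiv ℝ (fderiv ℝ k) (c t)) (c t) :=
    (h1.differentiable (by norm_num) _).hasFDerivAt
  have h3 := (h2.comp_hasDerivAt t hc).clm_apply hc₁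
  refine HasDerivAt.congr_deriv h3 ?_
  simp [accel]

theorem accel_smul {E : Type*} [NormedAddCommGroup E] [InnerProductSpace ℝ E]
    (k : E → V) (x v : E) (r : ℝ) : accel k x (r • v) = r ^ 2 • accel k x v := by
  simp only [accel, map_smul, _root_.smul_apply, norm_smul, smul_sub, smul_smul,
    mul_pow, Real.norm_eq_abs, sq_abs]
  congr 2
  ring

/-- The great circle through `x` with velocity `v`. -/
noncomputable def arc {E : Type*} [NormedAddCommGroup E] [InnerProductSpace ℝ E]
    (x v : E) (θ : ℝ) : E := Real.cos θ • x + Real.sin θ • v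

section Arc

variable {E : Type*} [NormedAddCommGroup E] [InnerProductSpace ℝ E]

theorem hasDerivAt_arc (x v : E) (θ : ℝ) : HasDerivAt (arc x v) (arc v (-x) θ) θ := by
  have := ((Real.hasDerivAt_cos θ).smul_const x).add ((Real.hasDerivAt_sin θ).smul_const v)
  refine HasDerivAt.congr_deriv this ?_
  simp only [arc, smul_neg, neg_smul]
  abel

@[simp] theorem arc_zero (x v : E) : arc x v 0 = x := by simp [arc]

theorem inner_arc {x v : E} (hx : ‖x‖ = 1) (hv : ‖v‖ = 1) (hxv : ⟪x, v⟫ = 0) (s t : ℝ) :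
    ⟪arc x v s, arc x v t⟫ = Real.cos (s - t) := by
  have hxx : ⟪x, x⟫ = 1 := by rw [real_inner_self_eq_norm_sq, hx]; norm_num
  have hvv : ⟪v, v⟫ = 1 := by rw [real_inner_self_eq_norm_sq, hv]; norm_num
  have hvx : ⟪v, x⟫ = 0 := by rw [real_inner_comm]; exact hxv
  simp only [arc, inner_add_left, inner_add_right, real_inner_smul_left, real_inner_smul_right,
    hxx, hvv, hxv, hvx, Real.cos_sub]
  ring

theorem norm_arc {x v : E} (hx : ‖x‖ = 1) (hv : ‖v‖ = 1) (hxv : ⟪x, v⟫ = 0) (t : ℝ) :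
    ‖arc x v t‖ = 1 := by
  have := inner_arc hx hv hxv t t
  rw [real_inner_self_eq_norm_sq, sub_self, Real.cos_zero] at this
  nlinarith [norm_nonneg (arc x v t)]

theorem hasDerivAt_comp_arc {k : E → V} (hk : ContDiff ℝ 2 k) (x v : E) (θ : ℝ) :
    HasDerivAt (fun s => k (arc x v s)) (fderiv ℝ k (arc x v θ) (arc v (-x) θ)) θ :=
  ((hk.differentiable (by norm_num) _).hasFDerivAt).comp_hasDerivAt θ (hasDerivAt_arc x v θ)

theorem hasDerivAt_fderiv_comp_arc {k : E → V} (hk : ContDiff ℝ 2 k) {x v : E} (hx : ‖x‖ = 1)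
    (hv : ‖v‖ = 1) (hxv : ⟪x, v⟫ = 0) (θ : ℝ) :
    HasDerivAt (fun s => fderiv ℝ k (arc x v s) (arc v (-x) s))
      (accel k (arc x v θ) (arc v (-x) θ)) θ := by
  have h := hasDerivAt_fderiv_comp hk (hasDerivAt_arc x v θ) (hasDerivAt_arc v (-x) θ)
  have h1 : ‖arc v (-x) θ‖ = 1 :=
    norm_arc hv (by simpa using hx) (by rw [inner_neg_right, real_inner_comm, hxv, neg_zero]) θ
  convert h using 1
  have : arc (-x) (-v) θ + ‖arc v (-x) θ‖ ^ 2 • arc x v θ = 0 := by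
    rw [h1]; simp only [arc]; module
  rw [this]; simp

end Arc

theorem hasDerivAt_cos_pow (m : ℕ) (θ : ℝ) :
    HasDerivAt (fun s => Real.cos s ^ m) (-(m * Real.cos θ ^ (m - 1) * Real.sin θ)) θ := by
  refine HasDerivAt.congr_deriv ((Real.hasDerivAt_cos θ).pow m) ?_
  ring

theorem hasDerivAt_cos_pow_deriv (m : ℕ) (θ : ℝ) :
    HasDerivAt (fun s => -(m * Real.cos s ^ (m - 1) * Real.sin s))
      (m * (m - 1) * Real.cos θ ^ (m - 2) - m ^ 2 * Real.cos θ ^ m) θ := by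
  have := (((hasDerivAt_cos_pow (m - 1) θ).const_mul (m : ℝ)).mul (Real.hasDerivAt_sin θ)).neg
  refine HasDerivAt.congr_deriv this ?_
  have h := Real.sin_sq θ
  rcases m with _ | _ | m
  · simp
  · simp
  · simp only [show m + 1 + 1 - 1 = m + 1 by omega, show m + 1 + 1 - 2 = m by omega,
      show m + 1 - 1 = m by omega]
    push_cast
    linear_combination ((m + 1 + 1) * (m + 1) * Real.cos θ ^ m) * h

theorem inner_accel_of_inner_eq {α α₁ α₂ β β₁ β₂ : ℝ → V} {c c₁ c₂ c₃ c₄ : ℝ → ℝ}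
    (hα : ∀ t, HasDerivAt α (α₁ t) t) (hα₁ : ∀ t, HasDerivAt α₁ (α₂ t) t)
    (hβ : ∀ t, HasDerivAt β (β₁ t) t) (hβ₁ : ∀ t, HasDerivAt β₁ (β₂ t) t)
    (hc : ∀ t, HasDerivAt c (c₁ t) t) (hc₁ : ∀ t, HasDerivAt c₁ (c₂ t) t)
    (hc₂ : ∀ t, HasDerivAt c₂ (c₃ t) t) (hc₃ : ∀ t, HasDerivAt c₃ (c₄ t) t)
    (h : ∀ s t, ⟪α s, β t⟫ = c (s - t)) (s t : ℝ) : ⟪α₂ s, β₂ t⟫ = c₄ (s - t) := by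
  have hl : ∀ {a a₁ : ℝ → V} {g g₁ : ℝ → ℝ} {w : V} {u : ℝ}, (∀ t, HasDerivAt a (a₁ t) t) →
      (∀ t, HasDerivAt g (g₁ t) t) → (∀ s, ⟪a s, w⟫ = g (s - u)) → ∀ s, ⟪a₁ s, w⟫ = g₁ (s - u) := by
    intro a a₁ g g₁ w u ha hg he s
    have e1 := (ha s).inner ℝ (hasDerivAt_const s w)
    have e2 := (hg (s - u)).comp s ((hasDerivAt_id s).sub_const u)
    have : (fun s => ⟪a s, w⟫) = g ∘ fun s => id s - u := by ext s; simp [he]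
    rw [this] at e1
    simpa using e1.unique e2
  have hr : ∀ {a a₁ : ℝ → V} {g g₁ : ℝ → ℝ} {w : V} {u : ℝ}, (∀ t, HasDerivAt a (a₁ t) t) →
      (∀ t, HasDerivAt g (g₁ t) t) → (∀ s, ⟪w, a s⟫ = g (u - s)) →
      ∀ s, ⟪w, a₁ s⟫ = -g₁ (u - s) := by
    intro a a₁ g g₁ w u ha hg he s
    have e1 := (hasDerivAt_const s w).inner ℝ (ha s)
    have e2 := (hg (u - s)).comp s ((hasDerivAt_id s).const_sub u)
    have : (fun s => ⟪w, a s⟫) = g ∘ fun s => u - id s := by ext s; simp [he]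
    rw [this] at e1
    simpa using e1.unique e2
  have h1 : ∀ t s, ⟪α₁ s, β t⟫ = c₁ (s - t) := fun t => hl hα hc fun s => h s t
  have h2 : ∀ t s, ⟪α₂ s, β t⟫ = c₂ (s - t) := fun t => hl hα₁ hc₁ (h1 t)
  have h3 : ∀ t, ⟪α₂ s, β₁ t⟫ = -c₃ (s - t) := hr hβ hc₂ fun t => h2 t s
  have h4 := hr (g := fun t => -c₃ t) (g₁ := fun t => -c₄ t) hβ₁ (fun t => (hc₃ t).neg) h3 t
  simpa using h4

namespace IsKernel

variable {k : Fin n → EuclideanSpace ℝ (Fin (n + 1)) → V} (hk : IsKernel d k)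
include hk

theorem inner_accel {x v : EuclideanSpace ℝ (Fin (n + 1))} (hx : ‖x‖ = 1) (hv : ‖v‖ = 1)
    (hxv : ⟪x, v⟫ = 0) (i j : Fin n) :
    ⟪accel (k i) x v, accel (k j) x v⟫ = if i = j then (d i : ℝ) * (3 * d i - 2) else 0 := by
  by_cases hij : i = j
  · subst hij
    have h := inner_accel_of_inner_eq (hasDerivAt_comp_arc (hk.contDiff i) x v)
      (hasDerivAt_fderiv_comp_arc (hk.contDiff i) hx hv hxv)
      (hasDerivAt_comp_arc (hk.contDiff i) x v)
      (hasDerivAt_fderiv_comp_arc (hk.contDiff i) hx hv hxv)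
      (hasDerivAt_cos_pow (d i)) (hasDerivAt_cos_pow_deriv (d i))
      (fun t => ((hasDerivAt_cos_pow (d i - 2) t).const_mul ((d i : ℝ) * (d i - 1))).sub
        ((hasDerivAt_cos_pow (d i) t).const_mul ((d i : ℝ) ^ 2)))
      (fun t => ((hasDerivAt_cos_pow_deriv (d i - 2) t).const_mul ((d i : ℝ) * (d i - 1))).sub
        ((hasDerivAt_cos_pow_deriv (d i) t).const_mul ((d i : ℝ) ^ 2)))
      (fun s t => by rw [hk.inner_eq, if_pos rfl, inner_arc hx hv hxv]) 0 0
    simp only [arc_zero, sub_self, Real.cos_zero, one_pow] at h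
    rw [h, if_pos rfl]
    rcases hd : d i with _ | _ | m
    · simp
    · norm_num
    · simp only [show m + 1 + 1 - 2 = m by omega]
      push_cast; ring
  · have h := inner_accel_of_inner_eq (hasDerivAt_comp_arc (hk.contDiff i) x v)
      (hasDerivAt_fderiv_comp_arc (hk.contDiff i) hx hv hxv)
      (hasDerivAt_comp_arc (hk.contDiff j) x v)
      (hasDerivAt_fderiv_comp_arc (hk.contDiff j) hx hv hxv)
      (fun t => hasDerivAt_const t (0 : ℝ)) (fun t => hasDerivAt_const t (0 : ℝ))
      (fun t => hasDerivAt_const t (0 : ℝ)) (fun t => hasDerivAt_const t (0 : ℝ))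
      (fun s t => by rw [hk.inner_eq, if_neg hij]) 0 0
    simpa [hij] using h

theorem inner_fderiv (i j : Fin n) (x y w : EuclideanSpace ℝ (Fin (n + 1))) :
    ⟪k i x, fderiv ℝ (k j) y w⟫ = if i = j then d i * ⟪x, y⟫ ^ (d i - 1) * ⟪x, w⟫ else 0 := by
  have h1 := (innerSL ℝ (k i x)).hasFDerivAt.comp y
    (((hk.contDiff j).differentiable (by norm_num) y).hasFDerivAt)
  have h2 : (⇑(innerSL ℝ (k i x)) ∘ k j) = fun y => if i = j then ⟪x, y⟫ ^ d i else 0 := by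
    ext y; simp [hk.inner_eq]
  rw [h2] at h1
  by_cases hij : i = j
  · simp only [hij, if_true] at h1 ⊢
    have h3 := ((innerSL ℝ x).hasFDerivAt (x := y)).pow (d j)
    have h4 := congrArg (fun L => L w) (h1.unique h3)
    simpa using h4
  · simp only [hij, if_false] at h1 ⊢
    have h4 := congrArg (fun L => L w) (h1.unique (hasFDerivAt_const (0 : ℝ) y))
    simpa using h4

theorem inner_fderiv_fderiv (i j : Fin n) {x v w : EuclideanSpace ℝ (Fin (n + 1))}
    (hx : ‖x‖ = 1) (hw : ⟪x, w⟫ = 0) :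
    ⟪fderiv ℝ (k i) x v, fderiv ℝ (k j) x w⟫ = if i = j then d i * ⟪v, w⟫ else 0 := by
  have h1 := (innerSL ℝ (fderiv ℝ (k j) x w)).hasFDerivAt.comp x
    (((hk.contDiff i).differentiable (by norm_num) x).hasFDerivAt)
  have h2 : (⇑(innerSL ℝ (fderiv ℝ (k j) x w)) ∘ k i) =
      fun y => if i = j then d i * ⟪y, x⟫ ^ (d i - 1) * ⟪y, w⟫ else 0 := by
    ext y; simp [real_inner_comm (k i y), hk.inner_fderiv]
  rw [h2] at h1
  rw [real_inner_comm]
  by_cases hij : i = j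
  · simp only [hij, if_true] at h1 ⊢
    have e1 : ∀ a : EuclideanSpace ℝ (Fin (n + 1)), HasFDerivAt (fun y => ⟪y, a⟫) (innerSL ℝ a) x := by
      intro a
      have := (innerSL ℝ a).hasFDerivAt (x := x)
      exact this.congr_of_eventuallyEq (Filter.Eventually.of_forall fun y => by
        simp [real_inner_comm])
    have h3 := (((e1 x).pow (d j - 1)).const_mul (d j : ℝ)).mul (e1 w)
    have h4 := congrArg (fun L => L v) (h1.unique h3)
    simpa [hw, hx, real_inner_comm] using h4
  · simp only [hij, if_false] at h1 ⊢
    have h4 := congrArg (fun L => L v) (h1.unique (hasFDerivAt_const (0 : ℝ) x))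
    simpa using h4

theorem map_neg (i : Fin n) (x : EuclideanSpace ℝ (Fin (n + 1))) :
    k i (-x) = (-1 : ℝ) ^ d i • k i x := by
  rw [← sub_eq_zero, ← inner_self_eq_zero (𝕜 := ℝ)]
  simp only [inner_sub_left, inner_sub_right, real_inner_smul_left, real_inner_smul_right,
    hk.inner_eq, if_true, inner_neg_left, inner_neg_right, neg_neg]
  rw [neg_pow ⟪x, x⟫]
  have : ((-1 : ℝ) ^ d i) * (-1) ^ d i = 1 := by rw [← mul_pow]; norm_num
  linear_combination (⟪x, x⟫ ^ d i) * (-this)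

theorem fderiv_neg (i : Fin n) (x v : EuclideanSpace ℝ (Fin (n + 1))) :
    fderiv ℝ (k i) (-x) v = (-1 : ℝ) ^ (d i + 1) • fderiv ℝ (k i) x v := by
  have h1 : HasFDerivAt (fun y => k i (-y)) ((fderiv ℝ (k i) (-x)).comp
      (-ContinuousLinearMap.id ℝ (EuclideanSpace ℝ (Fin (n + 1))))) x :=
    (((hk.contDiff i).differentiable (by norm_num) (-x)).hasFDerivAt).comp x (hasFDerivAt_id x).neg
  have h2 := (((hk.contDiff i).differentiable (by norm_num) x).hasFDerivAt).const_smul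
    ((-1 : ℝ) ^ d i)
  simp_rw [hk.map_neg i] at h1
  have h3 := congrArg (fun L => L v) (h1.unique h2)
  simp only [ContinuousLinearMap.comp_apply, _root_.neg_apply,
    ContinuousLinearMap.id_apply, _root_.map_neg, _root_.smul_apply] at h3
  rw [pow_succ, mul_neg_one, neg_smul, ← h3, neg_neg]

theorem sum_sq_inner_accel_le (hd : ∀ i, 1 ≤ d i) {D : ℕ} (hD : ∀ i, d i ≤ D)
    {x v : EuclideanSpace ℝ (Fin (n + 1))} (hx : ‖x‖ = 1) (hxv : ⟪x, v⟫ = 0) (f : V) :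
    ∑ i, (⟪f, accel (k i) x v⟫ / √(d i)) ^ 2 ≤ (D * ‖v‖ ^ 2 * ‖f‖) ^ 2 := by
  rcases eq_or_ne v 0 with rfl | hv0
  · simp [accel]
  have hvn : ‖v‖ ≠ 0 := norm_ne_zero_iff.2 hv0
  set u := ‖v‖⁻¹ • v with hu
  have hun : ‖u‖ = 1 := by rw [hu, norm_smul, norm_inv, norm_norm, inv_mul_cancel₀ hvn]
  have hxu : ⟪x, u⟫ = 0 := by rw [hu, real_inner_smul_right, hxv, mul_zero]
  have hvu : v = ‖v‖ • u := by rw [hu, smul_smul, mul_inv_cancel₀ hvn, one_smul]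
  have hdr : ∀ i, (1 : ℝ) ≤ d i := fun i => by exact_mod_cast hd i
  set c : Fin n → ℝ := fun i => √(d i * (3 * d i - 2)) with hc
  have hcpos : ∀ i, 0 < (d i : ℝ) * (3 * d i - 2) := fun i => by nlinarith [hdr i]
  have hcp : ∀ i, 0 < c i := fun i => Real.sqrt_pos.2 (hcpos i)
  have hc2 : ∀ i, c i ^ 2 = d i * (3 * d i - 2) := fun i => Real.sq_sqrt (hcpos i).le
  have ho : Orthonormal ℝ fun i => (c i)⁻¹ • accel (k i) x u := by
    rw [orthonormal_iff_ite]
    intro i j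
    rw [real_inner_smul_left, real_inner_smul_right, hk.inner_accel hx hun hxu]
    split_ifs with h
    · subst h
      rw [← hc2]; have := (hcp i).ne'; field_simp
    · simp
  have hb := ho.sum_inner_products_le f (s := univ)
  have h1 : ∀ i, (⟪f, accel (k i) x v⟫ / √(d i)) ^ 2 ≤
      (D * ‖v‖ ^ 2) ^ 2 * ‖⟪(c i)⁻¹ • accel (k i) x u, f⟫‖ ^ 2 := by
    intro i
    rw [hvu, accel_smul, ← hvu, real_inner_smul_right, real_inner_smul_left, Real.norm_eq_abs, sq_abs,
      real_inner_comm, div_pow, Real.sq_sqrt (by linarith [hdr i]), mul_pow, mul_pow _ (inner ℝ _ _),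
      inv_pow, hc2, mul_pow]
    have h2 : (3 * d i - 2 : ℝ) ≤ D ^ 2 := by
      have : (3 * d i - 2 : ℝ) ≤ d i ^ 2 := by
        have := hd i
        rcases h : d i with _ | _ | m
        · omega
        · norm_num
        · push_cast; nlinarith
      have : (d i : ℝ) ≤ D := by exact_mod_cast hD i
      nlinarith [hdr i]
    have h3 : 0 < (3 * d i - 2 : ℝ) := by linarith [hdr i]
    have h4 : (0 : ℝ) < d i := by linarith [hdr i]
    have h5 : (1 : ℝ) ≤ D ^ 2 / (3 * d i - 2) := by rw [le_div_iff₀ h3]; linarith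
    set I := ⟪accel (k i) x u, f⟫
    calc (‖v‖ ^ 2) ^ 2 * I ^ 2 / d i = (‖v‖ ^ 2) ^ 2 * I ^ 2 / d i * 1 := by ring
      _ ≤ (‖v‖ ^ 2) ^ 2 * I ^ 2 / d i * (D ^ 2 / (3 * d i - 2)) := by gcongr
      _ = _ := by field_simp
  calc _ ≤ ∑ i, (D * ‖v‖ ^ 2) ^ 2 * ‖⟪(c i)⁻¹ • accel (k i) x u, f⟫‖ ^ 2 :=
        Finset.sum_le_sum fun i _ => h1 i
    _ ≤ _ := by rw [← Finset.mul_sum, mul_pow _ ‖f‖]; gcongr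

end IsKernel

end Kernel

section Chart

variable {Y E : Type*} [NormedAddCommGroup Y] [InnerProductSpace ℝ Y] [NormedAddCommGroup E]
  [InnerProductSpace ℝ E]

/-- A conformal parametrization of the unit sphere, up to sign, with conformal factor
`2 / (1 + ‖y‖ ^ 2)`. -/
structure IsConformalChart (χ : Y → E) : Prop where
  contDiff : ContDiff ℝ 2 χ
  norm_eq : ∀ y, ‖χ y‖ = 1
  inner_fderiv : ∀ y v w, ⟪fderiv ℝ χ y v, fderiv ℝ χ y w⟫ = (2 / (1 + ‖y‖ ^ 2)) ^ 2 * ⟪v, w⟫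
  exists_fderiv_eq : ∀ y v, ⟪χ y, v⟫ = 0 → ∃ w, fderiv ℝ χ y w = v
  exists_eq : ∀ x, ‖x‖ = 1 → ∃ y, χ y = x ∨ χ y = -x

theorem isConformalChart_of_isometry {p : E} (hpn : ‖p‖ = 1) (ι : Y →ₗᵢ[ℝ] E)
    (hpι : ∀ y, ⟪p, ι y⟫ = 0) (hιs : ∀ x, ⟪p, x⟫ = 0 → ∃ y, ι y = x) :
    IsConformalChart fun y : Y => (2 / (1 + ‖y‖ ^ 2)) • (p + ι y) - p := by
  have hιp : ∀ y, ⟪ι y, p⟫ = 0 := fun y => by rw [real_inner_comm, hpι]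
  have hpp : ⟪p, p⟫ = 1 := by rw [real_inner_self_eq_norm_sq, hpn]; norm_num
  have hιι : ∀ v w, ⟪ι v, ι w⟫ = ⟪v, w⟫ := ι.inner_map_map
  have hpos : ∀ y : Y, (0 : ℝ) < 1 + ‖y‖ ^ 2 := fun y => by positivity
  set l : Y → ℝ := fun y => 2 / (1 + ‖y‖ ^ 2) with hl
  have hlpos : ∀ y, 0 < l y := fun y => div_pos two_pos (hpos y)
  have hlm : ∀ y, l y * (1 + ‖y‖ ^ 2) = 2 := fun y => div_mul_cancel₀ _ (hpos y).ne'
  have hlc : ContDiff ℝ 2 l := by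
    refine contDiff_const.div (contDiff_const.add (contDiff_norm_sq ℝ)) fun y => (hpos y).ne'
  have hld : ∀ y, HasFDerivAt l (-(l y ^ 2) • innerSL ℝ y) y := by
    intro y
    have h1 := ((hasDerivAt_inv (hpos y).ne').comp_hasFDerivAt y
      ((hasFDerivAt_id (𝕜 := ℝ) y).norm_sq.const_add 1)).const_mul 2
    refine (h1.congr_fderiv ?_).congr_of_eventuallyEq (Filter.Eventually.of_forall fun y => ?_)
    · ext w
      simp [hl]
      field_simp
    · simp [hl, div_eq_mul_inv]
  set χ : Y → E := fun y => l y • (p + ι y) - p with hχ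
  have hχd : ∀ y w, fderiv ℝ χ y w = -(l y ^ 2 * ⟪y, w⟫) • (p + ι y) + l y • ι w := by
    intro y w
    have h1 := ((hld y).smul (ι.toContinuousLinearMap.hasFDerivAt.const_add p)).sub_const p
    have h2 : fderiv ℝ χ y = _ := HasFDerivAt.fderiv h1
    rw [h2]
    simp only [_root_.add_apply, _root_.smul_apply, ContinuousLinearMap.smulRight_apply,
      innerSL_apply_apply, LinearIsometry.coe_toContinuousLinearMap, smul_eq_mul, neg_mul]
    abel
  change IsConformalChart χ
  refine ⟨?_, ?_, ?_, ?_, ?_⟩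
  · exact (hlc.smul (contDiff_const.add ι.toContinuousLinearMap.contDiff)).sub contDiff_const
  · intro y
    have : ‖χ y‖ ^ 2 = 1 := by
      rw [← real_inner_self_eq_norm_sq]
      simp only [hχ, inner_sub_left, inner_sub_right, real_inner_smul_left, real_inner_smul_right,
        inner_add_left, inner_add_right, hpp, hpι, hιp, hιι, real_inner_self_eq_norm_sq y]
      linear_combination (l y) * hlm y
    nlinarith [norm_nonneg (χ y)]
  · intro y v w
    rw [hχd, hχd]
    simp only [real_inner_smul_left, real_inner_smul_right,
      inner_add_left, inner_add_right, hpp, hpι, hιp, hιι, real_inner_self_eq_norm_sq y]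
    rw [real_inner_comm y v]
    change _ = l y ^ 2 * _
    linear_combination (l y ^ 3 * ⟪y, v⟫ * ⟪y, w⟫) * hlm y
  · intro y v hv
    set a := ⟪p, v⟫ with ha
    obtain ⟨c, hc⟩ := hιs (v - a • p) (by
      rw [inner_sub_right, real_inner_smul_right, hpp, ← ha]; ring)
    have hvc : v = a • p + ι c := by rw [hc]; abel
    refine ⟨(l y)⁻¹ • (c - a • y), ?_⟩
    have hly := (hlpos y).ne'
    have h1 : l y * a - a + l y * ⟪y, c⟫ = 0 := by
      rw [← hv]
      conv_rhs => rw [hvc]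
      simp only [hχ, inner_sub_left, real_inner_smul_left, real_inner_smul_right,
        inner_add_left, inner_add_right, hpp, hpι, hιp, hιι]
      ring
    have h2 : -(l y ^ 2 * ⟪y, (l y)⁻¹ • (c - a • y)⟫) = a := by
      rw [real_inner_smul_right, inner_sub_right, real_inner_smul_right, real_inner_self_eq_norm_sq]
      have := hlm y
      field_simp
      linear_combination -h1 + a * this
    rw [hχd, h2]
    conv_rhs => rw [hvc]
    rw [map_smul, smul_smul, mul_inv_cancel₀ hly, map_sub, map_smul]
    module
  · have key : ∀ x, ‖x‖ = 1 → 0 ≤ ⟪p, x⟫ → ∃ y, χ y = x := by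
      intro x hx hpx
      set c := ⟪p, x⟫ with hc
      obtain ⟨z, hz⟩ := hιs (x - c • p) (by
        rw [inner_sub_right, real_inner_smul_right, hpp, ← hc]; ring)
      have hzn : ‖z‖ ^ 2 = 1 - c ^ 2 := by
        rw [← ι.norm_map, hz, ← real_inner_self_eq_norm_sq]
        simp only [inner_sub_left, inner_sub_right, real_inner_smul_left, real_inner_smul_right,
          hpp, ← hc, real_inner_comm p x, real_inner_self_eq_norm_sq x, hx]
        ring
      have hc1 : (0 : ℝ) < 1 + c := by linarith
      have hly : l ((1 + c)⁻¹ • z) = 1 + c := by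
        simp only [hl, norm_smul, mul_pow, hzn, Real.norm_eq_abs, sq_abs]
        rw [show 1 + (1 + c)⁻¹ ^ 2 * (1 - c ^ 2) = 2 / (1 + c) by field_simp; ring]
        field_simp
      refine ⟨(1 + c)⁻¹ • z, ?_⟩
      simp only [hχ, hly, map_smul, smul_add, smul_smul, mul_inv_cancel₀ hc1.ne', hz]
      module
    intro x hx
    rcases le_total 0 ⟪p, x⟫ with h | h
    · obtain ⟨y, hy⟩ := key x hx h
      exact ⟨y, Or.inl hy⟩
    · obtain ⟨y, hy⟩ := key (-x) (by simpa using hx) (by rw [inner_neg_right]; linarith)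
      exact ⟨y, Or.inr hy⟩

theorem exists_isConformalChart (n : ℕ) :
    ∃ χ : EuclideanSpace ℝ (Fin n) → EuclideanSpace ℝ (Fin (n + 1)), IsConformalChart χ := by
  have : Fact (Module.finrank ℝ (EuclideanSpace ℝ (Fin (n + 1))) = n + 1) :=
    ⟨finrank_euclideanSpace_fin⟩
  obtain ⟨p, hpn⟩ : ∃ p : EuclideanSpace ℝ (Fin (n + 1)), ‖p‖ = 1 :=
    ⟨EuclideanSpace.single 0 1, by simp⟩
  have hp0 : p ≠ 0 := by intro h; rw [h] at hpn; simp at hpn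
  set b := OrthonormalBasis.fromOrthogonalSpanSingleton (𝕜 := ℝ) n hp0
  refine ⟨_, isConformalChart_of_isometry hpn
    ((Submodule.subtypeₗᵢ _).comp b.repr.symm.toLinearIsometry)
    (fun y => Submodule.mem_orthogonal_singleton_iff_inner_right.1 (b.repr.symm y).2)
    fun x hx => ⟨b.repr ⟨x, Submodule.mem_orthogonal_singleton_iff_inner_right.2 hx⟩, by simp⟩⟩

namespace IsConformalChart

variable {χ : Y → E} (hχ : IsConformalChart χ)
include hχ

theorem inner_fderiv_self (y w : Y) : ⟪χ y, fderiv ℝ χ y w⟫ = 0 := by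
  have h1 := ((hχ.contDiff.differentiable (by norm_num) y).hasFDerivAt).norm_sq
  have h2 : (fun y => ‖χ y‖ ^ 2) = fun _ => 1 := by ext y; rw [hχ.norm_eq]; norm_num
  rw [h2] at h1
  have := congrArg (fun L => L w) (h1.unique (hasFDerivAt_const (1 : ℝ) y))
  simpa using this

theorem norm_fderiv (y w : Y) :
    ‖fderiv ℝ χ y w‖ = 2 / (1 + ‖y‖ ^ 2) * ‖w‖ := by
  have h := hχ.inner_fderiv y w w
  rw [real_inner_self_eq_norm_sq, real_inner_self_eq_norm_sq, ← mul_pow] at h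
  exact (pow_left_inj₀ (norm_nonneg _) (by positivity) two_ne_zero).1 h

end IsConformalChart

end Chart

section Frame

variable {n : ℕ} {d : Fin n → ℕ} {V : Type*} [NormedAddCommGroup V] [InnerProductSpace ℝ V]
  {k : Fin n → EuclideanSpace ℝ (Fin (n + 1)) → V}
  {χ : EuclideanSpace ℝ (Fin n) → EuclideanSpace ℝ (Fin (n + 1))}

/-- Normalized partial derivatives of `k i` in the chart `χ`. -/
noncomputable def frame (d : Fin n → ℕ) (k : Fin n → EuclideanSpace ℝ (Fin (n + 1)) → V)
    (χ : EuclideanSpace ℝ (Fin n) → EuclideanSpace ℝ (Fin (n + 1)))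
    (y : EuclideanSpace ℝ (Fin n)) (i j : Fin n) : V :=
  (√(d i) * (2 / (1 + ‖y‖ ^ 2)))⁻¹ • fderiv ℝ (fun y => k i (χ y)) y (EuclideanSpace.single j 1)

theorem fderiv_comp_single (hd : ∀ i, 1 ≤ d i) (i j : Fin n) (y : EuclideanSpace ℝ (Fin n)) :
    fderiv ℝ (fun y => k i (χ y)) y (EuclideanSpace.single j 1) =
      (√(d i) * (2 / (1 + ‖y‖ ^ 2))) • frame d k χ y i j := by
  have : (0 : ℝ) < d i := by exact_mod_cast hd i
  rw [frame, smul_smul, mul_inv_cancel₀ (by positivity), one_smul]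

theorem fderiv_comp_eq_sum (hd : ∀ i, 1 ≤ d i) (i : Fin n) (y ξ : EuclideanSpace ℝ (Fin n)) :
    fderiv ℝ (fun y => k i (χ y)) y ξ =
      (√(d i) * (2 / (1 + ‖y‖ ^ 2))) • ∑ j, ξ j • frame d k χ y i j := by
  have h : ξ = ∑ j, ξ j • EuclideanSpace.single j (1 : ℝ) := by
    have := (EuclideanSpace.basisFun (Fin n) ℝ).sum_repr ξ
    simpa using this.symm
  conv_lhs => rw [h]
  rw [map_sum, Finset.smul_sum]
  refine Finset.sum_congr rfl fun j _ => ?_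
  rw [map_smul, fderiv_comp_single hd, smul_comm]

namespace IsKernel

variable (hk : IsKernel d k) (hχ : IsConformalChart χ)
include hk hχ

theorem contDiff_comp (i : Fin n) : ContDiff ℝ 2 fun y => k i (χ y) :=
  (hk.contDiff i).comp hχ.contDiff

theorem fderiv_comp (i : Fin n) (y w : EuclideanSpace ℝ (Fin n)) :
    fderiv ℝ (fun y => k i (χ y)) y w = fderiv ℝ (k i) (χ y) (fderiv ℝ χ y w) := by
  have := (((hk.contDiff i).differentiable (by norm_num) (χ y)).hasFDerivAt).comp y
    ((hχ.contDiff.differentiable (by norm_num) y).hasFDerivAt)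
  have h2 : fderiv ℝ (fun y => k i (χ y)) y = _ := this.fderiv
  rw [h2]; rfl

theorem inner_comp (i j : Fin n) (y : EuclideanSpace ℝ (Fin n)) :
    ⟪k i (χ y), k j (χ y)⟫ = if i = j then 1 else 0 := by
  rw [hk.inner_eq, real_inner_self_eq_norm_sq, hχ.norm_eq]; simp

theorem orthonormal_comp (y : EuclideanSpace ℝ (Fin n)) :
    Orthonormal ℝ fun i => k i (χ y) :=
  orthonormal_iff_ite.2 fun i j => hk.inner_comp hχ i j y

theorem inner_comp_fderiv (i j : Fin n) (y w : EuclideanSpace ℝ (Fin n)) :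
    ⟪k i (χ y), fderiv ℝ (fun y => k j (χ y)) y w⟫ = 0 := by
  rw [hk.fderiv_comp hχ, hk.inner_fderiv, hχ.inner_fderiv_self]; simp

theorem inner_comp_frame (i j l : Fin n) (y : EuclideanSpace ℝ (Fin n)) :
    ⟪k i (χ y), frame d k χ y j l⟫ = 0 := by
  rw [frame, real_inner_smul_right, hk.inner_comp_fderiv hχ, mul_zero]

theorem inner_fderiv_comp (i j : Fin n) (y v w : EuclideanSpace ℝ (Fin n)) :
    ⟪fderiv ℝ (fun y => k i (χ y)) y v, fderiv ℝ (fun y => k j (χ y)) y w⟫ =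
      if i = j then d i * ((2 / (1 + ‖y‖ ^ 2)) ^ 2 * ⟪v, w⟫) else 0 := by
  rw [hk.fderiv_comp hχ, hk.fderiv_comp hχ,
    hk.inner_fderiv_fderiv i j (hχ.norm_eq y) (hχ.inner_fderiv_self y w), hχ.inner_fderiv]

theorem orthonormal_frame (hd : ∀ i, 1 ≤ d i) (y : EuclideanSpace ℝ (Fin n)) :
    Orthonormal ℝ fun p : Fin n × Fin n => frame d k χ y p.1 p.2 := by
  rw [orthonormal_iff_ite]
  rintro ⟨i, j⟩ ⟨i', j'⟩
  have hdi : (0 : ℝ) < d i := by exact_mod_cast hd i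
  simp only [frame, real_inner_smul_left, real_inner_smul_right, hk.inner_fderiv_comp hχ,
    Prod.mk.injEq]
  by_cases hi : i = i'
  · subst hi
    by_cases hj : j = j'
    · subst hj
      have h2 : √(d i : ℝ) ^ 2 = d i := Real.sq_sqrt hdi.le
      have h3 := (Real.sqrt_pos.2 hdi).ne'
      simp only [if_true, and_self]
      simp only [real_inner_self_eq_norm_sq, PiLp.norm_single]
      simp
      field_simp
      rw [h2]
    · simp [hj, EuclideanSpace.inner_single_left]
  · simp [hi]

theorem contDiff_frame (i j : Fin n) : ContDiff ℝ 1 fun y => frame d k χ y i j := by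
  by_cases hd : d i = 0
  · have h0 : (fun y => frame d k χ y i j) = fun _ => 0 := by ext y; simp [frame, hd]
    rw [h0]
    exact contDiff_const
  have hpos : ∀ y : EuclideanSpace ℝ (Fin n), (0 : ℝ) < 1 + ‖y‖ ^ 2 := fun y => by positivity
  have hdi : (0 : ℝ) < d i := by exact_mod_cast Nat.pos_of_ne_zero hd
  refine ContDiff.smul (ContDiff.inv (contDiff_const.mul ?_) fun y => by positivity) ?_
  · exact contDiff_const.div (contDiff_const.add (contDiff_norm_sq ℝ)) fun y => (hpos y).ne'
  · exact ((hk.contDiff_comp hχ i).fderiv_right (by norm_num)).clm_apply contDiff_const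

end IsKernel

end Frame

section Coordinates

variable {n : ℕ} {V : Type*} [NormedAddCommGroup V] [InnerProductSpace ℝ V] [FiniteDimensional ℝ V]

/-- The map sending a family `e` of vectors to the linear map `h ↦ (⟪e i, h⟫)ᵢ`. -/
noncomputable def coordL (n : ℕ) (V : Type*) [NormedAddCommGroup V] [InnerProductSpace ℝ V]
    [FiniteDimensional ℝ V] : (Fin n → V) →L[ℝ] V →L[ℝ] EuclideanSpace ℝ (Fin n) :=
  LinearMap.toContinuousLinearMap
    { toFun := fun e => (EuclideanSpace.equiv (Fin n) ℝ).symm.toContinuousLinearMap ∘L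
        ContinuousLinearMap.pi fun i => innerSL ℝ (e i)
      map_add' := fun e e' => by ext h i; simp
      map_smul' := fun c e => by ext h i; simp }

@[simp] theorem coordL_apply (e : Fin n → V) (h : V) (i : Fin n) :
    coordL n V e h i = ⟪e i, h⟫ := by
  simp [coordL]

/-- The map sending a family `e` of vectors to the linear map `x ↦ ∑ i, x i • e i`. -/
noncomputable def synthL (n : ℕ) (V : Type*) [NormedAddCommGroup V] [InnerProductSpace ℝ V]
    [FiniteDimensional ℝ V] : (Fin n → V) →L[ℝ] EuclideanSpace ℝ (Fin n) →L[ℝ] V :=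
  LinearMap.toContinuousLinearMap
    { toFun := fun e => ∑ i, (EuclideanSpace.proj i : EuclideanSpace ℝ (Fin n) →L[ℝ] ℝ).smulRight
        (e i)
      map_add' := fun e e' => by ext x; simp [Finset.sum_add_distrib]
      map_smul' := fun c e => by
        ext x
        simp only [Pi.smul_apply, _root_.sum_apply,
          ContinuousLinearMap.smulRight_apply, RingHom.id_apply, _root_.smul_apply, Finset.smul_sum]
        exact Finset.sum_congr rfl fun i _ => smul_comm _ _ _ }

@[simp] theorem synthL_apply (e : Fin n → V) (x : EuclideanSpace ℝ (Fin n)) :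
    synthL n V e x = ∑ i, x i • e i := by
  simp [synthL]

theorem coordL_synthL {e : Fin n → V} (he : Orthonormal ℝ e) (x : EuclideanSpace ℝ (Fin n)) :
    coordL n V e (synthL n V e x) = x := by
  ext i
  rw [coordL_apply, synthL_apply, inner_sum]
  simp [real_inner_smul_right, orthonormal_iff_ite.1 he]

theorem inner_synthL (e : Fin n → V) (x : EuclideanSpace ℝ (Fin n)) (h : V) :
    ⟪synthL n V e x, h⟫ = ⟪x, coordL n V e h⟫ := by
  rw [synthL_apply, sum_inner, PiLp.inner_apply]
  refine Finset.sum_congr rfl fun i _ => ?_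
  rw [real_inner_smul_left, coordL_apply]
  simp [mul_comm]

theorem det_eq_det_apply_single (L : EuclideanSpace ℝ (Fin n) →L[ℝ] EuclideanSpace ℝ (Fin n)) :
    L.det = (Matrix.of fun i j => L (EuclideanSpace.single j 1) i).det := by
  rw [ContinuousLinearMap.det,
    ← LinearMap.det_toMatrix (EuclideanSpace.basisFun (Fin n) ℝ).toBasis]
  congr 1

theorem fderiv_euclidean_apply {Y : Type*} [NormedAddCommGroup Y] [NormedSpace ℝ Y]
    {g : Y → EuclideanSpace ℝ (Fin n)} {y : Y} {i : Fin n} {L : Y →L[ℝ] ℝ}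
    (hg : DifferentiableAt ℝ g y) (h : HasFDerivAt (fun y => g y i) L y) (w : Y) :
    fderiv ℝ g y w i = L w := by
  have h1 := (EuclideanSpace.proj i : EuclideanSpace ℝ (Fin n) →L[ℝ] ℝ).hasFDerivAt.comp y
    hg.hasFDerivAt
  exact congrArg (fun L => L w) (h1.unique h)

end Coordinates

section GaussianArea

theorem stdGaussian_image_fst_le {V X : Type*} [NormedAddCommGroup V] [InnerProductSpace ℝ V]
    [FiniteDimensional ℝ V] [MeasurableSpace V] [BorelSpace V]
    [NormedAddCommGroup X] [NormedSpace ℝ X] [FiniteDimensional ℝ X] [MeasurableSpace X]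
    [BorelSpace X] (ν : Measure X) [ν.IsAddHaarMeasure]
    {Ω : Set X} (hΩ : IsOpen Ω) (K : X → V →L[ℝ] X) (P : X → X →L[ℝ] V) (k : X → X)
    (hK : ∀ θ ∈ Ω, DifferentiableAt ℝ K θ) (hP : ∀ θ ∈ Ω, DifferentiableAt ℝ P θ)
    (hk : ∀ θ ∈ Ω, DifferentiableAt ℝ k θ)
    (hKm : Measurable K) (hPm : Measurable P) (hkm : Measurable k)
    (hKP : ∀ θ ∈ Ω, ∀ x, K θ (P θ x) = x) {S : Set (V × X)} (hS : MeasurableSet S)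
    (hSΩ : ∀ p ∈ S, p.2 ∈ Ω ∧ K p.2 p.1 = k p.2)
    {ψ : X → ℝ≥0∞} (hψ : Measurable ψ)
    (hψle : ∀ θ ∈ Ω, ∀ h, gaussWeight (h - P θ (K θ h - k θ)) * ψ (K θ h) ≤ gaussWeight h)
    {F : X → ℝ≥0∞} (hF : ∀ θ, ∫⁻ h, Set.indicator
        {p : V × X | (p.1 - P p.2 (K p.2 p.1 - k p.2), p.2) ∈ S}
        (fun p => ENNReal.ofReal |(fderiv ℝ (fun θ' => K θ' (p.1 - P p.2 (K p.2 p.1 - k p.2)) - k θ')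
          p.2).det|) (h, θ) ∂(stdGaussian V) ≤ F θ) :
    stdGaussian V (Prod.fst '' S) * ∫⁻ c, ψ c ∂ν ≤ ∫⁻ θ, F θ ∂ν := by
  have h0 := lintegral_image_fst_mul_le (volume : Measure V) ν hΩ K P k hK hP hk hKm hPm hkm hKP hS
    hSΩ measurable_gaussWeight hψ
  have h1 : ∫⁻ f in Prod.fst '' S, gaussWeight f =
      gaussMass (Module.finrank ℝ V) * stdGaussian V (Prod.fst '' S) := by
    rw [← withDensity_apply', withDensity_gaussWeight, Measure.smul_apply, smul_eq_mul]
  have h2 : ∀ θ, ∫⁻ h, Set.indicator {p : V × X | (p.1 - P p.2 (K p.2 p.1 - k p.2), p.2) ∈ S}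
        (fun p => ENNReal.ofReal |(fderiv ℝ (fun θ' => K θ' (p.1 - P p.2 (K p.2 p.1 - k p.2)) - k θ')
          p.2).det| * (gaussWeight (p.1 - P p.2 (K p.2 p.1 - k p.2)) * ψ (K p.2 p.1))) (h, θ) ≤
      gaussMass (Module.finrank ℝ V) * F θ := by
    intro θ
    refine le_trans ?_ (mul_le_mul_right (hF θ) _)
    rw [← lintegral_gaussWeight_mul]
    refine lintegral_mono fun h => ?_
    by_cases hm : (h - P θ (K θ h - k θ), θ) ∈ S
    · rw [Set.indicator_of_mem (by exact hm), Set.indicator_of_mem (by exact hm), mul_comm]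
      gcongr
      exact hψle θ (hSΩ _ hm).1 h
    · rw [Set.indicator_of_notMem (by exact hm)]
      exact zero_le
  have h3 := h0.trans (lintegral_mono h2)
  rw [h1, lintegral_const_mul' _ _ (gaussMass_ne_top _), mul_assoc] at h3
  exact (ENNReal.mul_le_mul_iff_right (gaussMass_ne_zero _) (gaussMass_ne_top _)).1 h3

theorem gaussWeight_mul_gaussWeight {V W : Type*} [NormedAddCommGroup V] [NormedAddCommGroup W]
    (v : V) (w : W) :
    gaussWeight v * gaussWeight w = ENNReal.ofReal (Real.exp (-(1 / 2) * (‖v‖ ^ 2 + ‖w‖ ^ 2))) := by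
  rw [gaussWeight, gaussWeight, ← ENNReal.ofReal_mul (Real.exp_nonneg _), ← Real.exp_add]
  ring_nf

end GaussianArea

section NearlySingularZero

variable {n : ℕ} {d : Fin n → ℕ} {V : Type*} [NormedAddCommGroup V] [InnerProductSpace ℝ V]
  {k : Fin n → EuclideanSpace ℝ (Fin (n + 1)) → V}

/-- Systems with a zero on the unit sphere at which the normalized derivative shrinks some
direction by more than the factor `s`. -/
def nearlySingularZero (d : Fin n → ℕ) (k : Fin n → EuclideanSpace ℝ (Fin (n + 1)) → V) (s : ℝ) :
    Set V :=
  {f | ∃ x v, ‖x‖ = 1 ∧ ‖v‖ = 1 ∧ ⟪x, v⟫ = 0 ∧ (∀ i, ⟪k i x, f⟫ = 0) ∧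
    ∑ i, (⟪fderiv ℝ (k i) x v, f⟫ / √(d i)) ^ 2 < s ^ 2 * ‖f‖ ^ 2}

open Matrix in
theorem nearlySingularZero_subset {χ : EuclideanSpace ℝ (Fin n) → EuclideanSpace ℝ (Fin (n + 1))}
    (hk : IsKernel d k) (hχ : IsConformalChart χ) (hd : ∀ i, 1 ≤ d i) (s : ℝ) :
    nearlySingularZero d k s ⊆ Prod.fst '' {p : V × EuclideanSpace ℝ (Fin n) |
      (∀ i, ⟪k i (χ p.2), p.1⟫ = 0) ∧ ∃ ξ : Fin n → ℝ, ξ ⬝ᵥ ξ = 1 ∧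
        ((Matrix.of fun i j => ⟪frame d k χ p.2 i j, p.1⟫) *ᵥ ξ) ⬝ᵥ
          ((Matrix.of fun i j => ⟪frame d k χ p.2 i j, p.1⟫) *ᵥ ξ) < s ^ 2 * ‖p.1‖ ^ 2} := by
  rintro f ⟨x, v, hx, hv, hxv, hz, hs⟩
  have key : ∀ y w, (∀ i, ⟪k i (χ y), f⟫ = 0) → ‖w‖ = 1 → ⟪χ y, w⟫ = 0 →
      ∑ i, (⟪fderiv ℝ (k i) (χ y) w, f⟫ / √(d i)) ^ 2 < s ^ 2 * ‖f‖ ^ 2 → ∃ ξ : Fin n → ℝ,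
        ξ ⬝ᵥ ξ = 1 ∧ ((Matrix.of fun i j => ⟪frame d k χ y i j, f⟫) *ᵥ ξ) ⬝ᵥ
          ((Matrix.of fun i j => ⟪frame d k χ y i j, f⟫) *ᵥ ξ) < s ^ 2 * ‖f‖ ^ 2 := by
    intro y w _ hw hyw hsum
    obtain ⟨η, hη⟩ := hχ.exists_fderiv_eq y w hyw
    have hl : (0 : ℝ) < 2 / (1 + ‖y‖ ^ 2) := by positivity
    set l := 2 / (1 + ‖y‖ ^ 2) with hl_def
    have hn := hχ.norm_fderiv y η
    rw [hη, hw, ← hl_def] at hn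
    refine ⟨fun j => l * η j, ?_, ?_⟩
    · have : ‖η‖ ^ 2 = ∑ j, η j ^ 2 := by rw [EuclideanSpace.norm_sq_eq]; simp
      simp only [dotProduct]
      calc ∑ j, l * η j * (l * η j) = l ^ 2 * ∑ j, η j ^ 2 := by
            rw [Finset.mul_sum]; exact Finset.sum_congr rfl fun j _ => by ring
        _ = 1 := by rw [← this, ← mul_pow, ← hn, one_pow]
    · refine lt_of_eq_of_lt ?_ hsum
      rw [dotProduct]
      refine Finset.sum_congr rfl fun i _ => ?_
      have hdi : (0 : ℝ) < √(d i) := Real.sqrt_pos.2 (by exact_mod_cast hd i)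
      rw [← hη, ← hk.fderiv_comp hχ, fderiv_comp_eq_sum hd, real_inner_smul_left, sum_inner, ← sq]
      congr 1
      rw [← hl_def, mul_assoc, mul_div_cancel_left₀ _ hdi.ne', Finset.mul_sum]
      simp only [mulVec, dotProduct, Matrix.of_apply, real_inner_smul_left]
      exact Finset.sum_congr rfl fun j _ => by ring
  obtain ⟨y, hy | hy⟩ := hχ.exists_eq x hx
  · rw [← hy] at hz hs hxv
    exact ⟨(f, y), ⟨hz, key y v hz hv hxv hs⟩, rfl⟩
  · have hxy : x = -χ y := by rw [hy, neg_neg]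
    rw [hxy] at hz hs hxv
    have hz' : ∀ i, ⟪k i (χ y), f⟫ = 0 := fun i => by
      have := hz i
      rw [hk.map_neg, real_inner_smul_left] at this
      exact (mul_eq_zero.1 this).resolve_left (by positivity)
    refine ⟨(f, y), ⟨hz', key y v hz' hv (by simpa using hxv) (lt_of_eq_of_lt ?_ hs)⟩, rfl⟩
    refine Finset.sum_congr rfl fun i _ => ?_
    rw [hk.fderiv_neg, real_inner_smul_left, mul_div_assoc, mul_pow, ← pow_mul,
      Even.neg_one_pow (by simp), one_mul]

end NearlySingularZero

section Adjoint

variable {V X : Type*} [NormedAddCommGroup V] [InnerProductSpace ℝ V] [NormedAddCommGroup X]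
  [InnerProductSpace ℝ X]

theorem norm_sub_sq_add_norm_sq {K : V →L[ℝ] X} {P : X →L[ℝ] V}
    (hP : ∀ x h, ⟪P x, h⟫ = ⟪x, K h⟫) (hKP : ∀ x, K (P x) = x) (h : V) (c : X) :
    ‖h - P (K h - c)‖ ^ 2 + ‖K h‖ ^ 2 = ‖h‖ ^ 2 + ‖c‖ ^ 2 := by
  have h1 : ‖P (K h - c)‖ ^ 2 = ‖K h - c‖ ^ 2 := by
    rw [← real_inner_self_eq_norm_sq, hP, hKP, real_inner_self_eq_norm_sq]
  rw [norm_sub_sq_real, real_inner_comm, hP, h1, norm_sub_sq_real, inner_sub_left,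
    real_inner_self_eq_norm_sq, real_inner_comm c (K h)]
  ring

theorem gaussWeight_sub_mul_le {K : V →L[ℝ] X} {P : X →L[ℝ] V}
    (hP : ∀ x h, ⟪P x, h⟫ = ⟪x, K h⟫) (hKP : ∀ x, K (P x) = x) (h : V) (c : X) :
    gaussWeight (h - P (K h - c)) * gaussWeight (K h) ≤ gaussWeight h := by
  rw [gaussWeight_mul_gaussWeight, norm_sub_sq_add_norm_sq hP hKP, gaussWeight]
  refine ENNReal.ofReal_le_ofReal (Real.exp_le_exp.2 ?_)
  nlinarith [sq_nonneg ‖c‖]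

end Adjoint

section NearlySingularZero

variable {n : ℕ} {d : Fin n → ℕ} {V : Type*} [NormedAddCommGroup V] [InnerProductSpace ℝ V]
  {k : Fin n → EuclideanSpace ℝ (Fin (n + 1)) → V}
  {χ : EuclideanSpace ℝ (Fin n) → EuclideanSpace ℝ (Fin (n + 1))}

/-- The normalized derivative of the system `f` in the chart `χ`. -/
noncomputable def normDeriv (d : Fin n → ℕ) (k : Fin n → EuclideanSpace ℝ (Fin (n + 1)) → V)
    (χ : EuclideanSpace ℝ (Fin n) → EuclideanSpace ℝ (Fin (n + 1)))
    (y : EuclideanSpace ℝ (Fin n)) (f : V) : Matrix (Fin n) (Fin n) ℝ :=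
  Matrix.of fun i j => ⟪frame d k χ y i j, f⟫

theorem det_normDeriv_smul (c : Fin n → ℝ) (l : ℝ) (B : Matrix (Fin n) (Fin n) ℝ) :
    (Matrix.of fun i j => c i * l * B i j).det = (∏ i, c i) * l ^ n * B.det := by
  have := Matrix.det_mul_column (fun i => c i * l) B
  rw [this, Finset.prod_mul_distrib]
  simp

section
variable (hk : IsKernel d k) (hχ : IsConformalChart χ)
include hk hχ

theorem IsKernel.continuous_normDeriv (i j : Fin n) :
    Continuous fun p : V × EuclideanSpace ℝ (Fin n) => normDeriv d k χ p.2 p.1 i j := by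
  simp only [normDeriv, Matrix.of_apply]
  exact ((hk.contDiff_frame hχ i j).continuous.comp continuous_snd).inner continuous_fst

open Matrix in
theorem IsKernel.measurableSet_nearlySingular [FiniteDimensional ℝ V] [MeasurableSpace V] [BorelSpace V]
    (s : ℝ) :
    MeasurableSet {p : V × EuclideanSpace ℝ (Fin n) |
      (∀ i, ⟪k i (χ p.2), p.1⟫ = 0) ∧ ∃ ξ : Fin n → ℝ, ξ ⬝ᵥ ξ = 1 ∧
        (normDeriv d k χ p.2 p.1 *ᵥ ξ) ⬝ᵥ (normDeriv d k χ p.2 p.1 *ᵥ ξ) < s ^ 2 * ‖p.1‖ ^ 2} := by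
  have hc := hk.continuous_normDeriv hχ
  refine MeasurableSet.inter ?_ ?_
  · refine IsClosed.measurableSet ?_
    change IsClosed {p : V × EuclideanSpace ℝ (Fin n) | ∀ i, ⟪k i (χ p.2), p.1⟫ = 0}
    rw [Set.ofPred_forall]
    refine isClosed_iInter fun i => isClosed_eq ?_ continuous_const
    exact ((hk.contDiff_comp hχ i).continuous.comp continuous_snd).inner continuous_fst
  · refine IsOpen.measurableSet ?_
    have : {p : V × EuclideanSpace ℝ (Fin n) | ∃ ξ : Fin n → ℝ, ξ ⬝ᵥ ξ = 1 ∧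
        (normDeriv d k χ p.2 p.1 *ᵥ ξ) ⬝ᵥ (normDeriv d k χ p.2 p.1 *ᵥ ξ) < s ^ 2 * ‖p.1‖ ^ 2} =
        ⋃ ξ : {ξ : Fin n → ℝ // ξ ⬝ᵥ ξ = 1}, {p : V × EuclideanSpace ℝ (Fin n) |
          (normDeriv d k χ p.2 p.1 *ᵥ ξ) ⬝ᵥ (normDeriv d k χ p.2 p.1 *ᵥ ξ) <
            s ^ 2 * ‖p.1‖ ^ 2} := by
      ext p
      simp
    change IsOpen {p : V × EuclideanSpace ℝ (Fin n) | ∃ ξ : Fin n → ℝ, _}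
    rw [this]
    refine isOpen_iUnion fun ξ => isOpen_lt ?_ (by fun_prop)
    simp only [dotProduct, mulVec]
    fun_prop

theorem IsKernel.det_fderiv_coordL [FiniteDimensional ℝ V] (hd : ∀ i, 1 ≤ d i)
    (y : EuclideanSpace ℝ (Fin n)) (f : V) :
    (fderiv ℝ (fun y => coordL n V (fun i => k i (χ y)) f) y).det =
      (∏ i, √(d i)) * (2 / (1 + ‖y‖ ^ 2)) ^ n * (normDeriv d k χ y f).det := by
  have hdiff : ∀ i, DifferentiableAt ℝ (fun y => k i (χ y)) y := fun i =>
    (hk.contDiff_comp hχ i).differentiable two_ne_zero y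
  have hg : DifferentiableAt ℝ (fun y => coordL n V (fun i => k i (χ y)) f) y :=
    ((coordL n V).differentiableAt.comp y (differentiableAt_pi.2 hdiff)).clm_apply
      (differentiableAt_const f)
  rw [det_eq_det_apply_single, ← det_normDeriv_smul]
  congr 2
  ext i j
  have h1 : HasFDerivAt (fun y => coordL n V (fun i => k i (χ y)) f i)
      ((innerSL ℝ f) ∘L fderiv ℝ (fun y => k i (χ y)) y) y := by
    have h0 := (innerSL ℝ f).hasFDerivAt.comp y (hdiff i).hasFDerivAt
    refine h0.congr_of_eventuallyEq (Filter.Eventually.of_forall fun z => ?_)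
    simp [real_inner_comm]
  rw [fderiv_euclidean_apply hg h1, ContinuousLinearMap.comp_apply, fderiv_comp_single hd,
    map_smul, innerSL_apply_apply, normDeriv, Matrix.of_apply, real_inner_comm, smul_eq_mul]

theorem IsKernel.normDeriv_sub_synthL [FiniteDimensional ℝ V] (y x : EuclideanSpace ℝ (Fin n)) (h : V) :
    normDeriv d k χ y (h - synthL n V (fun i => k i (χ y)) x) = normDeriv d k χ y h := by
  ext i j
  rw [normDeriv, normDeriv, Matrix.of_apply, Matrix.of_apply, inner_sub_right, synthL_apply,
    inner_sum, sub_eq_self]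
  refine Finset.sum_eq_zero fun l _ => ?_
  rw [real_inner_smul_right, real_inner_comm, hk.inner_comp_frame hχ, mul_zero]

open Matrix in
theorem IsKernel.stdGaussian_nearlySingularZero_mul_le [FiniteDimensional ℝ V] [MeasurableSpace V]
    [BorelSpace V] (hd : ∀ i, 1 ≤ d i) {s : ℝ} (hs : 0 ≤ s) :
    stdGaussian V (nearlySingularZero d k s) * gaussMass n ≤
      ∫⁻ y : EuclideanSpace ℝ (Fin n), ENNReal.ofReal ((2 / (1 + ‖y‖ ^ 2)) ^ n) *
        ENNReal.ofReal ((∏ i, √(d i)) * s * (√(Module.finrank ℝ V) * √(n * n.factorial))) := by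
  have hprod : 0 ≤ ∏ i, √(d i : ℝ) := Finset.prod_nonneg fun i _ => Real.sqrt_nonneg _
  set e : EuclideanSpace ℝ (Fin n) → Fin n → V := fun y i => k i (χ y) with he
  have hed : Differentiable ℝ e := fun y => differentiableAt_pi.2 fun i =>
    (hk.contDiff_comp hχ i).differentiable two_ne_zero y
  have hec : Continuous e := hed.continuous
  have hKP : ∀ y x, coordL n V (e y) (synthL n V (e y) x) = x := fun y x =>
    coordL_synthL (hk.orthonormal_comp hχ y) x
  have hPK : ∀ y x h, ⟪synthL n V (e y) x, h⟫ = ⟪x, coordL n V (e y) h⟫ := fun y x h =>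
    inner_synthL (e y) x h
  have hnorm : ∀ y h, ‖h - synthL n V (e y) (coordL n V (e y) h - 0)‖ ≤ ‖h‖ := fun y h => by
    have := norm_sub_sq_add_norm_sq (hPK y) (hKP y) h 0
    rw [norm_zero] at this
    exact abs_le_of_sq_le_sq' (by nlinarith [sq_nonneg ‖coordL n V (e y) h‖]) (norm_nonneg _) |>.2
  have main := stdGaussian_image_fst_le (V := V) (volume : Measure (EuclideanSpace ℝ (Fin n)))
    isOpen_univ (fun y => coordL n V (e y)) (fun y => synthL n V (e y)) (fun _ => 0)
    (fun y _ => (coordL n V).differentiableAt.comp y (hed y))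
    (fun y _ => (synthL n V).differentiableAt.comp y (hed y))
    (fun y _ => differentiableAt_const _)
    ((coordL n V).continuous.comp hec).measurable ((synthL n V).continuous.comp hec).measurable
    measurable_const (fun y _ => hKP y) (hk.measurableSet_nearlySingular hχ s)
    (fun p hp => ⟨Set.mem_univ _, by ext i; simpa [he] using hp.1 i⟩)
    measurable_gaussWeight (fun y _ h => gaussWeight_sub_mul_le (hPK y) (hKP y) h 0)
    (F := fun y => ENNReal.ofReal ((2 / (1 + ‖y‖ ^ 2)) ^ n) *
        ENNReal.ofReal ((∏ i, √(d i)) * s * (√(Module.finrank ℝ V) * √(n * n.factorial)))) ?_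
  · rw [lintegral_gaussWeight, finrank_euclideanSpace, Fintype.card_fin] at main
    exact (mul_le_mul_left (measure_mono (nearlySingularZero_subset hk hχ hd s)) _).trans main
  intro y
  have hl : (0 : ℝ) ≤ (2 / (1 + ‖y‖ ^ 2)) ^ n := by positivity
  rw [← ENNReal.ofReal_mul hl, ← mul_assoc, ENNReal.ofReal_mul (by positivity)]
  refine le_trans ?_ (mul_le_mul_right
    (lintegral_norm_mul_adjugate_le (hk.orthonormal_frame hχ hd y)) _)
  rw [← lintegral_const_mul' _ _ ENNReal.ofReal_ne_top]
  refine lintegral_mono fun h => Set.indicator_apply_le' (fun hp => ?_) (fun _ => zero_le)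
  obtain ⟨-, ξ, hξ, hlt⟩ := hp
  dsimp only at hlt ⊢
  have hB : normDeriv d k χ y (h - synthL n V (e y) (coordL n V (e y) h - 0)) =
      normDeriv d k χ y h := hk.normDeriv_sub_synthL hχ y _ h
  have hdet := hk.det_fderiv_coordL hχ hd y (h - synthL n V (e y) (coordL n V (e y) h - 0))
  simp only [sub_zero (coordL n V (e _) (h - _))]
  rw [hB] at hlt hdet
  rw [hdet, ← ENNReal.ofReal_mul (by positivity)]
  refine ENNReal.ofReal_le_ofReal ?_
  change _ ≤ _ * (‖h‖ * √(∑ k_1, ∑ l, (normDeriv d k χ y h).adjugate k_1 l ^ 2))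
  set B := normDeriv d k χ y h
  have hdetB : |B.det| ≤ s * ‖h‖ * √(∑ k, ∑ l, B.adjugate k l ^ 2) := by
    rw [← Real.sqrt_sq (mul_nonneg hs (norm_nonneg h)), ← Real.sqrt_mul (sq_nonneg _)]
    refine Real.abs_le_sqrt ((sq_det_le_adjugate B hξ).trans ?_)
    refine mul_le_mul_of_nonneg_right (hlt.le.trans ?_) (by positivity)
    rw [mul_pow]
    gcongr
    exact hnorm y h
  rw [abs_mul, abs_of_nonneg (by positivity)]
  calc (∏ i, √(d i : ℝ)) * (2 / (1 + ‖y‖ ^ 2)) ^ n * |B.det|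
      ≤ (∏ i, √(d i : ℝ)) * (2 / (1 + ‖y‖ ^ 2)) ^ n *
        (s * ‖h‖ * √(∑ k, ∑ l, B.adjugate k l ^ 2)) := by gcongr
    _ = _ := by ring

theorem IsKernel.stdGaussian_nearlySingularZero_le [FiniteDimensional ℝ V] [MeasurableSpace V]
    [BorelSpace V] (hn : 1 ≤ n) (hd : ∀ i, 1 ≤ d i) {s : ℝ} (hs : 0 ≤ s) :
    stdGaussian V (nearlySingularZero d k s) ≤
      ENNReal.ofReal (√(2 * Real.pi) * n * (∏ i, √(d i)) * √(Module.finrank ℝ V) * s) := by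
  have hprod : 0 ≤ ∏ i, √(d i : ℝ) := Finset.prod_nonneg fun i _ => Real.sqrt_nonneg _
  have hn0 : (0 : ℝ) < n := by exact_mod_cast hn
  have h := hk.stdGaussian_nearlySingularZero_mul_le hχ hd hs
  rw [lintegral_mul_const' _ _ ENNReal.ofReal_ne_top, lintegral_conformal_factor_pow hn] at h
  refine (ENNReal.mul_le_mul_iff_left (gaussMass_ne_zero n) (gaussMass_ne_top n)).1 (h.trans ?_)
  have hG : 0 < Real.Gamma n := Real.Gamma_pos_of_pos hn0
  have hG2 : 0 < Real.Gamma (n / 2) := Real.Gamma_pos_of_pos (by positivity)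
  rw [gaussMass, ← ENNReal.ofReal_mul (by positivity), ← ENNReal.ofReal_mul (by positivity)]
  refine ENNReal.ofReal_le_ofReal ?_
  have hkey : (2 : ℝ) ^ n * Real.pi ^ ((n : ℝ) / 2) * Real.Gamma (n / 2) / Real.Gamma n *
      √(n * n.factorial) ≤ √(2 * Real.pi) * n * (2 * Real.pi) ^ ((n : ℝ) / 2) := by
    refine abs_le_of_sq_le_sq' ?_ (by positivity) |>.2
    have hfac : ((n.factorial : ℕ) : ℝ) = n * Real.Gamma n := by
      rw [← Real.Gamma_nat_eq_factorial, Real.Gamma_add_one hn0.ne']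
    have hp : ∀ a : ℝ, 0 ≤ a → (a ^ ((n : ℝ) / 2)) ^ 2 = a ^ n := fun a ha => by
      rw [← Real.rpow_natCast, ← Real.rpow_mul ha, ← Real.rpow_natCast]
      norm_num
    rw [mul_pow, mul_pow, mul_pow, div_pow, mul_pow, mul_pow, Real.sq_sqrt (by positivity),
      Real.sq_sqrt (by positivity), hp _ Real.pi_pos.le, hp _ (by positivity), hfac, mul_pow]
    have h2 := two_pow_mul_sq_Gamma_half_le n hn
    have : (0 : ℝ) < 2 ^ n * Real.pi ^ n * n ^ 2 / Real.Gamma n := by positivity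
    calc ((2 : ℝ) ^ n) ^ 2 * Real.pi ^ n * Real.Gamma (n / 2) ^ 2 / Real.Gamma n ^ 2 *
          (n * (n * Real.Gamma n))
        = (2 ^ n * Real.pi ^ n * n ^ 2 / Real.Gamma n) * (2 ^ n * Real.Gamma (n / 2) ^ 2) := by
          field_simp
      _ ≤ (2 ^ n * Real.pi ^ n * n ^ 2 / Real.Gamma n) * (2 * Real.pi * Real.Gamma n) := by gcongr
      _ = _ := by field_simp
  calc _ = ((2 : ℝ) ^ n * Real.pi ^ ((n : ℝ) / 2) * Real.Gamma (n / 2) / Real.Gamma n *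
        √(n * n.factorial)) * ((∏ i, √(d i : ℝ)) * s * √(Module.finrank ℝ V)) := by ring
    _ ≤ (√(2 * Real.pi) * n * (2 * Real.pi) ^ ((n : ℝ) / 2)) *
        ((∏ i, √(d i : ℝ)) * s * √(Module.finrank ℝ V)) := by gcongr
    _ = _ := by ring

end

end NearlySingularZero

theorem hasDerivAt_fderiv_line {E F : Type*} [NormedAddCommGroup E] [NormedSpace ℝ E]
    [NormedAddCommGroup F] [NormedSpace ℝ F] {g : E → F} (hg : ContDiff ℝ 2 g) (y ξ : E) :
    HasDerivAt (fun s : ℝ => fderiv ℝ g (y + s • ξ) ξ)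
      (fderiv ℝ (fderiv ℝ g) (y + (0 : ℝ) • ξ) ξ ξ) 0 := by
  have hline : HasDerivAt (fun s : ℝ => y + s • ξ) ξ 0 := by
    simpa using ((hasDerivAt_id (0 : ℝ)).smul_const ξ).const_add y
  have h1 : ContDiff ℝ 1 (fderiv ℝ g) := hg.fderiv_right (by norm_num)
  have h2 := (h1.differentiable one_ne_zero (y + (0 : ℝ) • ξ)).hasFDerivAt.comp_hasDerivAt
    (0 : ℝ) hline
  exact (h2.clm_apply (hasDerivAt_const (0 : ℝ) ξ)).congr_deriv (by simp)

section CriticalHessian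

variable {n : ℕ} {d : Fin n → ℕ} {V : Type*} [NormedAddCommGroup V] [InnerProductSpace ℝ V]
  {k : Fin n → EuclideanSpace ℝ (Fin (n + 1)) → V}
  {χ : EuclideanSpace ℝ (Fin n) → EuclideanSpace ℝ (Fin (n + 1))}

theorem euclidean_eq_sum_single (ξ : EuclideanSpace ℝ (Fin n)) :
    ξ = ∑ j, ξ j • EuclideanSpace.single j (1 : ℝ) := by
  have := (EuclideanSpace.basisFun (Fin n) ℝ).sum_repr ξ
  simpa using this.symm

/-- The second derivative of `∑ i, (z i / √(d i)) * ⟪k i (χ y), f⟫` with respect to `y`. -/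
noncomputable def critHess (d : Fin n → ℕ) (k : Fin n → EuclideanSpace ℝ (Fin (n + 1)) → V)
    (χ : EuclideanSpace ℝ (Fin n) → EuclideanSpace ℝ (Fin (n + 1)))
    (z y : EuclideanSpace ℝ (Fin n)) (f : V) : Matrix (Fin n) (Fin n) ℝ :=
  Matrix.of fun j l => ∑ i, z i / √(d i) * ⟪fderiv ℝ (fderiv ℝ fun y => k i (χ y)) y
    (EuclideanSpace.single l 1) (EuclideanSpace.single j 1), f⟫

open Matrix in
theorem dotProduct_critHess (z y ξ : EuclideanSpace ℝ (Fin n)) (f : V) :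
    ξ.ofLp ⬝ᵥ critHess d k χ z y f *ᵥ ξ.ofLp =
      ∑ i, z i / √(d i) * ⟪fderiv ℝ (fderiv ℝ fun y => k i (χ y)) y ξ ξ, f⟫ := by
  have h : ∀ i, ⟪fderiv ℝ (fderiv ℝ fun y => k i (χ y)) y ξ ξ, f⟫ =
      ∑ j, ∑ l, ξ j * (ξ l * ⟪fderiv ℝ (fderiv ℝ fun y => k i (χ y)) y
    (EuclideanSpace.single l 1) (EuclideanSpace.single j 1), f⟫) := by
    intro i
    generalize fderiv ℝ (fderiv ℝ fun y => k i (χ y)) y = L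
    conv_lhs => rw [euclidean_eq_sum_single ξ]
    simp only [map_sum, map_smul, _root_.sum_apply, _root_.smul_apply, sum_inner,
      real_inner_smul_left, Finset.mul_sum]
  simp only [h, dotProduct, mulVec, critHess, Matrix.of_apply, Finset.mul_sum, Finset.sum_mul]
  symm
  rw [Finset.sum_comm]
  refine Finset.sum_congr rfl fun j _ => ?_
  rw [Finset.sum_comm]
  exact Finset.sum_congr rfl fun l _ => Finset.sum_congr rfl fun i _ => by ring

variable (hk : IsKernel d k) (hχ : IsConformalChart χ)
include hk hχ

theorem IsKernel.isSymm_critHess (z y : EuclideanSpace ℝ (Fin n)) (f : V) :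
    (critHess d k χ z y f).IsSymm := by
  ext j l
  simp only [Matrix.transpose_apply, critHess, Matrix.of_apply]
  refine Finset.sum_congr rfl fun i _ => ?_
  have : IsSymmSndFDerivAt ℝ (fun y => k i (χ y)) y :=
    (hk.contDiff_comp hχ i).contDiffAt.isSymmSndFDerivAt (by simp)
  rw [this.eq]

theorem IsKernel.exists_fderiv_fderiv_comp_eq (y ξ : EuclideanSpace ℝ (Fin n)) :
    ∃ w, ∀ i, fderiv ℝ (fderiv ℝ fun y => k i (χ y)) y ξ ξ =
      accel (k i) (χ y) (fderiv ℝ χ y ξ) + fderiv ℝ (fun y => k i (χ y)) y w := by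
  have hline : HasDerivAt (fun s : ℝ => y + s • ξ) ξ 0 := by
    simpa using ((hasDerivAt_id (0 : ℝ)).smul_const ξ).const_add y
  have hy0 : y + (0 : ℝ) • ξ = y := by simp
  have hc : HasDerivAt (fun s : ℝ => χ (y + s • ξ)) (fderiv ℝ χ (y + (0 : ℝ) • ξ) ξ) 0 :=
    (hχ.contDiff.differentiable two_ne_zero _).hasFDerivAt.comp_hasDerivAt (0 : ℝ) hline
  have hc₁ : HasDerivAt (fun s : ℝ => fderiv ℝ χ (y + s • ξ) ξ)
      (fderiv ℝ (fderiv ℝ χ) (y + (0 : ℝ) • ξ) ξ ξ) 0 := hasDerivAt_fderiv_line hχ.contDiff y ξ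
  have htan : ⟪χ y, fderiv ℝ (fderiv ℝ χ) y ξ ξ + ‖fderiv ℝ χ y ξ‖ ^ 2 • χ y⟫ = 0 := by
    have h1 := hc.inner ℝ hc₁
    have h2 : HasDerivAt (fun s : ℝ => ⟪χ (y + s • ξ), fderiv ℝ χ (y + s • ξ) ξ⟫) 0 0 := by
      simp only [hχ.inner_fderiv_self]
      exact hasDerivAt_const _ _
    have h3 := h1.unique h2
    simp only [hy0] at h3
    rw [inner_add_right, real_inner_smul_right, real_inner_self_eq_norm_sq (χ y), hχ.norm_eq,
      ← h3, real_inner_self_eq_norm_sq]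
    ring
  obtain ⟨w, hw⟩ := hχ.exists_fderiv_eq y _ htan
  refine ⟨w, fun i => ?_⟩
  have h1 := hasDerivAt_fderiv_comp (hk.contDiff i) hc hc₁
  have h2 := hasDerivAt_fderiv_line (hk.contDiff_comp hχ i) y ξ
  have h3 := h2.unique (h1.congr_of_eventuallyEq
    (Filter.Eventually.of_forall fun s => hk.fderiv_comp hχ i _ _))
  simp only [hy0] at h3
  rw [h3, hk.fderiv_comp hχ, hw]

open Matrix in
theorem IsKernel.abs_dotProduct_critHess_le (hd : ∀ i, 1 ≤ d i) {D : ℕ} (hD : ∀ i, d i ≤ D)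
    {z y : EuclideanSpace ℝ (Fin n)} {f : V} (hcrit : z.ofLp ᵥ* normDeriv d k χ y f = 0)
    (ξ : EuclideanSpace ℝ (Fin n)) :
    |ξ.ofLp ⬝ᵥ critHess d k χ z y f *ᵥ ξ.ofLp| ≤
      (2 / (1 + ‖y‖ ^ 2)) ^ 2 * (‖z‖ * D * ‖f‖) * ‖ξ‖ ^ 2 := by
  obtain ⟨w, hw⟩ := hk.exists_fderiv_fderiv_comp_eq hχ y ξ
  have hcrit' : ∀ j, ∑ i, z i * ⟪frame d k χ y i j, f⟫ = 0 := fun j => by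
    simpa [vecMul, dotProduct, normDeriv] using congrFun hcrit j
  have h0 : ∑ i, z i / √(d i) * ⟪fderiv ℝ (fun y => k i (χ y)) y w, f⟫ = 0 := by
    have : ∀ i, z i / √(d i) * ⟪fderiv ℝ (fun y => k i (χ y)) y w, f⟫ =
        ∑ j, (2 / (1 + ‖y‖ ^ 2)) * w j * (z i * ⟪frame d k χ y i j, f⟫) := fun i => by
      have hdi : √(d i : ℝ) ≠ 0 := (Real.sqrt_pos.2 (by exact_mod_cast hd i)).ne'
      rw [fderiv_comp_eq_sum hd, real_inner_smul_left, sum_inner, Finset.mul_sum, Finset.mul_sum]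
      refine Finset.sum_congr rfl fun j _ => ?_
      rw [real_inner_smul_left]
      field_simp
    simp only [this]
    rw [Finset.sum_comm]
    simp only [← Finset.mul_sum, hcrit', mul_zero, Finset.sum_const_zero]
  rw [dotProduct_critHess]
  have h1 : ∑ i, z i / √(d i) * ⟪fderiv ℝ (fderiv ℝ fun y => k i (χ y)) y ξ ξ, f⟫ =
      ∑ i, z i * (⟪f, accel (k i) (χ y) (fderiv ℝ χ y ξ)⟫ / √(d i)) := by
    rw [← sub_eq_zero, ← Finset.sum_sub_distrib, ← h0]
    refine Finset.sum_congr rfl fun i _ => ?_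
    rw [hw, inner_add_left, real_inner_comm f]
    ring
  rw [h1]
  have h2 := Finset.sum_mul_sq_le_sq_mul_sq univ (fun i => z i)
    fun i => ⟪f, accel (k i) (χ y) (fderiv ℝ χ y ξ)⟫ / √(d i)
  have h3 := hk.sum_sq_inner_accel_le hd hD (hχ.norm_eq y) (hχ.inner_fderiv_self y ξ) f
  have h4 : ∑ i, z i ^ 2 = ‖z‖ ^ 2 := by rw [EuclideanSpace.norm_sq_eq]; simp
  rw [h4] at h2
  refine abs_le_of_sq_le_sq (h2.trans ((mul_le_mul_of_nonneg_left h3 (sq_nonneg _)).trans_eq ?_))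
    (by positivity)
  rw [hχ.norm_fderiv]
  ring

end CriticalHessian

open Matrix in
theorem exists_orthonormal_gram {n : ℕ} (hn : 1 ≤ n) {z : EuclideanSpace ℝ (Fin n)} (hz : z ≠ 0) :
    ∃ w : Fin (n - 1) → EuclideanSpace ℝ (Fin n), Orthonormal ℝ w ∧ (∀ l, ⟪z, w l⟫ = 0) ∧
      ∀ B : Matrix (Fin n) (Fin n) ℝ, z.ofLp ᵥ* B = 0 →
        Bᵀ * B = ∑ l, vecMulVec ((w l).ofLp ᵥ* B) ((w l).ofLp ᵥ* B) := by
  obtain ⟨m, rfl⟩ : ∃ m, n = m + 1 := ⟨n - 1, by omega⟩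
  have hzn : ‖z‖ ≠ 0 := norm_ne_zero_iff.2 hz
  obtain ⟨b, hb⟩ := Orthonormal.exists_orthonormalBasis_extension_of_card_eq (𝕜 := ℝ)
    (E := EuclideanSpace ℝ (Fin (m + 1))) (ι := Fin (m + 1)) (by simp)
    (v := fun _ => ‖z‖⁻¹ • z) (s := {0}) (by
      rw [orthonormal_iff_ite]
      rintro ⟨i, rfl⟩ ⟨j, rfl⟩
      simp [norm_smul, hzn])
  have hb0 : b 0 = ‖z‖⁻¹ • z := hb 0 rfl
  have hzb : ‖z‖ • b 0 = z := by rw [hb0, smul_smul, mul_inv_cancel₀ hzn, one_smul]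
  refine ⟨fun l => b l.succ, b.orthonormal.comp _ (Fin.succ_injective m), fun l => ?_, ?_⟩
  · rw [← hzb, real_inner_smul_left, b.orthonormal.2 (Fin.succ_ne_zero l).symm, mul_zero]
  intro B hB
  have hcol : ∀ (v : EuclideanSpace ℝ (Fin (m + 1))) j,
      ⟪v, WithLp.toLp 2 (fun i => B i j)⟫ = (v.ofLp ᵥ* B) j := fun v j => by
    simp [PiLp.inner_apply, vecMul, dotProduct, mul_comm]
  ext j l
  have h1 := b.sum_inner_mul_inner (WithLp.toLp 2 fun i => B i j) (WithLp.toLp 2 fun i => B i l)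
  rw [Fin.sum_univ_succ] at h1
  have h2 : ⟪b 0, WithLp.toLp 2 (fun i => B i l)⟫ = 0 := by
    rw [hb0, real_inner_smul_left, hcol, hB]; simp
  rw [h2, mul_zero, zero_add] at h1
  have h3 : (Bᵀ * B) j l = ⟪WithLp.toLp 2 (fun i => B i j), WithLp.toLp 2 (fun i => B i l)⟫ := by
    simp [Matrix.mul_apply, PiLp.inner_apply, mul_comm]
  rw [h3, ← h1, Matrix.sum_apply]
  refine Finset.sum_congr rfl fun i _ => ?_
  rw [real_inner_comm, hcol, hcol, vecMulVec_apply]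

open Matrix in
theorem abs_det_fromBlocks {n : ℕ} (a : Fin n → ℝ) {c l : ℝ} (hc : 0 ≤ c) (hl : 0 < l)
    (ha : ∀ i, 0 ≤ a i)
    (B S : Matrix (Fin n) (Fin n) ℝ) :
    |(fromBlocks (-diagonal a) (l • (diagonal a * B)) (c • Bᵀ) ((c * l⁻¹) • S)).det| =
      (∏ i, a i) * (c * l) ^ n * |(Bᵀ * B + (l⁻¹) ^ 2 • S).det| := by
  have h : fromBlocks (-diagonal a) (l • (diagonal a * B)) (c • Bᵀ) ((c * l⁻¹) • S) =
      fromBlocks (-diagonal a) 0 0 ((c * l) • 1) *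
        fromBlocks 1 (-(l • B)) (l⁻¹ • Bᵀ) ((l⁻¹) ^ 2 • S) := by
    rw [fromBlocks_multiply]
    congr 1
    · simp
    · rw [neg_mul_neg, Matrix.mul_smul, Matrix.zero_mul, add_zero]
    · rw [Matrix.zero_mul, zero_add, Matrix.smul_mul, Matrix.one_mul, smul_smul,
        mul_assoc, mul_inv_cancel₀ hl.ne', mul_one]
    · rw [Matrix.zero_mul, zero_add, Matrix.smul_mul, Matrix.one_mul, smul_smul]
      congr 1
      field_simp
  rw [h, det_mul, det_fromBlocks_zero₂₁, det_fromBlocks_one₁₁, det_neg, det_diagonal, det_smul]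
  have h2 : (l⁻¹) ^ 2 • S - l⁻¹ • Bᵀ * -(l • B) = Bᵀ * B + (l⁻¹) ^ 2 • S := by
    simp [smul_smul, hl.ne', add_comm]
  rw [h2, abs_mul, abs_mul, abs_mul, abs_pow, abs_neg, abs_one, one_pow, one_mul,
    abs_of_nonneg (Finset.prod_nonneg fun i _ => ha i), det_one, mul_one, Fintype.card_fin,
    abs_of_nonneg (by positivity)]

open Matrix in
theorem det_prod_eq_det_fromBlocks {n : ℕ}
    (T : EuclideanSpace ℝ (Fin n) × EuclideanSpace ℝ (Fin n) →L[ℝ]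
      EuclideanSpace ℝ (Fin n) × EuclideanSpace ℝ (Fin n)) :
    T.det = (fromBlocks (of fun i j => (T (EuclideanSpace.single j 1, 0)).1 i)
      (of fun i j => (T (0, EuclideanSpace.single j 1)).1 i)
      (of fun i j => (T (EuclideanSpace.single j 1, 0)).2 i)
      (of fun i j => (T (0, EuclideanSpace.single j 1)).2 i)).det := by
  rw [ContinuousLinearMap.det,
    ← LinearMap.det_toMatrix ((EuclideanSpace.basisFun (Fin n) ℝ).toBasis.prod
      (EuclideanSpace.basisFun (Fin n) ℝ).toBasis)]
  congr 1
  ext (i | i) (j | j) <;> simp [LinearMap.toMatrix_apply]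

section CriticalHessian

variable {n : ℕ} {d : Fin n → ℕ} {V : Type*} [NormedAddCommGroup V] [InnerProductSpace ℝ V]
  {k : Fin n → EuclideanSpace ℝ (Fin (n + 1)) → V}
  {χ : EuclideanSpace ℝ (Fin n) → EuclideanSpace ℝ (Fin (n + 1))}

open Matrix in
theorem IsKernel.abs_det_gram_add_critHess_le (hk : IsKernel d k) (hχ : IsConformalChart χ)
    (hd : ∀ i, 1 ≤ d i) {D : ℕ} (hD : ∀ i, d i ≤ D)
    {z y : EuclideanSpace ℝ (Fin n)} {f : V} (hcrit : z.ofLp ᵥ* normDeriv d k χ y f = 0)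
    {ρ : ℝ} (hρ0 : 0 < ρ) (hρ : ‖z‖ * D * ‖f‖ ≤ ρ) :
    |((normDeriv d k χ y f)ᵀ * normDeriv d k χ y f +
      ((2 / (1 + ‖y‖ ^ 2))⁻¹) ^ 2 • critHess d k χ z y f).det| ≤
      (ρ • (1 : Matrix (Fin n) (Fin n) ℝ) + (normDeriv d k χ y f)ᵀ * normDeriv d k χ y f).det := by
  set B := normDeriv d k χ y f
  have hl : (0 : ℝ) < 2 / (1 + ‖y‖ ^ 2) := by positivity
  have hquad := hk.abs_dotProduct_critHess_le hχ hd hD hcrit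
  set l := 2 / (1 + ‖y‖ ^ 2)
  have hS := hk.isSymm_critHess hχ z y f
  set S := critHess d k χ z y f
  refine abs_det_le_of_abs_quadratic_le ?_ ?_ fun ξ => ?_
  · exact (by simp [IsSymm] : (Bᵀ * B).IsSymm).add (hS.smul _)
  · refine (PosDef.smul PosDef.one hρ0).add_posSemidef ?_
    simpa using posSemidef_conjTranspose_mul_self B
  · have hB : ξ ⬝ᵥ (Bᵀ * B) *ᵥ ξ = (B *ᵥ ξ) ⬝ᵥ (B *ᵥ ξ) := by
      rw [← mulVec_mulVec, dotProduct_mulVec, vecMul_transpose]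
    have hB0 : 0 ≤ (B *ᵥ ξ) ⬝ᵥ (B *ᵥ ξ) := by
      simpa using dotProduct_star_self_nonneg (B *ᵥ ξ)
    have h1 := hquad (WithLp.toLp 2 ξ)
    have hξ : ‖(WithLp.toLp 2 ξ : EuclideanSpace ℝ (Fin n))‖ ^ 2 = ξ ⬝ᵥ ξ := by
      rw [EuclideanSpace.norm_sq_eq]; simp [dotProduct, sq]
    have hξ0 : 0 ≤ ξ ⬝ᵥ ξ := by rw [← hξ]; positivity
    rw [hξ] at h1
    rw [add_mulVec, dotProduct_add, add_mulVec, dotProduct_add, hB, smul_mulVec, dotProduct_smul,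
      smul_mulVec, dotProduct_smul, one_mulVec, smul_eq_mul, smul_eq_mul]
    have h2 : |(l⁻¹) ^ 2 * (ξ ⬝ᵥ S *ᵥ ξ)| ≤ ρ * (ξ ⬝ᵥ ξ) := by
      rw [abs_mul, abs_of_nonneg (by positivity)]
      calc (l⁻¹) ^ 2 * |ξ ⬝ᵥ S *ᵥ ξ| ≤ (l⁻¹) ^ 2 * (l ^ 2 * (‖z‖ * D * ‖f‖) * (ξ ⬝ᵥ ξ)) := by
            gcongr
        _ = (‖z‖ * D * ‖f‖) * (ξ ⬝ᵥ ξ) := by field_simp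
        _ ≤ _ := by gcongr
    refine (abs_add_le _ _).trans ?_
    rw [abs_of_nonneg hB0]
    linarith

end CriticalHessian

section PairCoordinates

variable {n : ℕ} {V : Type*} [NormedAddCommGroup V] [InnerProductSpace ℝ V] [FiniteDimensional ℝ V]

/-- The map sending two families of vectors to the pair of their coordinate maps. -/
noncomputable def pairCoordL (n : ℕ) (V : Type*) [NormedAddCommGroup V] [InnerProductSpace ℝ V]
    [FiniteDimensional ℝ V] : (Fin n → V) × (Fin n → V) →L[ℝ] V →L[ℝ]
      EuclideanSpace ℝ (Fin n) × EuclideanSpace ℝ (Fin n) :=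
  (ContinuousLinearMap.compL ℝ V _ _ (ContinuousLinearMap.inl ℝ _ _)) ∘L coordL n V ∘L
      ContinuousLinearMap.fst ℝ _ _ +
    (ContinuousLinearMap.compL ℝ V _ _ (ContinuousLinearMap.inr ℝ _ _)) ∘L coordL n V ∘L
      ContinuousLinearMap.snd ℝ _ _

@[simp] theorem pairCoordL_apply (p : (Fin n → V) × (Fin n → V)) (h : V) :
    pairCoordL n V p h = (coordL n V p.1 h, coordL n V p.2 h) := by
  simp [pairCoordL]

/-- The map sending two families of vectors to the sum of their synthesis maps. -/
noncomputable def pairSynthL (n : ℕ) (V : Type*) [NormedAddCommGroup V] [InnerProductSpace ℝ V]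
    [FiniteDimensional ℝ V] : (Fin n → V) × (Fin n → V) →L[ℝ]
      EuclideanSpace ℝ (Fin n) × EuclideanSpace ℝ (Fin n) →L[ℝ] V :=
  let E := EuclideanSpace ℝ (Fin n)
  ((ContinuousLinearMap.compL ℝ (E × E) E V).flip (ContinuousLinearMap.fst ℝ E E)) ∘L
      synthL n V ∘L ContinuousLinearMap.fst ℝ _ _ +
    ((ContinuousLinearMap.compL ℝ (E × E) E V).flip (ContinuousLinearMap.snd ℝ E E)) ∘L
      synthL n V ∘L ContinuousLinearMap.snd ℝ _ _

@[simp] theorem pairSynthL_apply (p : (Fin n → V) × (Fin n → V))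
    (x : EuclideanSpace ℝ (Fin n) × EuclideanSpace ℝ (Fin n)) :
    pairSynthL n V p x = synthL n V p.1 x.1 + synthL n V p.2 x.2 := by
  simp [pairSynthL]

theorem coordL_synthL_eq_zero {e e' : Fin n → V} (h : ∀ i j, ⟪e i, e' j⟫ = 0)
    (x : EuclideanSpace ℝ (Fin n)) : coordL n V e (synthL n V e' x) = 0 := by
  ext i
  simp [h]

theorem pairCoordL_pairSynthL {p : (Fin n → V) × (Fin n → V)} (h1 : Orthonormal ℝ p.1)
    (h2 : Orthonormal ℝ p.2) (h12 : ∀ i j, ⟪p.1 i, p.2 j⟫ = 0)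
    (x : EuclideanSpace ℝ (Fin n) × EuclideanSpace ℝ (Fin n)) :
    pairCoordL n V p (pairSynthL n V p x) = x := by
  rw [pairCoordL_apply, pairSynthL_apply, map_add, map_add, coordL_synthL h1, coordL_synthL h2,
    coordL_synthL_eq_zero h12, coordL_synthL_eq_zero fun i j => by rw [real_inner_comm, h12]]
  simp

theorem gaussWeight_sub_pairSynthL_mul_le {p : (Fin n → V) × (Fin n → V)}
    (h1 : Orthonormal ℝ p.1)
    (h2 : Orthonormal ℝ p.2) (h12 : ∀ i j, ⟪p.1 i, p.2 j⟫ = 0) (h : V)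
    (c : EuclideanSpace ℝ (Fin n) × EuclideanSpace ℝ (Fin n)) :
    gaussWeight (h - pairSynthL n V p (pairCoordL n V p h - c)) *
      (gaussWeight (pairCoordL n V p h).1 * gaussWeight (pairCoordL n V p h).2) ≤
        gaussWeight h := by
  set h' := h - synthL n V p.1 (coordL n V p.1 h - c.1) with hh'
  have e1 : coordL n V p.2 h' = coordL n V p.2 h := by
    rw [hh', map_sub, coordL_synthL_eq_zero fun i j => by rw [real_inner_comm, h12], sub_zero]
  have e2 : h - pairSynthL n V p (pairCoordL n V p h - c) =
      h' - synthL n V p.2 (coordL n V p.2 h' - c.2) := by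
    rw [e1, hh', pairSynthL_apply, pairCoordL_apply]
    simp only [Prod.fst_sub, Prod.snd_sub]
    abel
  have i1 := gaussWeight_sub_mul_le (inner_synthL p.2) (coordL_synthL h2) h' c.2
  have i2 := gaussWeight_sub_mul_le (inner_synthL p.1) (coordL_synthL h1) h c.1
  rw [e1] at i1
  rw [e2, e1, pairCoordL_apply, mul_comm (gaussWeight (coordL n V p.1 h)), ← mul_assoc]
  exact (mul_le_mul_left i1 _).trans i2

/-- Multiplication of the coordinates by the constants `a i`. -/
noncomputable def diagL (a : Fin n → ℝ) :
    EuclideanSpace ℝ (Fin n) →L[ℝ] EuclideanSpace ℝ (Fin n) :=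
  LinearMap.toContinuousLinearMap
    { toFun := fun z => WithLp.toLp 2 fun i => a i * z i
      map_add' := fun z z' => by ext i; simp [mul_add]
      map_smul' := fun c z => by ext i; simp [mul_left_comm] }

@[simp] theorem diagL_apply (a : Fin n → ℝ) (z : EuclideanSpace ℝ (Fin n)) (i : Fin n) :
    diagL a z i = a i * z i := by
  simp [diagL]

theorem fderiv_prod_euclidean_fst_apply {Y : Type*} [NormedAddCommGroup Y] [NormedSpace ℝ Y]
    {g : Y → EuclideanSpace ℝ (Fin n) × EuclideanSpace ℝ (Fin n)} {y : Y} {i : Fin n}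
    {L : Y →L[ℝ] ℝ} (hg : DifferentiableAt ℝ g y) (h : HasFDerivAt (fun y => (g y).1 i) L y)
    (w : Y) : (fderiv ℝ g y w).1 i = L w := by
  have h1 := ((EuclideanSpace.proj i : EuclideanSpace ℝ (Fin n) →L[ℝ] ℝ) ∘L
    ContinuousLinearMap.fst ℝ _ (EuclideanSpace ℝ (Fin n))).hasFDerivAt.comp y hg.hasFDerivAt
  exact congrArg (fun L => L w) (h1.unique h)

theorem fderiv_prod_euclidean_snd_apply {Y : Type*} [NormedAddCommGroup Y] [NormedSpace ℝ Y]
    {g : Y → EuclideanSpace ℝ (Fin n) × EuclideanSpace ℝ (Fin n)} {y : Y} {i : Fin n}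
    {L : Y →L[ℝ] ℝ} (hg : DifferentiableAt ℝ g y) (h : HasFDerivAt (fun y => (g y).2 i) L y)
    (w : Y) : (fderiv ℝ g y w).2 i = L w := by
  have h1 := ((EuclideanSpace.proj i : EuclideanSpace ℝ (Fin n) →L[ℝ] ℝ) ∘L
    ContinuousLinearMap.snd ℝ (EuclideanSpace ℝ (Fin n)) _).hasFDerivAt.comp y hg.hasFDerivAt
  exact congrArg (fun L => L w) (h1.unique h)

end PairCoordinates

section CriticalFrame

variable {n : ℕ} {d : Fin n → ℕ} {V : Type*} [NormedAddCommGroup V] [InnerProductSpace ℝ V]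
  {k : Fin n → EuclideanSpace ℝ (Fin (n + 1)) → V}
  {χ : EuclideanSpace ℝ (Fin n) → EuclideanSpace ℝ (Fin (n + 1))}

/-- The frame combined along the direction of `z`. -/
noncomputable def dirFrame (d : Fin n → ℕ) (k : Fin n → EuclideanSpace ℝ (Fin (n + 1)) → V)
    (χ : EuclideanSpace ℝ (Fin n) → EuclideanSpace ℝ (Fin (n + 1)))
    (z y : EuclideanSpace ℝ (Fin n)) (j : Fin n) : V :=
  ‖z‖⁻¹ • ∑ i, z i • frame d k χ y i j

/-- The orthonormal families whose coordinates express that `y` is a critical point with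
value `z`. -/
noncomputable def critPair (d : Fin n → ℕ) (k : Fin n → EuclideanSpace ℝ (Fin (n + 1)) → V)
    (χ : EuclideanSpace ℝ (Fin n) → EuclideanSpace ℝ (Fin (n + 1)))
    (θ : EuclideanSpace ℝ (Fin n) × EuclideanSpace ℝ (Fin n)) : (Fin n → V) × (Fin n → V) :=
  (fun i => k i (χ θ.2), dirFrame d k χ θ.1 θ.2)

open Matrix in
theorem inner_dirFrame (z y : EuclideanSpace ℝ (Fin n)) (j : Fin n) (f : V) :
    ⟪dirFrame d k χ z y j, f⟫ = ‖z‖⁻¹ * (z.ofLp ᵥ* normDeriv d k χ y f) j := by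
  simp [dirFrame, real_inner_smul_left, sum_inner, vecMul, dotProduct, normDeriv]

theorem inner_dirFrame_eq (z y : EuclideanSpace ℝ (Fin n)) (j : Fin n) (f : V) :
    ⟪dirFrame d k χ z y j, f⟫ = (‖z‖⁻¹ * (2 / (1 + ‖y‖ ^ 2))⁻¹) * ∑ i, z i / √(d i) *
      ⟪fderiv ℝ (fun y => k i (χ y)) y (EuclideanSpace.single j 1), f⟫ := by
  simp only [dirFrame, frame, real_inner_smul_left, sum_inner, Finset.mul_sum]
  refine Finset.sum_congr rfl fun i _ => ?_
  rw [mul_inv]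
  ring

variable (hk : IsKernel d k) (hχ : IsConformalChart χ)
include hk hχ

theorem IsKernel.orthonormal_dirFrame (hd : ∀ i, 1 ≤ d i) {z : EuclideanSpace ℝ (Fin n)}
    (hz : z ≠ 0) (y : EuclideanSpace ℝ (Fin n)) : Orthonormal ℝ (dirFrame d k χ z y) := by
  have hzn : ‖z‖ ≠ 0 := norm_ne_zero_iff.2 hz
  have hO := orthonormal_iff_ite.1 (hk.orthonormal_frame hχ hd y)
  have hO' : ∀ i j i' j', ⟪frame d k χ y i j, frame d k χ y i' j'⟫ =
      if i = i' ∧ j = j' then (1 : ℝ) else 0 := fun i j i' j' => by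
    simpa using hO (i, j) (i', j')
  have hzz : ∑ i, z i ^ 2 = ‖z‖ ^ 2 := by rw [EuclideanSpace.norm_sq_eq]; simp
  rw [orthonormal_iff_ite]
  intro j j'
  simp only [dirFrame, real_inner_smul_left, real_inner_smul_right, sum_inner, inner_sum, hO']
  by_cases h : j = j'
  · simp only [h, and_true, mul_ite, mul_one, mul_zero, Finset.sum_ite_eq', Finset.mem_univ,
      if_true]
    field_simp
    rw [← Finset.sum_div, hzz, sq, mul_div_assoc, div_self hzn, mul_one]
  · simp [h]

theorem IsKernel.inner_comp_dirFrame (z y : EuclideanSpace ℝ (Fin n)) (i j : Fin n) :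
    ⟪k i (χ y), dirFrame d k χ z y j⟫ = 0 := by
  simp [dirFrame, real_inner_smul_right, inner_sum, hk.inner_comp_frame hχ]

theorem IsKernel.differentiableAt_critPair
    {θ : EuclideanSpace ℝ (Fin n) × EuclideanSpace ℝ (Fin n)} (hθ : θ.1 ≠ 0) :
    DifferentiableAt ℝ (critPair d k χ) θ := by
  refine DifferentiableAt.prodMk (differentiableAt_pi.2 fun i => ?_)
    (differentiableAt_pi.2 fun j => ?_)
  · exact DifferentiableAt.comp (g := fun y => k i (χ y)) θ ((hk.contDiff_comp hχ i).differentiable two_ne_zero θ.2)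
      differentiableAt_snd
  · have hf : ∀ i, DifferentiableAt ℝ (fun θ : EuclideanSpace ℝ (Fin n) ×
        EuclideanSpace ℝ (Fin n) => frame d k χ θ.2 i j) θ := fun i =>
      DifferentiableAt.comp θ ((hk.contDiff_frame hχ i j).differentiable one_ne_zero θ.2)
        differentiableAt_snd
    have hz : ∀ i, DifferentiableAt ℝ (fun θ : EuclideanSpace ℝ (Fin n) ×
        EuclideanSpace ℝ (Fin n) => θ.1 i) θ := fun i => by fun_prop
    refine DifferentiableAt.smul (f := fun θ : EuclideanSpace ℝ (Fin n) ×
        EuclideanSpace ℝ (Fin n) => ∑ i, θ.1 i • frame d k χ θ.2 i j) ?_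
      (DifferentiableAt.fun_sum fun i _ => (hz i).smul (hf i))
    exact (differentiableAt_fst.norm ℝ hθ).inv (norm_ne_zero_iff.2 hθ)

theorem IsKernel.measurable_critPair [FiniteDimensional ℝ V] [MeasurableSpace V] [BorelSpace V] :
    Measurable (critPair d k χ) := by
  refine Measurable.prodMk (measurable_pi_lambda _ fun i => ?_) (measurable_pi_lambda _ fun j => ?_)
  · exact ((hk.contDiff_comp hχ i).continuous.comp continuous_snd).measurable
  · refine Measurable.smul (by fun_prop) (Finset.measurable_sum _ fun i _ => Continuous.measurable ?_)
    refine Continuous.smul (by fun_prop) ((hk.contDiff_frame hχ i j).continuous.comp continuous_snd)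

theorem IsKernel.hasFDerivAt_fst_critical (hd : ∀ i, 1 ≤ d i)
    (z y : EuclideanSpace ℝ (Fin n)) (f : V) (i : Fin n) :
    ∃ L : EuclideanSpace ℝ (Fin n) × EuclideanSpace ℝ (Fin n) →L[ℝ] ℝ,
      HasFDerivAt (fun θ : EuclideanSpace ℝ (Fin n) × EuclideanSpace ℝ (Fin n) =>
        ⟪k i (χ θ.2), f⟫ - √(d i) * θ.1 i) L (z, y) ∧
      (∀ j, L (EuclideanSpace.single j 1, 0) = -(if i = j then √(d i) else 0)) ∧
      ∀ j, L (0, EuclideanSpace.single j 1) =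
        2 / (1 + ‖y‖ ^ 2) * (√(d i) * normDeriv d k χ y f i j) := by
  have h1 : HasFDerivAt (fun y => ⟪k i (χ y), f⟫)
      ((innerSL ℝ f) ∘L fderiv ℝ (fun y => k i (χ y)) y) y := by
    have h0 := (innerSL ℝ f).hasFDerivAt.comp y
      ((hk.contDiff_comp hχ i).differentiable two_ne_zero y).hasFDerivAt
    refine h0.congr_of_eventuallyEq (Filter.Eventually.of_forall fun z => ?_)
    simp [real_inner_comm]
  have h2 := h1.comp (z, y) (hasFDerivAt_snd (𝕜 := ℝ) (p := (z, y)))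
  have h3 : HasFDerivAt (fun θ : EuclideanSpace ℝ (Fin n) × EuclideanSpace ℝ (Fin n) => θ.1 i)
      ((EuclideanSpace.proj i : EuclideanSpace ℝ (Fin n) →L[ℝ] ℝ) ∘L
        ContinuousLinearMap.fst ℝ _ _) (z, y) :=
    ((EuclideanSpace.proj i : EuclideanSpace ℝ (Fin n) →L[ℝ] ℝ) ∘L
      ContinuousLinearMap.fst ℝ _ (EuclideanSpace ℝ (Fin n))).hasFDerivAt
  refine ⟨_, h2.sub (h3.const_mul _), fun j => ?_, fun j => ?_⟩
  · simp
  · simp only [_root_.sub_apply, ContinuousLinearMap.comp_apply, ContinuousLinearMap.coe_snd',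
      _root_.smul_apply, ContinuousLinearMap.coe_fst', map_zero, smul_zero, sub_zero,
      fderiv_comp_single hd, map_smul, innerSL_apply_apply]
    rw [normDeriv, Matrix.of_apply, real_inner_comm, smul_eq_mul]
    ring

open Matrix in
theorem IsKernel.hasFDerivAt_snd_critical (hd : ∀ i, 1 ≤ d i)
    {z : EuclideanSpace ℝ (Fin n)} (hz : z ≠ 0) (y : EuclideanSpace ℝ (Fin n)) {f : V}
    (hcrit : z.ofLp ᵥ* normDeriv d k χ y f = 0) (j : Fin n) :
    ∃ L : EuclideanSpace ℝ (Fin n) × EuclideanSpace ℝ (Fin n) →L[ℝ] ℝ,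
      HasFDerivAt (fun θ : EuclideanSpace ℝ (Fin n) × EuclideanSpace ℝ (Fin n) =>
        ⟪dirFrame d k χ θ.1 θ.2 j, f⟫) L (z, y) ∧
      (∀ l, L (EuclideanSpace.single l 1, 0) = ‖z‖⁻¹ * (normDeriv d k χ y f) l j) ∧
      ∀ l, L (0, EuclideanSpace.single l 1) =
        ‖z‖⁻¹ * (2 / (1 + ‖y‖ ^ 2))⁻¹ * critHess d k χ z y f j l := by
  have hzn : ‖z‖ ≠ 0 := norm_ne_zero_iff.2 hz
  have hdi : ∀ i, √(d i : ℝ) ≠ 0 := fun i => (Real.sqrt_pos.2 (by exact_mod_cast hd i)).ne'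
  have hl : 2 / (1 + ‖y‖ ^ 2) ≠ 0 := by positivity
  have h1 : ∀ i, HasFDerivAt (fun y => ⟪fderiv ℝ (fun y => k i (χ y)) y
      (EuclideanSpace.single j 1), f⟫)
      ((innerSL ℝ f) ∘L (fderiv ℝ (fderiv ℝ fun y => k i (χ y)) y).flip
        (EuclideanSpace.single j 1)) y := by
    intro i
    have hc : ContDiff ℝ 1 (fderiv ℝ fun y => k i (χ y)) :=
      (hk.contDiff_comp hχ i).fderiv_right (by norm_num)
    have h0 := (innerSL ℝ f).hasFDerivAt.comp y
      ((hc.differentiable one_ne_zero y).hasFDerivAt.clm_apply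
        (hasFDerivAt_const (EuclideanSpace.single j (1 : ℝ)) y))
    refine (h0.congr_of_eventuallyEq (Filter.Eventually.of_forall fun z => ?_)).congr_fderiv ?_
    · simp [real_inner_comm]
    · ext; simp
  have h2 : ∀ i, HasFDerivAt (fun θ : EuclideanSpace ℝ (Fin n) × EuclideanSpace ℝ (Fin n) =>
      θ.1 i / √(d i)) ((√(d i))⁻¹ • ((EuclideanSpace.proj i : EuclideanSpace ℝ (Fin n) →L[ℝ] ℝ) ∘L
        ContinuousLinearMap.fst ℝ _ _)) (z, y) := fun i => by
    have : HasFDerivAt (fun θ : EuclideanSpace ℝ (Fin n) × EuclideanSpace ℝ (Fin n) => θ.1 i)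
      ((EuclideanSpace.proj i : EuclideanSpace ℝ (Fin n) →L[ℝ] ℝ) ∘L
        ContinuousLinearMap.fst ℝ _ _) (z, y) :=
      ((EuclideanSpace.proj i : EuclideanSpace ℝ (Fin n) →L[ℝ] ℝ) ∘L
        ContinuousLinearMap.fst ℝ _ (EuclideanSpace ℝ (Fin n))).hasFDerivAt
    simpa [div_eq_inv_mul] using this.const_mul (√(d i : ℝ))⁻¹
  have h3 := HasFDerivAt.fun_sum (u := univ) fun i _ =>
    (h2 i).mul ((h1 i).comp (z, y) (hasFDerivAt_snd (𝕜 := ℝ) (p := (z, y))))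
  obtain ⟨c', hc'⟩ : DifferentiableAt ℝ (fun θ : EuclideanSpace ℝ (Fin n) ×
      EuclideanSpace ℝ (Fin n) => ‖θ.1‖⁻¹ * (2 / (1 + ‖θ.2‖ ^ 2))⁻¹) (z, y) := by
    have h0 : DifferentiableAt ℝ (fun θ : EuclideanSpace ℝ (Fin n) ×
        EuclideanSpace ℝ (Fin n) => ‖θ.1‖) (z, y) :=
      DifferentiableAt.norm ℝ differentiableAt_fst hz
    refine (h0.inv hzn).mul ?_
    have : Differentiable ℝ fun θ : EuclideanSpace ℝ (Fin n) × EuclideanSpace ℝ (Fin n) =>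
        ‖θ.2‖ ^ 2 := differentiable_snd.norm_sq ℝ
    simp only [inv_div]
    simp only [div_eq_mul_inv]
    exact ((this (z, y)).const_add 1).mul_const (2 : ℝ)⁻¹
  have h4 := hc'.mul h3
  have hq : ∑ i, z i / √(d i) * ⟪fderiv ℝ (fun y => k i (χ y)) y
      (EuclideanSpace.single j 1), f⟫ = 0 := by
    have := inner_dirFrame_eq (d := d) (k := k) (χ := χ) z y j f
    rw [inner_dirFrame, hcrit, Pi.zero_apply, mul_zero] at this
    exact (mul_eq_zero.1 this.symm).resolve_left (mul_ne_zero (inv_ne_zero hzn) (inv_ne_zero hl))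
  have h5 := h4.congr_of_eventuallyEq (Filter.Eventually.of_forall fun θ =>
    inner_dirFrame_eq (d := d) (k := k) (χ := χ) θ.1 θ.2 j f)
  refine ⟨_, h5, fun l => ?_, fun l => ?_⟩
  · simp [hq]
    rw [fderiv_comp_single hd, real_inner_smul_left, normDeriv, Matrix.of_apply]
    have := hdi l
    field_simp
  · simp [hq]
    left
    rw [critHess, Matrix.of_apply]
    exact Finset.sum_congr rfl fun i _ => by rw [real_inner_comm]

end CriticalFrame

section SmallCriticalValue

open Matrix

variable {n : ℕ} {d : Fin n → ℕ} {V : Type*} [NormedAddCommGroup V] [InnerProductSpace ℝ V]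
  {k : Fin n → EuclideanSpace ℝ (Fin (n + 1)) → V}
  {χ : EuclideanSpace ℝ (Fin n) → EuclideanSpace ℝ (Fin (n + 1))}

/-- Systems of norm at most `R` with a critical point of `x ↦ ∑ i, ⟪k i x, f⟫ ^ 2 / d i` on the
sphere at which this function takes a nonzero value at most `a ^ 2`. -/
def smallCriticalValue (d : Fin n → ℕ) (k : Fin n → EuclideanSpace ℝ (Fin (n + 1)) → V)
    (a R : ℝ) : Set V :=
  {f | ∃ (x : EuclideanSpace ℝ (Fin (n + 1))) (z : EuclideanSpace ℝ (Fin n)), ‖x‖ = 1 ∧ z ≠ 0 ∧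
    ‖z‖ ≤ a ∧ ‖f‖ ≤ R ∧ (∀ i, ⟪k i x, f⟫ = √(d i) * z i) ∧
      ∀ v, ⟪x, v⟫ = 0 → ∑ i, z i / √(d i) * ⟪fderiv ℝ (k i) x v, f⟫ = 0}

/-- The incidence set over `smallCriticalValue` in the chart `χ`. -/
def criticalIncidence (d : Fin n → ℕ) (k : Fin n → EuclideanSpace ℝ (Fin (n + 1)) → V)
    (χ : EuclideanSpace ℝ (Fin n) → EuclideanSpace ℝ (Fin (n + 1))) (a R : ℝ) :
    Set (V × EuclideanSpace ℝ (Fin n) × EuclideanSpace ℝ (Fin n)) :=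
  {p | p.2.1 ≠ 0 ∧ ‖p.2.1‖ ≤ a ∧ ‖p.1‖ ≤ R ∧ (∀ i, ⟪k i (χ p.2.2), p.1⟫ = √(d i) * p.2.1 i) ∧
    p.2.1.ofLp ᵥ* normDeriv d k χ p.2.2 p.1 = 0}

variable (hk : IsKernel d k) (hχ : IsConformalChart χ)
include hk hχ

theorem IsKernel.smallCriticalValue_subset (a R : ℝ) :
    smallCriticalValue d k a R ⊆ Prod.fst '' criticalIncidence d k χ a R := by
  rintro f ⟨x, z, hx, hz, hza, hf, hv, hc⟩
  have key : ∀ (y z : EuclideanSpace ℝ (Fin n)),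
      (∀ v, ⟪χ y, v⟫ = 0 → ∑ i, z i / √(d i) * ⟪fderiv ℝ (k i) (χ y) v, f⟫ = 0) →
      z.ofLp ᵥ* normDeriv d k χ y f = 0 := by
    intro y z h
    ext j
    have h1 := h (fderiv ℝ χ y (EuclideanSpace.single j 1)) (hχ.inner_fderiv_self y _)
    simp only [← hk.fderiv_comp hχ] at h1
    simp only [vecMul, dotProduct, normDeriv, Matrix.of_apply, frame, real_inner_smul_left,
      Pi.zero_apply]
    rw [← mul_zero (2 / (1 + ‖y‖ ^ 2))⁻¹, ← h1, Finset.mul_sum]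
    refine Finset.sum_congr rfl fun i _ => ?_
    rw [mul_inv]
    ring
  obtain ⟨y, hy | hy⟩ := hχ.exists_eq x hx
  · rw [← hy] at hv hc
    exact ⟨(f, z, y), ⟨hz, hza, hf, hv, key y z hc⟩, rfl⟩
  · have hxy : x = -χ y := by rw [hy, neg_neg]
    rw [hxy] at hv hc
    have hs : ∀ m : ℕ, ((-1 : ℝ) ^ m) * (-1) ^ m = 1 := fun m => by
      rw [← mul_pow]; norm_num
    set z' : EuclideanSpace ℝ (Fin n) := WithLp.toLp 2 fun i => (-1) ^ d i * z i with hz'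
    have hzi : ∀ i, z' i = (-1) ^ d i * z i := fun i => rfl
    have hn : ‖z'‖ = ‖z‖ := by
      rw [EuclideanSpace.norm_eq, EuclideanSpace.norm_eq]
      simp [hzi]
    refine ⟨(f, z', y), ⟨?_, ?_, hf, fun i => ?_, key y z' fun v hv' => ?_⟩, rfl⟩
    · rw [← norm_ne_zero_iff]
      change ‖z'‖ ≠ 0
      rw [hn]
      exact norm_ne_zero_iff.2 hz
    · exact hn.trans_le hza
    · have := hv i
      rw [hk.map_neg, real_inner_smul_left] at this
      change _ = _ * z' i
      rw [hzi, mul_left_comm, ← this, ← mul_assoc, hs, one_mul]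
    · have := hc v (by simpa using hv')
      rw [← neg_eq_zero, ← Finset.sum_neg_distrib, ← this]
      refine Finset.sum_congr rfl fun i _ => ?_
      rw [hk.fderiv_neg, real_inner_smul_left, hzi, pow_succ]
      ring

theorem IsKernel.measurableSet_criticalIncidence [FiniteDimensional ℝ V] [MeasurableSpace V]
    [BorelSpace V] (a R : ℝ) : MeasurableSet (criticalIncidence d k χ a R) := by
  have hc := hk.continuous_normDeriv hχ
  refine MeasurableSet.inter (IsOpen.measurableSet ?_) (IsClosed.measurableSet ?_)
  · exact isOpen_ne_fun (by fun_prop) continuous_const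
  refine IsClosed.inter (isClosed_le (continuous_norm.comp (continuous_fst.comp continuous_snd))
    continuous_const) (IsClosed.inter (isClosed_le (continuous_norm.comp continuous_fst)
      continuous_const) (IsClosed.inter ?_ ?_))
  · change IsClosed {p : V × EuclideanSpace ℝ (Fin n) × EuclideanSpace ℝ (Fin n) |
      ∀ i, ⟪k i (χ p.2.2), p.1⟫ = √(d i) * p.2.1 i}
    rw [Set.ofPred_forall]
    refine isClosed_iInter fun i => isClosed_eq ?_ (by fun_prop)
    exact ((hk.contDiff_comp hχ i).continuous.comp (continuous_snd.comp continuous_snd)).inner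
      continuous_fst
  · refine isClosed_eq (continuous_pi fun j => ?_) continuous_const
    simp only [vecMul, dotProduct]
    refine continuous_finsetSum _ fun i _ => Continuous.mul (by fun_prop) ?_
    have hp : Continuous fun p : V × EuclideanSpace ℝ (Fin n) × EuclideanSpace ℝ (Fin n) =>
        (p.1, p.2.2) := by fun_prop
    have h2 : Continuous ((fun p : V × EuclideanSpace ℝ (Fin n) => normDeriv d k χ p.2 p.1 i j) ∘
        fun p : V × EuclideanSpace ℝ (Fin n) × EuclideanSpace ℝ (Fin n) => (p.1, p.2.2)) :=
      (hc i j).comp hp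
    exact h2

theorem IsKernel.abs_det_fderiv_critical_le [FiniteDimensional ℝ V] (hd : ∀ i, 1 ≤ d i) {D : ℕ}
    (hD : ∀ i, d i ≤ D) {z : EuclideanSpace ℝ (Fin n)} (hz : z ≠ 0) {y : EuclideanSpace ℝ (Fin n)}
    {f : V} (hcrit : z.ofLp ᵥ* normDeriv d k χ y f = 0) {ρ : ℝ} (hρ0 : 0 < ρ)
    (hρ : ‖z‖ * D * ‖f‖ ≤ ρ) :
    |(fderiv ℝ (fun θ : EuclideanSpace ℝ (Fin n) × EuclideanSpace ℝ (Fin n) =>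
      pairCoordL n V (critPair d k χ θ) f - (diagL (fun i => √(d i)) θ.1, 0)) (z, y)).det| ≤
      (∏ i, √(d i)) * (‖z‖⁻¹ * (2 / (1 + ‖y‖ ^ 2))) ^ n *
        (ρ • (1 : Matrix (Fin n) (Fin n) ℝ) +
          (normDeriv d k χ y f)ᵀ * normDeriv d k χ y f).det := by
  have hl : (0 : ℝ) < 2 / (1 + ‖y‖ ^ 2) := by positivity
  refine le_trans (le_of_eq ?_) (mul_le_mul_of_nonneg_left
    (hk.abs_det_gram_add_critHess_le hχ hd hD hcrit hρ0 hρ) (mul_nonneg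
      (Finset.prod_nonneg fun i _ => Real.sqrt_nonneg _) (by positivity)))
  rw [← abs_det_fromBlocks (fun i => √(d i : ℝ)) (inv_nonneg.2 (norm_nonneg z)) hl
    (fun i => Real.sqrt_nonneg _), det_prod_eq_det_fromBlocks]
  have hg : DifferentiableAt ℝ (fun θ : EuclideanSpace ℝ (Fin n) × EuclideanSpace ℝ (Fin n) =>
      pairCoordL n V (critPair d k χ θ) f -
        (diagL (fun i => √(d i)) θ.1, (0 : EuclideanSpace ℝ (Fin n)))) (z, y) := by
    refine DifferentiableAt.sub ?_ ?_
    · exact ((pairCoordL n V).differentiableAt.comp (z, y)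
        (hk.differentiableAt_critPair hχ (θ := (z, y)) hz)).clm_apply (differentiableAt_const f)
    · exact ((diagL fun i => √(d i : ℝ)).differentiableAt.comp (z, y)
        differentiableAt_fst).prodMk (differentiableAt_const _)
  have e1 : ∀ i, (fun θ : EuclideanSpace ℝ (Fin n) × EuclideanSpace ℝ (Fin n) =>
      (pairCoordL n V (critPair d k χ θ) f -
        (diagL (fun i => √(d i)) θ.1, (0 : EuclideanSpace ℝ (Fin n)))).1 i) =
      fun θ => ⟪k i (χ θ.2), f⟫ - √(d i) * θ.1 i := fun i => by
    ext θ
    simp [critPair]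
  have e2 : ∀ i, (fun θ : EuclideanSpace ℝ (Fin n) × EuclideanSpace ℝ (Fin n) =>
      (pairCoordL n V (critPair d k χ θ) f -
        (diagL (fun i => √(d i)) θ.1, (0 : EuclideanSpace ℝ (Fin n)))).2 i) =
      fun θ => ⟪dirFrame d k χ θ.1 θ.2 i, f⟫ := fun i => by
    ext θ
    simp [critPair]
  choose L1 h1 h1a h1b using hk.hasFDerivAt_fst_critical hχ hd z y f
  choose L2 h2 h2a h2b using hk.hasFDerivAt_snd_critical hχ hd hz y hcrit
  have g1 : ∀ i w, _ := fun i w =>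
    fderiv_prod_euclidean_fst_apply (i := i) hg (by rw [e1]; exact h1 i) w
  have g2 : ∀ i w, _ := fun i w =>
    fderiv_prod_euclidean_snd_apply (i := i) hg (by rw [e2]; exact h2 i) w
  congr 3
  · ext i j
    rw [Matrix.of_apply, g1, h1a, Matrix.neg_apply, Matrix.diagonal_apply]
  · ext i j
    rw [Matrix.of_apply, g1, h1b, Matrix.smul_apply, Matrix.diagonal_mul, smul_eq_mul]
  · ext i j
    rw [Matrix.of_apply, g2, h2a, Matrix.smul_apply, Matrix.transpose_apply, smul_eq_mul]
  · ext i j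
    rw [Matrix.of_apply, g2, h2b, Matrix.smul_apply, smul_eq_mul]

theorem IsKernel.vecMul_normDeriv_sub_pairSynthL [FiniteDimensional ℝ V] (hd : ∀ i, 1 ≤ d i)
    {z w : EuclideanSpace ℝ (Fin n)} (hzw : ⟪z, w⟫ = 0) (y : EuclideanSpace ℝ (Fin n))
    (x : EuclideanSpace ℝ (Fin n) × EuclideanSpace ℝ (Fin n)) (h : V) :
    w.ofLp ᵥ* normDeriv d k χ y (h - pairSynthL n V (critPair d k χ (z, y)) x) =
      w.ofLp ᵥ* normDeriv d k χ y h := by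
  have hO := orthonormal_iff_ite.1 (hk.orthonormal_frame hχ hd y)
  have hO' : ∀ i j i' j', ⟪frame d k χ y i j, frame d k χ y i' j'⟫ =
      if i = i' ∧ j = j' then (1 : ℝ) else 0 := fun i j i' j' => by
    simpa using hO (i, j) (i', j')
  have hzw' : ∑ i, w i * z i = 0 := by
    rw [← hzw]; simp [PiLp.inner_apply]
  have hdir : ∀ j l, ∑ i, w i * ⟪frame d k χ y i j, dirFrame d k χ z y l⟫ = 0 := by
    intro j l
    simp only [dirFrame, real_inner_smul_right, inner_sum, hO']
    by_cases hjl : j = l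
    · simp only [hjl, and_true, mul_ite, mul_one, mul_zero, Finset.sum_ite_eq, Finset.mem_univ,
        if_true]
      rw [← mul_zero ‖z‖⁻¹, ← hzw', Finset.mul_sum]
      exact Finset.sum_congr rfl fun i _ => by ring
    · simp [hjl]
  ext j
  simp only [vecMul, dotProduct, normDeriv, Matrix.of_apply, inner_sub_right, mul_sub,
    Finset.sum_sub_distrib, sub_eq_self, pairSynthL_apply, critPair, synthL_apply, inner_add_right,
    inner_sum, mul_add, Finset.sum_add_distrib, real_inner_smul_right]
  have h1 : ∀ i l, ⟪frame d k χ y i j, k l (χ y)⟫ = 0 := fun i l => by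
    rw [real_inner_comm, hk.inner_comp_frame hχ]
  simp only [h1, mul_zero, Finset.sum_const_zero, zero_add, Finset.mul_sum]
  rw [Finset.sum_comm]
  refine Finset.sum_eq_zero fun l _ => ?_
  rw [← mul_zero (x.2 l), ← hdir j l, Finset.mul_sum]
  exact Finset.sum_congr rfl fun i _ => by ring

theorem IsKernel.lintegral_gramDet_frame_le [FiniteDimensional ℝ V] [MeasurableSpace V]
    [BorelSpace V] (hd : ∀ i, 1 ≤ d i) (y : EuclideanSpace ℝ (Fin n))
    {w : Fin (n - 1) → EuclideanSpace ℝ (Fin n)} (hw : Orthonormal ℝ w) {ρ : ℝ} (hρ : 0 < ρ) :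
    ∫⁻ h, ENNReal.ofReal (gramDet n (n - 1) ρ fun l => (w l).ofLp ᵥ* normDeriv d k χ y h)
      ∂(stdGaussian V) ≤
      ENNReal.ofReal (n.descFactorial (n - 1) * (ρ ^ (n - (n - 1)) * (1 + ρ) ^ (n - 1))) := by
  have hO := orthonormal_iff_ite.1 (hk.orthonormal_frame hχ hd y)
  have hO' : ∀ i j i' j', ⟪frame d k χ y i j, frame d k χ y i' j'⟫ =
      if i = i' ∧ j = j' then (1 : ℝ) else 0 := fun i j i' j' => by
    simpa using hO (i, j) (i', j')
  have hu : Orthonormal ℝ fun p : Fin (n - 1) × Fin n => ∑ i, w p.1 i • frame d k χ y i p.2 := by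
    rw [orthonormal_iff_ite]
    rintro ⟨l, j⟩ ⟨l', j'⟩
    have hww := orthonormal_iff_ite.1 hw l l'
    simp only [PiLp.inner_apply, RCLike.inner_apply, conj_trivial] at hww
    simp only [real_inner_smul_left, real_inner_smul_right, sum_inner, inner_sum, hO',
      Prod.mk.injEq]
    by_cases hj : j = j'
    · simp only [hj, and_true, mul_ite, mul_one, mul_zero, Finset.sum_ite_eq', Finset.mem_univ,
        if_true]
      rw [← hww]
    · simp [hj]
  refine le_trans (le_of_eq ?_) (lintegral_gramDet_le hρ (n - 1) n (Nat.sub_le n 1))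
  rw [← map_inner_stdGaussian_prod (V := V)
    (u := fun l j => ∑ i, w l i • frame d k χ y i j) hu, lintegral_map]
  · refine lintegral_congr fun h => ?_
    congr 2
    ext l j
    simp [vecMul, dotProduct, normDeriv, sum_inner, real_inner_smul_left]
  · exact ENNReal.measurable_ofReal.comp (continuous_gramDet _ _ _).measurable
  · fun_prop

theorem IsKernel.lintegral_abs_det_fderiv_critical_le [FiniteDimensional ℝ V] [MeasurableSpace V]
    [BorelSpace V] (hn : 1 ≤ n) (hd : ∀ i, 1 ≤ d i) {D : ℕ} (hD : ∀ i, d i ≤ D) {a R : ℝ}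
    (hR : 0 < R) {z : EuclideanSpace ℝ (Fin n)} (hz : z ≠ 0) (hza : ‖z‖ ≤ a)
    (y : EuclideanSpace ℝ (Fin n)) (c : V → EuclideanSpace ℝ (Fin n) × EuclideanSpace ℝ (Fin n)) :
    ∫⁻ h, ({h | (h - pairSynthL n V (critPair d k χ (z, y)) (c h), z, y) ∈
        criticalIncidence d k χ a R}.indicator (fun h => ENNReal.ofReal
      |(fderiv ℝ (fun θ : EuclideanSpace ℝ (Fin n) × EuclideanSpace ℝ (Fin n) =>
        pairCoordL n V (critPair d k χ θ) (h - pairSynthL n V (critPair d k χ (z, y)) (c h)) -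
          (diagL (fun i => √(d i)) θ.1, 0)) (z, y)).det|)) h ∂(stdGaussian V) ≤
      ENNReal.ofReal (‖z‖ / ‖z‖ ^ n) * ENNReal.ofReal ((2 / (1 + ‖y‖ ^ 2)) ^ n) *
        ENNReal.ofReal ((∏ i, √(d i)) * n.factorial * (D * R) * (1 + a * (D * R)) ^ (n - 1)) := by
  have hprod : 0 ≤ ∏ i, √(d i : ℝ) := Finset.prod_nonneg fun i _ => Real.sqrt_nonneg _
  have hzn : 0 < ‖z‖ := norm_pos_iff.2 hz
  have hD0 : (0 : ℝ) < D := by exact_mod_cast (hd ⟨0, hn⟩).trans (hD _)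
  have hρ : 0 < ‖z‖ * (D * R) := by positivity
  obtain ⟨w, hw, hzw, hgram⟩ := exists_orthonormal_gram hn hz
  have hl : (0 : ℝ) ≤ (∏ i, √(d i)) * (‖z‖⁻¹ * (2 / (1 + ‖y‖ ^ 2))) ^ n := by positivity
  calc _ ≤ ∫⁻ h, ENNReal.ofReal ((∏ i, √(d i)) * (‖z‖⁻¹ * (2 / (1 + ‖y‖ ^ 2))) ^ n) *
        ENNReal.ofReal (gramDet n (n - 1) (‖z‖ * (D * R))
          fun l => (w l).ofLp ᵥ* normDeriv d k χ y h) ∂(stdGaussian V) := by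
        refine lintegral_mono fun h => Set.indicator_apply_le' (fun hp => ?_) (fun _ => zero_le)
        obtain ⟨-, -, hf, -, hcrit⟩ := hp
        dsimp only at hf hcrit
        rw [← ENNReal.ofReal_mul hl]
        refine ENNReal.ofReal_le_ofReal ((hk.abs_det_fderiv_critical_le hχ hd hD hz hcrit hρ
          ?_).trans (le_of_eq ?_))
        · rw [mul_assoc]
          gcongr
        · rw [hgram _ hcrit, gramDet]
          congr 3
          refine Finset.sum_congr rfl fun l _ => ?_
          rw [hk.vecMul_normDeriv_sub_pairSynthL hχ hd (hzw l)]
    _ ≤ ENNReal.ofReal ((∏ i, √(d i)) * (‖z‖⁻¹ * (2 / (1 + ‖y‖ ^ 2))) ^ n) *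
        ENNReal.ofReal (n.descFactorial (n - 1) * ((‖z‖ * (D * R)) ^ (n - (n - 1)) *
          (1 + ‖z‖ * (D * R)) ^ (n - 1))) := by
        rw [lintegral_const_mul' _ _ ENNReal.ofReal_ne_top]
        gcongr
        exact hk.lintegral_gramDet_frame_le hχ hd y hw hρ
    _ ≤ _ := by
        rw [← ENNReal.ofReal_mul hl, ← ENNReal.ofReal_mul (by positivity),
          ← ENNReal.ofReal_mul (by positivity)]
        refine ENNReal.ofReal_le_ofReal ?_
        have h1 : n.descFactorial (n - 1) = n.factorial := by
          obtain ⟨m, rfl⟩ : ∃ m, n = m + 1 := ⟨n - 1, by omega⟩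
          rw [Nat.descFactorial_eq_div (by omega)]
          simp
        have h2 : n - (n - 1) = 1 := by omega
        rw [h1, h2, pow_one]
        calc _ = (∏ i, √(d i : ℝ)) * (2 / (1 + ‖y‖ ^ 2)) ^ n * n.factorial * (D * R) *
              (‖z‖ / ‖z‖ ^ n) * (1 + ‖z‖ * (D * R)) ^ (n - 1) := by
              rw [mul_pow, inv_pow]
              ring
          _ ≤ (∏ i, √(d i : ℝ)) * (2 / (1 + ‖y‖ ^ 2)) ^ n * n.factorial * (D * R) *
              (‖z‖ / ‖z‖ ^ n) * (1 + a * (D * R)) ^ (n - 1) := by gcongr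
          _ = _ := by ring

theorem IsKernel.stdGaussian_smallCriticalValue_mul_le [FiniteDimensional ℝ V] [MeasurableSpace V]
    [BorelSpace V] (hn : 1 ≤ n) (hd : ∀ i, 1 ≤ d i) {D : ℕ} (hD : ∀ i, d i ≤ D) {a R : ℝ}
    (ha : 0 ≤ a) (hR : 0 < R) :
    stdGaussian V (smallCriticalValue d k a R) * (gaussMass n * gaussMass n) ≤
      ENNReal.ofReal (a * (2 * Real.pi ^ ((n : ℝ) / 2) / Real.Gamma ((n : ℝ) / 2))) *
      ENNReal.ofReal (2 ^ n * Real.pi ^ ((n : ℝ) / 2) * Real.Gamma ((n : ℝ) / 2) / Real.Gamma n) *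
        ENNReal.ofReal ((∏ i, √(d i)) * n.factorial * (D * R) * (1 + a * (D * R)) ^ (n - 1)) := by
  have hO1 : ∀ θ : EuclideanSpace ℝ (Fin n) × EuclideanSpace ℝ (Fin n),
      Orthonormal ℝ (critPair d k χ θ).1 := fun θ => hk.orthonormal_comp hχ θ.2
  have hO2 : ∀ θ : EuclideanSpace ℝ (Fin n) × EuclideanSpace ℝ (Fin n), θ.1 ≠ 0 →
      Orthonormal ℝ (critPair d k χ θ).2 := fun θ hθ => hk.orthonormal_dirFrame hχ hd hθ θ.2
  have hO3 : ∀ (θ : EuclideanSpace ℝ (Fin n) × EuclideanSpace ℝ (Fin n)) i j,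
      ⟪(critPair d k χ θ).1 i, (critPair d k χ θ).2 j⟫ = 0 := fun θ i j =>
    hk.inner_comp_dirFrame hχ θ.1 θ.2 i j
  have main := stdGaussian_image_fst_le (V := V)
    ((volume : Measure (EuclideanSpace ℝ (Fin n))).prod
      (volume : Measure (EuclideanSpace ℝ (Fin n))))
    (Ω := {θ | θ.1 ≠ 0}) (isOpen_ne_fun continuous_fst continuous_const)
    (fun θ => pairCoordL n V (critPair d k χ θ)) (fun θ => pairSynthL n V (critPair d k χ θ))
    (fun θ => (diagL (fun i => √(d i)) θ.1, 0))
    (fun θ hθ => (pairCoordL n V).differentiableAt.comp θ (hk.differentiableAt_critPair hχ hθ))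
    (fun θ hθ => (pairSynthL n V).differentiableAt.comp θ (hk.differentiableAt_critPair hχ hθ))
    (fun θ _ => ((diagL fun i => √(d i : ℝ)).differentiableAt.comp θ
        differentiableAt_fst).prodMk (differentiableAt_const _))
    ((pairCoordL n V).continuous.measurable.comp (hk.measurable_critPair hχ))
    ((pairSynthL n V).continuous.measurable.comp (hk.measurable_critPair hχ))
    (((diagL fun i => √(d i : ℝ)).continuous.comp continuous_fst).prodMk
      continuous_const).measurable
    (fun θ hθ x => pairCoordL_pairSynthL (hO1 θ) (hO2 θ hθ) (hO3 θ) x)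
    (hk.measurableSet_criticalIncidence hχ a R)
    (fun p hp => ⟨hp.1, by
      have h4 := hp.2.2.2.1
      have h5 := hp.2.2.2.2
      rw [pairCoordL_apply]
      refine Prod.ext ?_ ?_
      · ext i
        simpa [critPair] using h4 i
      · ext j
        simp [critPair, inner_dirFrame, h5]⟩)
    (ψ := fun x => gaussWeight x.1 * gaussWeight x.2)
    ((measurable_gaussWeight.comp measurable_fst).mul (measurable_gaussWeight.comp measurable_snd))
    (fun θ hθ h => gaussWeight_sub_pairSynthL_mul_le (hO1 θ) (hO2 θ hθ) (hO3 θ) h _)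
    (F := fun θ => {z : EuclideanSpace ℝ (Fin n) | ‖z‖ ≤ a}.indicator
      (fun z => ENNReal.ofReal (‖z‖ / ‖z‖ ^ n)) θ.1 * ENNReal.ofReal ((2 / (1 + ‖θ.2‖ ^ 2)) ^ n) *
        ENNReal.ofReal ((∏ i, √(d i)) * n.factorial * (D * R) * (1 + a * (D * R)) ^ (n - 1))) ?_
  · refine (mul_le_mul_left (measure_mono (hk.smallCriticalValue_subset hχ a R)) _).trans ?_
    rw [lintegral_mul_const' _ _ ENNReal.ofReal_ne_top,
      lintegral_prod_mul measurable_gaussWeight.aemeasurable measurable_gaussWeight.aemeasurable,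
      lintegral_prod_mul (g := fun y : EuclideanSpace ℝ (Fin n) =>
        ENNReal.ofReal ((2 / (1 + ‖y‖ ^ 2)) ^ n)), lintegral_gaussWeight,
      finrank_euclideanSpace, Fintype.card_fin, lintegral_norm_div_pow hn ha,
      lintegral_conformal_factor_pow hn] at main
    · exact main
    · refine Measurable.aemeasurable (Measurable.indicator (by fun_prop) ?_)
      exact (isClosed_le continuous_norm continuous_const).measurableSet
    · fun_prop
  · rintro ⟨z, y⟩
    by_cases hz : z ≠ 0 ∧ ‖z‖ ≤ a
    · rw [Set.indicator_of_mem (by exact hz.2)]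
      exact hk.lintegral_abs_det_fderiv_critical_le hχ hn hd hD hR hz.1 hz.2 y _
    · refine le_trans (le_of_eq ?_) zero_le
      rw [← lintegral_zero (μ := stdGaussian V)]
      refine lintegral_congr fun h => Set.indicator_of_notMem (fun hp => hz ⟨hp.1, hp.2.1⟩) _

theorem IsKernel.stdGaussian_smallCriticalValue_le [FiniteDimensional ℝ V] [MeasurableSpace V]
    [BorelSpace V] (hn : 1 ≤ n) (hd : ∀ i, 1 ≤ d i) {D : ℕ} (hD : ∀ i, d i ≤ D) {a R : ℝ}
    (ha : 0 ≤ a) (hR : 0 < R) :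
    stdGaussian V (smallCriticalValue d k a R) ≤
      ENNReal.ofReal (2 * n * (∏ i, √(d i)) * (a * (D * R)) * (1 + a * (D * R)) ^ (n - 1)) := by
  have hprod : 0 ≤ ∏ i, √(d i : ℝ) := Finset.prod_nonneg fun i _ => Real.sqrt_nonneg _
  have hn0 : (0 : ℝ) < n := by exact_mod_cast hn
  have h := hk.stdGaussian_smallCriticalValue_mul_le hχ hn hd hD ha hR
  refine (ENNReal.mul_le_mul_iff_left (mul_ne_zero (gaussMass_ne_zero n) (gaussMass_ne_zero n))
    (ENNReal.mul_ne_top (gaussMass_ne_top n) (gaussMass_ne_top n))).1 (h.trans (le_of_eq ?_))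
  have hG : 0 < Real.Gamma n := Real.Gamma_pos_of_pos hn0
  have hG2 : 0 < Real.Gamma (n / 2) := Real.Gamma_pos_of_pos (by positivity)
  have hfac : ((n.factorial : ℕ) : ℝ) = n * Real.Gamma n := by
    rw [← Real.Gamma_nat_eq_factorial, Real.Gamma_add_one hn0.ne']
  have hp : ∀ a : ℝ, 0 ≤ a → a ^ ((n : ℝ) / 2) * a ^ ((n : ℝ) / 2) = a ^ n := fun a ha => by
    rw [← sq, ← Real.rpow_natCast, ← Real.rpow_mul ha, ← Real.rpow_natCast]
    norm_num
  rw [gaussMass, ← ENNReal.ofReal_mul (by positivity), ← ENNReal.ofReal_mul (by positivity),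
    ← ENNReal.ofReal_mul (by positivity), ← ENNReal.ofReal_mul (by positivity),
    hp _ (by positivity), hfac, mul_pow, ← hp Real.pi Real.pi_pos.le]
  congr 1
  field_simp

end SmallCriticalValue

section Geometry

theorem exists_eq_arc {E : Type*} [NormedAddCommGroup E] [InnerProductSpace ℝ E] {x ζ : E}
    (hx : ‖x‖ = 1) (hζ : ‖ζ‖ = 1) {ψ : ℝ} (hψ : 0 < Real.sin ψ) (h : ⟪ζ, x⟫ = Real.cos ψ) :
    ∃ v, ‖v‖ = 1 ∧ ⟪ζ, v⟫ = 0 ∧ arc ζ v ψ = x := by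
  have hv0 : ⟪ζ, (Real.sin ψ)⁻¹ • (x - Real.cos ψ • ζ)⟫ = 0 := by
    rw [real_inner_smul_right, inner_sub_right, real_inner_smul_right, real_inner_self_eq_norm_sq,
      hζ, h]
    ring
  have he : arc ζ ((Real.sin ψ)⁻¹ • (x - Real.cos ψ • ζ)) ψ = x := by
    rw [arc, smul_smul, mul_inv_cancel₀ hψ.ne', one_smul]
    abel
  refine ⟨_, ?_, hv0, he⟩
  rw [norm_smul, norm_inv, Real.norm_of_nonneg hψ.le, inv_mul_eq_one₀ hψ.ne']
  have : ‖x - Real.cos ψ • ζ‖ ^ 2 = Real.sin ψ ^ 2 := by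
    rw [norm_sub_sq_real, norm_smul, real_inner_smul_right, hx, hζ, real_inner_comm, h, mul_one,
      Real.norm_eq_abs, sq_abs, Real.sin_sq]
    ring
  exact ((pow_left_inj₀ hψ.le (norm_nonneg _) two_ne_zero).1 this.symm)

variable {n : ℕ} {d : Fin n → ℕ} {V : Type*} [NormedAddCommGroup V] [InnerProductSpace ℝ V]
  [FiniteDimensional ℝ V] {k : Fin n → EuclideanSpace ℝ (Fin (n + 1)) → V}

/-- The normalized coordinates of `f` along a family of vectors. -/
noncomputable def valueL (d : Fin n → ℕ) (f : V) : (Fin n → V) →L[ℝ] EuclideanSpace ℝ (Fin n) :=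
  (coordL n V).flip f ∘L ContinuousLinearMap.pi fun i =>
    (√(d i))⁻¹ • ContinuousLinearMap.proj (R := ℝ) (φ := fun _ : Fin n => V) i

@[simp] theorem valueL_apply (f : V) (p : Fin n → V) (i : Fin n) :
    valueL d f p i = ⟪p i, f⟫ / √(d i) := by
  simp [valueL, real_inner_smul_left, div_eq_inv_mul]

theorem norm_sq_valueL (f : V) (p : Fin n → V) :
    ‖valueL d f p‖ ^ 2 = ∑ i, (⟪p i, f⟫ / √(d i)) ^ 2 := by
  rw [EuclideanSpace.norm_sq_eq]
  simp only [valueL_apply, Real.norm_eq_abs, sq_abs]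

variable (hk : IsKernel d k)
include hk

theorem IsKernel.hasDerivAt_valueL_arc (f : V) (x v : EuclideanSpace ℝ (Fin (n + 1))) (t : ℝ) :
    HasDerivAt (fun t => valueL d f fun i => k i (arc x v t))
      (valueL d f fun i => fderiv ℝ (k i) (arc x v t) (arc v (-x) t)) t :=
  (valueL d f).hasFDerivAt.comp_hasDerivAt t
    (hasDerivAt_pi.2 fun i => hasDerivAt_comp_arc (hk.contDiff i) x v t)

theorem IsKernel.norm_valueL_arc_sub_le (hd : ∀ i, 1 ≤ d i) {D : ℕ} (hD : ∀ i, d i ≤ D) (f : V)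
    {x v : EuclideanSpace ℝ (Fin (n + 1))} (hx : ‖x‖ = 1) (hv : ‖v‖ = 1) (hxv : ⟪x, v⟫ = 0)
    {t : ℝ} (ht : 0 ≤ t) :
    ‖(valueL d f fun i => k i (arc x v t)) - (valueL d f fun i => k i x) -
      t • valueL d f fun i => fderiv ℝ (k i) x v‖ ≤ D * ‖f‖ * t ^ 2 / 2 := by
  have hxv' : ⟪v, -x⟫ = 0 := by rw [inner_neg_right, real_inner_comm, hxv, neg_zero]
  have h2 : ∀ s, HasDerivAt (fun t => valueL d f fun i =>
      fderiv ℝ (k i) (arc x v t) (arc v (-x) t))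
      (valueL d f fun i => accel (k i) (arc x v s) (arc v (-x) s)) s := fun s =>
    (valueL d f).hasFDerivAt.comp_hasDerivAt s
      (hasDerivAt_pi.2 fun i => hasDerivAt_fderiv_comp_arc (hk.contDiff i) hx hv hxv s)
  have hacc : ∀ s, ‖valueL d f fun i => accel (k i) (arc x v s) (arc v (-x) s)‖ ≤ D * ‖f‖ := by
    intro s
    have hn : ‖arc v (-x) s‖ = 1 := norm_arc hv (by rw [norm_neg, hx]) hxv' s
    have ho : ⟪arc x v s, arc v (-x) s⟫ = 0 := by
      simp only [arc, inner_add_left, inner_add_right, real_inner_smul_left, real_inner_smul_right,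
        inner_neg_right, real_inner_self_eq_norm_sq, hx, hv, hxv, real_inner_comm x v]
      ring
    have := hk.sum_sq_inner_accel_le hd hD (norm_arc hx hv hxv s) ho f
    refine abs_le_of_sq_le_sq' ?_ (by positivity) |>.2
    rw [norm_sq_valueL]
    simpa [hn, real_inner_comm] using this
  set g1 := valueL d f fun i => fderiv ℝ (k i) x v with hg1
  have hfirst : ∀ s, 0 ≤ s → ‖(valueL d f fun i => fderiv ℝ (k i) (arc x v s) (arc v (-x) s)) - g1‖ ≤
      D * ‖f‖ * s := by
    intro s hs
    have := norm_image_sub_le_of_norm_deriv_le_segment' (f := fun t => valueL d f fun i =>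
      fderiv ℝ (k i) (arc x v t) (arc v (-x) t)) (a := 0) (b := s) (C := D * ‖f‖)
      (fun t _ => (h2 t).hasDerivWithinAt) (fun t _ => hacc t) s ⟨hs, le_rfl⟩
    simpa using this
  have := image_norm_le_of_norm_deriv_right_le_deriv_boundary (a := 0) (b := t)
    (f := fun s => (valueL d f fun i => k i (arc x v s)) - (valueL d f fun i => k i x) - s • g1)
    (f' := fun s => (valueL d f fun i => fderiv ℝ (k i) (arc x v s) (arc v (-x) s)) - g1)
    (B := fun s => D * ‖f‖ * s ^ 2 / 2) (B' := fun s => D * ‖f‖ * s) ?_ ?_ ?_ ?_ ?_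
    (x := t) ⟨ht, le_rfl⟩
  · exact this
  · intro s _
    exact (((hk.hasDerivAt_valueL_arc f x v s).continuousAt.sub continuousAt_const).sub
      (by fun_prop)).continuousWithinAt
  · intro s _
    have := ((hk.hasDerivAt_valueL_arc f x v s).sub_const (valueL d f fun i => k i x)).fun_sub
      ((hasDerivAt_id' s).smul_const g1)
    exact (this.congr_deriv (by rw [one_smul])).hasDerivWithinAt
  · simp
  · intro s
    have := ((hasDerivAt_pow 2 s).const_mul (D * ‖f‖)).div_const 2
    refine this.congr_deriv ?_
    simp
    ring
  · intro s hs
    exact hfirst s hs.1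

end Geometry

section SphericalMinimum

open Filter Topology

variable {E F : Type*} [NormedAddCommGroup E] [InnerProductSpace ℝ E]
  [NormedAddCommGroup F] [InnerProductSpace ℝ F]

theorem continuous_arc (x v : E) : Continuous (arc x v) :=
  continuous_iff_continuousAt.2 fun t => (hasDerivAt_arc x v t).continuousAt

theorem le_norm_of_zero {Φ : E → F} {Φ' : E → E → F} {D M θ : ℝ} (hD : 0 ≤ D) (hM : 0 ≤ M)
    (hθ : 0 < θ) (hθ1 : θ ≤ 1)
    (hT : ∀ x v t, ‖x‖ = 1 → ‖v‖ = 1 → ⟪x, v⟫ = 0 → 0 ≤ t →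
      ‖Φ (arc x v t) - Φ x - t • Φ' x v‖ ≤ D * M * t ^ 2 / 2)
    (hs : ∀ ζ v, ‖ζ‖ = 1 → ‖v‖ = 1 → ⟪ζ, v⟫ = 0 → Φ ζ = 0 → 2 * D * θ * M ≤ ‖Φ' ζ v‖)
    {ζ x : E} (hζ : ‖ζ‖ = 1) (hζ0 : Φ ζ = 0) (hx : ‖x‖ = 1) {ψ : ℝ} (h1 : θ ≤ ψ)
    (h2 : ψ ≤ 2 * θ) (h : ⟪ζ, x⟫ = Real.cos ψ) : 3 / 2 * D * θ ^ 2 * M ≤ ‖Φ x‖ := by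
  have hπ := Real.pi_gt_three
  obtain ⟨v, hv, hζv, rfl⟩ := exists_eq_arc hx hζ
    (Real.sin_pos_of_pos_of_lt_pi (by linarith) (by linarith)) h
  have hψ : 0 ≤ ψ := by linarith
  have hT' := hT ζ v ψ hζ hv hζv hψ
  rw [hζ0, sub_zero] at hT'
  have h3 := norm_sub_norm_le (ψ • Φ' ζ v) (Φ (arc ζ v ψ))
  rw [norm_sub_rev, norm_smul, Real.norm_of_nonneg hψ] at h3
  have h4 := mul_le_mul_of_nonneg_left (hs ζ v hζ hv hζv hζ0) hψ
  have h5 : 0 ≤ D * M * ((ψ - θ) * (3 * θ - ψ)) :=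
    mul_nonneg (mul_nonneg hD hM) (mul_nonneg (by linarith) (by linarith))
  nlinarith

/-- If a function on the sphere grows at a definite rate away from its zeros, and has at some
point a small value and a small derivative in some direction, then it has a small nonzero local
minimum. -/
theorem exists_isLocalMin_norm_arc [ProperSpace E] {Φ : E → F} {Φ' : E → E → F} (hc : Continuous Φ)
    (hneg : ∀ x v, Φ' x (-v) = -Φ' x v) {D M θ ε : ℝ} (hD : 0 < D) (hM : 0 < M)
    (hθ : 0 < θ) (hθ1 : θ ≤ 1) (hε : ε = D * θ ^ 2 / 2)
    (hT : ∀ x v t, ‖x‖ = 1 → ‖v‖ = 1 → ⟪x, v⟫ = 0 → 0 ≤ t →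
      ‖Φ (arc x v t) - Φ x - t • Φ' x v‖ ≤ D * M * t ^ 2 / 2)
    (hs : ∀ ζ v, ‖ζ‖ = 1 → ‖v‖ = 1 → ⟪ζ, v⟫ = 0 → Φ ζ = 0 → 2 * D * θ * M ≤ ‖Φ' ζ v‖)
    {y w : E} (hy : ‖y‖ = 1) (hw : ‖w‖ = 1) (hyw : ⟪y, w⟫ = 0) (hΦ : ‖Φ y‖ < ε * M)
    (hΦ' : ‖Φ' y w‖ < ε * M) :
    ∃ x, ‖x‖ = 1 ∧ Φ x ≠ 0 ∧ ‖Φ x‖ < ε * M ∧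
      ∀ v, ‖v‖ = 1 → ⟪x, v⟫ = 0 → IsLocalMin (fun t => ‖Φ (arc x v t)‖) 0 := by
  have hπ := Real.pi_gt_three
  have hgrow := fun {ζ x} => le_norm_of_zero hD.le hM.le hθ hθ1 hT hs (ζ := ζ) (x := x)
  have h3ε : 3 / 2 * D * θ ^ 2 * M = 3 * ε * M := by rw [hε]; ring
  rw [h3ε] at hgrow
  have hεM : 0 < ε * M := by rw [hε]; positivity
  have hcos0 : 0 ≤ Real.cos θ := Real.cos_nonneg_of_neg_pi_div_two_le_of_le (by linarith)
    (by linarith)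
  have hsin0 : 0 ≤ Real.sin θ := Real.sin_nonneg_of_nonneg_of_le_pi (by linarith) (by linarith)
  have hcos1 : Real.cos θ < 1 := by
    rw [← Real.cos_zero]
    exact Real.cos_lt_cos_of_nonneg_of_le_pi le_rfl (by linarith) hθ
  set Z := {ζ : E | ‖ζ‖ = 1 ∧ Φ ζ = 0} with hZ
  set W := {x : E | ‖x‖ = 1 ∧ ∀ ζ ∈ Z, ⟪x, ζ⟫ ≤ Real.cos θ} with hW
  have hsph : IsCompact {x : E | ‖x‖ = 1} := by
    simpa [sphere, dist_zero_right] using isCompact_sphere (0 : E) 1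
  have hZc : IsCompact Z := hsph.inter_right (isClosed_eq hc continuous_const)
  have hWc : IsCompact W := by
    have : W = {x : E | ‖x‖ = 1} ∩ ⋂ ζ ∈ Z, {x | ⟪x, ζ⟫ ≤ Real.cos θ} := by
      ext x
      simp [hW]
    rw [this]
    exact hsph.inter_right (isClosed_biInter fun ζ _ => isClosed_le (by fun_prop) continuous_const)
  have hyW : y ∈ W := by
    refine ⟨hy, fun ζ hζ => ?_⟩
    by_contra! hlt
    obtain ⟨v, hv, hyv, hvζ, hΦv⟩ : ∃ v, ‖v‖ = 1 ∧ ⟪y, v⟫ = 0 ∧ ⟪v, ζ⟫ ≤ 0 ∧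
        ‖Φ' y v‖ < ε * M := by
      rcases le_total ⟪w, ζ⟫ 0 with h | h
      · exact ⟨w, hw, hyw, h, hΦ'⟩
      · exact ⟨-w, by rwa [norm_neg], by rw [inner_neg_right, hyw, neg_zero],
          by rw [inner_neg_left]; linarith, by rwa [hneg, norm_neg]⟩
    have hp := norm_arc hy hv hyv θ
    have hyp : ⟪y, arc y v θ⟫ = Real.cos θ := by
      have := inner_arc hy hv hyv 0 θ
      rwa [arc_zero, zero_sub, Real.cos_neg] at this
    have ha1 : InnerProductGeometry.angle y (arc y v θ) = θ := by
      rw [InnerProductGeometry.angle, hyp, hy, hp, mul_one, div_one,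
        Real.arccos_cos hθ.le (by linarith)]
    have ha2 : InnerProductGeometry.angle ζ y ≤ θ := by
      rw [InnerProductGeometry.angle, hζ.1, hy, mul_one, div_one,
        ← Real.arccos_cos hθ.le (by linarith), real_inner_comm]
      exact Real.arccos_le_arccos hlt.le
    have ha3 := InnerProductGeometry.angle_le_angle_add_angle ζ y (arc y v θ)
    have hcosψ : ⟪ζ, arc y v θ⟫ = Real.cos (InnerProductGeometry.angle ζ (arc y v θ)) := by
      rw [InnerProductGeometry.cos_angle, hζ.1, hp, mul_one, div_one]
    have hle : ⟪ζ, arc y v θ⟫ ≤ Real.cos θ := by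
      have hyζ : ⟪ζ, y⟫ ≤ 1 := by simpa [hy, hζ.1] using real_inner_le_norm ζ y
      rw [arc, inner_add_right, real_inner_smul_right, real_inner_smul_right,
        real_inner_comm v ζ]
      nlinarith
    have hψ : θ ≤ InnerProductGeometry.angle ζ (arc y v θ) := by
      by_contra! hlt'
      have := Real.cos_lt_cos_of_nonneg_of_le_pi (InnerProductGeometry.angle_nonneg ζ (arc y v θ))
        (by linarith) hlt'
      linarith
    have h1 := hgrow hζ.1 hζ.2 hp hψ (by linarith) hcosψ
    have h2 := hT y v θ hy hv hyv hθ.le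
    have h3 : ‖Φ (arc y v θ)‖ ≤ ‖Φ (arc y v θ) - Φ y - θ • Φ' y v‖ + (‖Φ y‖ + θ * ‖Φ' y v‖) := by
      calc ‖Φ (arc y v θ)‖ = ‖(Φ (arc y v θ) - Φ y - θ • Φ' y v) + (Φ y + θ • Φ' y v)‖ := by
            congr 1; abel
        _ ≤ _ := (norm_add_le _ _).trans (by
            gcongr
            refine (norm_add_le _ _).trans_eq ?_
            rw [norm_smul, Real.norm_of_nonneg hθ.le])
    have h4 : D * M * θ ^ 2 / 2 = ε * M := by rw [hε]; ring
    have h5 : θ * ‖Φ' y v‖ ≤ 1 * ‖Φ' y v‖ := by gcongr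
    linarith
  obtain ⟨x, hxW, hmin⟩ := hWc.exists_isMinOn ⟨y, hyW⟩ hc.norm.continuousOn
  have hxlt : ‖Φ x‖ < ε * M := (hmin hyW).trans_lt hΦ
  have hint : ∀ ζ ∈ Z, ⟪x, ζ⟫ < Real.cos θ := by
    intro ζ hζ
    refine (hxW.2 ζ hζ).lt_of_ne fun h => ?_
    have := hgrow hζ.1 hζ.2 hxW.1 le_rfl (by linarith) (by rw [real_inner_comm, h])
    linarith
  refine ⟨x, hxW.1, fun h => ?_, hxlt, fun v hv hxv => ?_⟩
  · have := hint x ⟨hxW.1, h⟩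
    rw [real_inner_self_eq_norm_sq, hxW.1] at this
    linarith
  · have hev : ∀ᶠ t in 𝓝 (0 : ℝ), ∀ ζ ∈ Z, ⟪arc x v t, ζ⟫ < Real.cos θ := by
      refine hZc.eventually_forall_of_forall_eventually fun ζ hζ => ?_
      have hcont : Continuous fun p : ℝ × E => ⟪arc x v p.1, p.2⟫ :=
        ((continuous_arc x v).comp continuous_fst).inner continuous_snd
      exact hcont.continuousAt.eventually_lt continuousAt_const (by simpa using hint ζ hζ)
    filter_upwards [hev] with t ht
    simpa using hmin ⟨norm_arc hxW.1 hv hxv t, fun ζ hζ => (ht ζ hζ).le⟩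

end SphericalMinimum

section Dichotomy

variable {n : ℕ} {d : Fin n → ℕ} {V : Type*} [NormedAddCommGroup V] [InnerProductSpace ℝ V]
  [FiniteDimensional ℝ V] {k : Fin n → EuclideanSpace ℝ (Fin (n + 1)) → V}

theorem norm_valueL_sq_le (hd : ∀ i, 1 ≤ d i) (f : V) (p : Fin n → V) :
    ‖valueL d f p‖ ^ 2 ≤ ∑ i, ⟪p i, f⟫ ^ 2 := by
  rw [norm_sq_valueL]
  refine Finset.sum_le_sum fun i _ => ?_
  have : (1 : ℝ) ≤ d i := by exact_mod_cast hd i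
  rw [div_pow, Real.sq_sqrt (by linarith)]
  exact div_le_self (sq_nonneg _) this

/-- The systems that are nearly singular at some point of the sphere. -/
def nearlySingular (d : Fin n → ℕ) (k : Fin n → EuclideanSpace ℝ (Fin (n + 1)) → V)
    (ε : ℝ) : Set V :=
  {f | ∃ x v : EuclideanSpace ℝ (Fin (n + 1)), ‖x‖ = 1 ∧ ‖v‖ = 1 ∧ ⟪x, v⟫ = 0 ∧
    ∑ i, ⟪k i x, f⟫ ^ 2 + ∑ i, (⟪fderiv ℝ (k i) x v, f⟫ / √(d i)) ^ 2 < ε ^ 2 * ‖f‖ ^ 2}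

/-- A nearly singular system has a nearly singular zero or a small nonzero critical value. -/
theorem IsKernel.nearlySingular_inter_closedBall_subset (hk : IsKernel d k)
    (hd : ∀ i, 1 ≤ d i) {D : ℕ} (hD : ∀ i, d i ≤ D) {ε R : ℝ} (hε : 0 < ε) (hεD : 2 * ε ≤ D) :
    nearlySingular d k ε ∩ closedBall 0 R ⊆
      nearlySingularZero d k √(8 * D * ε) ∪ smallCriticalValue d k (ε * R) R := by
  rintro f ⟨⟨y, w, hy, hw, hyw, hlt⟩, hfR⟩
  rw [mem_closedBall_zero_iff] at hfR
  rw [Set.mem_union, or_iff_not_imp_left]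
  intro hns
  have hD0 : (0 : ℝ) < D := by linarith
  set θ := √(2 * ε / D) with hθdef
  have hθ2 : θ ^ 2 = 2 * ε / D := Real.sq_sqrt (by positivity)
  have hθ : 0 < θ := Real.sqrt_pos.2 (by positivity)
  have hθ1 : θ ≤ 1 := by
    exact Real.sqrt_le_one.2 ((div_le_one hD0).2 hεD)
  have hf : 0 < ‖f‖ := by
    refine (norm_nonneg f).lt_of_ne fun h => ?_
    rw [← h] at hlt
    have h1 : 0 ≤ ∑ i, ⟪k i y, f⟫ ^ 2 := Finset.sum_nonneg fun i _ => sq_nonneg _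
    have h2 : 0 ≤ ∑ i, (⟪fderiv ℝ (k i) y w, f⟫ / √(d i)) ^ 2 :=
      Finset.sum_nonneg fun i _ => sq_nonneg _
    nlinarith
  have hsq := norm_valueL_sq_le hd f fun i => k i y
  have hsq' := norm_sq_valueL (d := d) f fun i => fderiv ℝ (k i) y w
  have hzero : ∀ x, (valueL d f fun i => k i x) = 0 → ∀ i, ⟪k i x, f⟫ = 0 := by
    intro x hx i
    have h := congrArg (fun z : EuclideanSpace ℝ (Fin n) => z i) hx
    have hdi : √(d i : ℝ) ≠ 0 := (Real.sqrt_pos.2 (by exact_mod_cast hd i)).ne'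
    simpa [hdi] using h
  obtain ⟨x, hx, hx0, hxlt, hmin⟩ := exists_isLocalMin_norm_arc
    (Φ := fun x => valueL d f fun i => k i x)
    (Φ' := fun x v => valueL d f fun i => fderiv ℝ (k i) x v) (D := D) (M := ‖f‖) (θ := θ) (ε := ε)
    ((valueL d f).continuous.comp (continuous_pi fun i => (hk.contDiff i).continuous))
    (fun x v => by
      rw [← _root_.map_neg]
      congr 1
      funext i
      simp) hD0 hf hθ hθ1 (by rw [hθ2]; field_simp)
    (fun x v t hx hv hxv ht => hk.norm_valueL_arc_sub_le hd hD f hx hv hxv ht)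
    (fun ζ v hζ hv hζv hζ0 => by
      by_contra! hlt'
      refine hns ⟨ζ, v, hζ, hv, hζv, hzero ζ hζ0, ?_⟩
      rw [← norm_sq_valueL (d := d) f fun i => fderiv ℝ (k i) ζ v, Real.sq_sqrt (by positivity)]
      refine (pow_lt_pow_left₀ hlt' (norm_nonneg _) two_ne_zero).trans_eq ?_
      rw [mul_pow, mul_pow, mul_pow, hθ2]
      field_simp
      ring) hy hw hyw
    (by
      refine lt_of_pow_lt_pow_left₀ 2 (by positivity) ?_
      have : 0 ≤ ∑ i, (⟪fderiv ℝ (k i) y w, f⟫ / √(d i)) ^ 2 :=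
        Finset.sum_nonneg fun i _ => sq_nonneg _
      rw [mul_pow]
      linarith)
    (by
      refine lt_of_pow_lt_pow_left₀ 2 (by positivity) ?_
      have : 0 ≤ ∑ i, ⟪k i y, f⟫ ^ 2 := Finset.sum_nonneg fun i _ => sq_nonneg _
      rw [mul_pow]
      linarith)
  refine ⟨x, valueL d f fun i => k i x, hx, hx0, hxlt.le.trans (by gcongr), hfR, fun i => ?_,
    fun v hxv => ?_⟩
  · have hdi : √(d i : ℝ) ≠ 0 := (Real.sqrt_pos.2 (by exact_mod_cast hd i)).ne'
    rw [valueL_apply]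
    field_simp
  · have key : ∀ v, ‖v‖ = 1 → ⟪x, v⟫ = 0 →
        ⟪valueL d f fun i => k i x, valueL d f fun i => fderiv ℝ (k i) x v⟫ = 0 := by
      intro v hv hxv
      have hder := (hk.hasDerivAt_valueL_arc f x v 0).norm_sq
      have hmin' : IsLocalMin (fun t => ‖valueL d f fun i => k i (arc x v t)‖ ^ 2) 0 := by
        filter_upwards [hmin v hv hxv] with t ht
        exact pow_le_pow_left₀ (norm_nonneg _) ht 2
      have := hmin'.hasDerivAt_eq_zero hder
      simpa using this
    have hconv : ∀ v, ∑ i, (valueL d f fun i => k i x) i / √(d i) * ⟪fderiv ℝ (k i) x v, f⟫ =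
        ⟪valueL d f fun i => k i x, valueL d f fun i => fderiv ℝ (k i) x v⟫ := by
      intro v
      rw [PiLp.inner_apply]
      refine Finset.sum_congr rfl fun i _ => ?_
      simp only [valueL_apply, RCLike.inner_apply, conj_trivial]
      ring
    rcases eq_or_ne v 0 with rfl | hv0
    · simp
    · have hvn : ‖v‖ ≠ 0 := norm_ne_zero_iff.2 hv0
      have h := key (‖v‖⁻¹ • v) (by rw [norm_smul, norm_inv, norm_norm, inv_mul_cancel₀ hvn])
        (by rw [real_inner_smul_right, hxv, mul_zero])
      rw [← hconv] at h
      simp only [_root_.map_smul, real_inner_smul_left] at h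
      have h' : ‖v‖⁻¹ * ∑ i, (valueL d f fun i => k i x) i / √(d i) *
          ⟪fderiv ℝ (k i) x v, f⟫ = 0 := by
        rw [Finset.mul_sum, ← h]
        exact Finset.sum_congr rfl fun i _ => by ring
      exact (mul_eq_zero.1 h').resolve_left (inv_ne_zero hvn)

end Dichotomy

section Sphere

variable {V : Type*} [NormedAddCommGroup V] [InnerProductSpace ℝ V] [FiniteDimensional ℝ V]
  [MeasurableSpace V] [BorelSpace V] {A : Set V}

theorem lintegral_indicator_cone_norm (hA : MeasurableSet A)
    (hcone : ∀ x, ∀ r : ℝ, 0 < r → (r • x ∈ A ↔ x ∈ A)) {h : ℝ → ℝ≥0∞} (hh : Measurable h)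
    [Nontrivial V] :
    ∫⁻ x : V, A.indicator (fun x => h ‖x‖) x =
      (volume : Measure V).toSphere ((↑) ⁻¹' A) *
        ∫⁻ r, h r ∂(Measure.volumeIoiPow (Module.finrank ℝ V - 1)) := by
  have hA' : MeasurableSet ((↑) ⁻¹' A : Set (sphere (0 : V) 1)) := measurable_subtype_coe hA
  have h1 : ∫⁻ x : V, A.indicator (fun x => h ‖x‖) x =
      ∫⁻ x : ({0}ᶜ : Set V), A.indicator (fun x => h ‖x‖) (x : V)
        ∂((volume : Measure V).comap (↑)) := by
    rw [lintegral_subtype_comap (measurableSet_singleton (0 : V)).compl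
      (fun x => A.indicator (fun x => h ‖x‖) x), restrict_compl_singleton]
  have h2 : ∀ x : ({0}ᶜ : Set V), A.indicator (fun x => h ‖x‖) (x : V) =
      (fun p : sphere (0 : V) 1 × Set.Ioi (0 : ℝ) =>
        ((↑) ⁻¹' A : Set (sphere (0 : V) 1)).indicator 1 p.1 * h p.2)
        (homeomorphUnitSphereProd V x) := by
    intro x
    have hx : (x : V) ≠ 0 := x.2
    have hmem := hcone x ‖(x : V)‖⁻¹ (by positivity)
    by_cases hxA : (x : V) ∈ A
    · have : (homeomorphUnitSphereProd V x).1 ∈ ((↑) ⁻¹' A : Set (sphere (0 : V) 1)) := by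
        simpa using hmem.2 hxA
      simp [Set.indicator_of_mem this, Set.indicator_of_mem hxA]
    · have : (homeomorphUnitSphereProd V x).1 ∉ ((↑) ⁻¹' A : Set (sphere (0 : V) 1)) := by
        simpa using fun hm => hxA (hmem.1 hm)
      simp [Set.indicator_of_notMem this, Set.indicator_of_notMem hxA]
  have hf : Measurable (((↑) ⁻¹' A : Set (sphere (0 : V) 1)).indicator (1 : sphere (0 : V) 1 → ℝ≥0∞)) :=
    measurable_one.indicator hA'
  have hg : Measurable fun r : Set.Ioi (0 : ℝ) => h r := hh.comp measurable_subtype_coe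
  have hfg : Measurable fun p : sphere (0 : V) 1 × Set.Ioi (0 : ℝ) =>
      ((↑) ⁻¹' A : Set (sphere (0 : V) 1)).indicator 1 p.1 * h p.2 :=
    (hf.comp measurable_fst).mul (hg.comp measurable_snd)
  rw [h1, lintegral_congr h2, (Measure.measurePreserving_homeomorphUnitSphereProd
    (volume : Measure V)).lintegral_comp hfg, lintegral_prod_mul hf.aemeasurable hg.aemeasurable, lintegral_indicator_one hA']

/-- The uniform measure of a cone on the sphere is its Gaussian measure, up to truncation to a
ball. -/
theorem stdGaussian_cone_inter_closedBall_mul (hA : MeasurableSet A)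
    (hcone : ∀ x, ∀ r : ℝ, 0 < r → (r • x ∈ A ↔ x ∈ A)) (R : ℝ) [Nontrivial V] :
    stdGaussian V (A ∩ closedBall 0 R) * (volume : Measure V).toSphere Set.univ =
      (volume : Measure V).toSphere ((↑) ⁻¹' A) * stdGaussian V (closedBall 0 R) := by
  set h : ℝ → ℝ≥0∞ := fun r =>
    (Set.Iic R).indicator (fun r => ENNReal.ofReal (Real.exp (-(1 / 2) * r ^ 2))) r with hh
  have hmeas : Measurable h := Measurable.indicator (by fun_prop) measurableSet_Iic
  have key : ∀ B : Set V, MeasurableSet B → ∫⁻ x : V, B.indicator (fun x => h ‖x‖) x =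
      gaussMass (Module.finrank ℝ V) * stdGaussian V (B ∩ closedBall 0 R) := by
    intro B hB
    have hBm : MeasurableSet (B ∩ closedBall 0 R) := hB.inter measurableSet_closedBall
    rw [← smul_eq_mul, ← Measure.smul_apply, ← withDensity_gaussWeight, withDensity_apply _ hBm,
      ← lintegral_indicator hBm]
    refine lintegral_congr fun x => ?_
    by_cases hxB : x ∈ B <;> by_cases hxR : ‖x‖ ≤ R <;> simp [hh, hxB, hxR, gaussWeight]
  have e1 := lintegral_indicator_cone_norm hA hcone hmeas
  have e2 := lintegral_indicator_cone_norm (V := V) .univ (by simp) hmeas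
  rw [key _ hA] at e1
  rw [key _ .univ, Set.univ_inter, Set.preimage_univ] at e2
  rw [← ENNReal.mul_right_inj (gaussMass_ne_zero (Module.finrank ℝ V)) (gaussMass_ne_top _)]
  rw [← mul_assoc, e1, mul_left_comm, e2]
  ring

theorem uniform_cone_le (hA : MeasurableSet A)
    (hcone : ∀ x, ∀ r : ℝ, 0 < r → (r • x ∈ A ↔ x ∈ A)) {R : ℝ} (hR0 : 0 < R)
    (hR : 5 * Module.finrank ℝ V ≤ R ^ 2) [Nontrivial V] :
    (((volume : Measure V).toSphere Set.univ)⁻¹ • (volume : Measure V).toSphere) ((↑) ⁻¹' A) ≤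
      ENNReal.ofReal (5 / 4) * stdGaussian V (A ∩ closedBall 0 R) := by
  have hball : ENNReal.ofReal (4 / 5) ≤ stdGaussian V (closedBall 0 R) := by
    have h1 := lintegral_norm_le_stdGaussian (V := V) hR0
    rw [lintegral_indicator_one (measurableSet_le measurable_norm measurable_const)] at h1
    have h2 : {h : V | ‖h‖ ≤ R} = closedBall 0 R := by ext; simp
    rw [h2] at h1
    refine le_trans ?_ h1
    have h3 : (Module.finrank ℝ V : ℝ≥0∞) / ENNReal.ofReal (R ^ 2) ≤ ENNReal.ofReal (1 / 5) := by
      rw [← ENNReal.ofReal_natCast, ← ENNReal.ofReal_div_of_pos (by positivity)]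
      refine ENNReal.ofReal_le_ofReal ?_
      rw [div_le_div_iff₀ (by positivity) (by norm_num)]
      linarith
    refine le_trans ?_ (tsub_le_tsub_left h3 1)
    rw [← ENNReal.ofReal_one, ← ENNReal.ofReal_sub _ (by norm_num)]
    norm_num
  have hu0 : (volume : Measure V).toSphere Set.univ ≠ 0 := by
    rw [ne_eq, Measure.measure_univ_eq_zero]
    exact Measure.toSphere_ne_zero _
  have hut : (volume : Measure V).toSphere Set.univ ≠ ⊤ := measure_ne_top _ _
  have h := stdGaussian_cone_inter_closedBall_mul hA hcone R
  rw [Measure.smul_apply, smul_eq_mul]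
  calc ((volume : Measure V).toSphere Set.univ)⁻¹ * (volume : Measure V).toSphere ((↑) ⁻¹' A)
      = ((volume : Measure V).toSphere Set.univ)⁻¹ * (volume : Measure V).toSphere ((↑) ⁻¹' A) *
        (ENNReal.ofReal (5 / 4) * ENNReal.ofReal (4 / 5)) := by
        rw [← ENNReal.ofReal_mul (by norm_num)]
        norm_num
    _ ≤ ((volume : Measure V).toSphere Set.univ)⁻¹ * (volume : Measure V).toSphere ((↑) ⁻¹' A) *
        (ENNReal.ofReal (5 / 4) * stdGaussian V (closedBall 0 R)) := by gcongr
    _ = ENNReal.ofReal (5 / 4) * (((volume : Measure V).toSphere Set.univ)⁻¹ *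
        ((volume : Measure V).toSphere ((↑) ⁻¹' A) * stdGaussian V (closedBall 0 R))) := by ring
    _ = ENNReal.ofReal (5 / 4) * stdGaussian V (A ∩ closedBall 0 R) := by
        rw [← h, mul_comm (stdGaussian V _), ← mul_assoc (_)⁻¹, ENNReal.inv_mul_cancel hu0 hut,
          one_mul]

end Sphere

section Tail

variable {n : ℕ} {d : Fin n → ℕ} {V : Type*} [NormedAddCommGroup V] [InnerProductSpace ℝ V]
  {k : Fin n → EuclideanSpace ℝ (Fin (n + 1)) → V}

theorem isOpen_nearlySingular (d : Fin n → ℕ) (k : Fin n → EuclideanSpace ℝ (Fin (n + 1)) → V)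
    (ε : ℝ) : IsOpen (nearlySingular d k ε) := by
  have : nearlySingular d k ε = ⋃ p : EuclideanSpace ℝ (Fin (n + 1)) × EuclideanSpace ℝ (Fin (n + 1)),
      {f | (‖p.1‖ = 1 ∧ ‖p.2‖ = 1 ∧ ⟪p.1, p.2⟫ = 0) ∧ ∑ i, ⟪k i p.1, f⟫ ^ 2 +
        ∑ i, (⟪fderiv ℝ (k i) p.1 p.2, f⟫ / √(d i)) ^ 2 < ε ^ 2 * ‖f‖ ^ 2} := by
    ext f
    simp [nearlySingular, and_assoc]
  rw [this]
  refine isOpen_iUnion fun p => ?_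
  by_cases hp : ‖p.1‖ = 1 ∧ ‖p.2‖ = 1 ∧ ⟪p.1, p.2⟫ = 0
  · simp only [hp, true_and, and_self]
    exact isOpen_lt (by fun_prop) (by fun_prop)
  · simp [hp]

theorem smul_mem_nearlySingular (d : Fin n → ℕ) (k : Fin n → EuclideanSpace ℝ (Fin (n + 1)) → V)
    (ε : ℝ) (f : V) {r : ℝ} (hr : 0 < r) :
    r • f ∈ nearlySingular d k ε ↔ f ∈ nearlySingular d k ε := by
  refine exists_congr fun x => exists_congr fun v => and_congr_right fun _ =>
    and_congr_right fun _ => and_congr_right fun _ => ?_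
  have h1 : ∑ i, ⟪k i x, r • f⟫ ^ 2 + ∑ i, (⟪fderiv ℝ (k i) x v, r • f⟫ / √(d i)) ^ 2 =
      r ^ 2 * (∑ i, ⟪k i x, f⟫ ^ 2 + ∑ i, (⟪fderiv ℝ (k i) x v, f⟫ / √(d i)) ^ 2) := by
    simp only [real_inner_smul_right, mul_add, Finset.mul_sum, mul_div_assoc, mul_pow]
  have h2 : ε ^ 2 * ‖r • f‖ ^ 2 = r ^ 2 * (ε ^ 2 * ‖f‖ ^ 2) := by
    rw [norm_smul, Real.norm_eq_abs, mul_pow, sq_abs]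
    ring
  rw [h1, h2]
  exact mul_lt_mul_iff_right₀ (by positivity)

variable [FiniteDimensional ℝ V] [MeasurableSpace V] [BorelSpace V]

theorem IsKernel.uniform_nearlySingular_le [Nontrivial V] (hk : IsKernel d k) (hn : 1 ≤ n)
    (hd : ∀ i, 1 ≤ d i) {D : ℕ} (hD : ∀ i, d i ≤ D) {ε : ℝ} (hε : 0 < ε) (hεD : 2 * ε ≤ D) :
    (((volume : Measure V).toSphere Set.univ)⁻¹ • (volume : Measure V).toSphere)
        ((↑) ⁻¹' nearlySingular d k ε) ≤
      ENNReal.ofReal (5 / 4 * (√(2 * Real.pi) * n * (∏ i, √(d i : ℝ)) * √(Module.finrank ℝ V) *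
          √(8 * D * ε) + 2 * n * (∏ i, √(d i : ℝ)) * (5 * Module.finrank ℝ V * D * ε) *
          (1 + 5 * Module.finrank ℝ V * D * ε) ^ (n - 1))) := by
  obtain ⟨χ, hχ⟩ := exists_isConformalChart n
  have hm : 0 < Module.finrank ℝ V := Module.finrank_pos
  have hR0 : 0 < √(5 * Module.finrank ℝ V : ℝ) := Real.sqrt_pos.2 (by positivity)
  have hR2 : √(5 * Module.finrank ℝ V : ℝ) ^ 2 = 5 * Module.finrank ℝ V :=
    Real.sq_sqrt (by positivity)
  set R := √(5 * Module.finrank ℝ V : ℝ)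
  have hρ : ε * R * (D * R) = 5 * Module.finrank ℝ V * D * ε := by
    rw [← hR2]; ring
  refine (uniform_cone_le (isOpen_nearlySingular d k ε).measurableSet
    (fun f r hr => smul_mem_nearlySingular d k ε f hr) hR0 hR2.ge).trans ?_
  rw [ENNReal.ofReal_mul (by norm_num)]
  gcongr
  refine (measure_mono (hk.nearlySingular_inter_closedBall_subset hd hD hε hεD)).trans
    ((measure_union_le _ _).trans ?_)
  rw [ENNReal.ofReal_add (by positivity) (by positivity)]
  refine add_le_add (hk.stdGaussian_nearlySingularZero_le hχ hn hd (Real.sqrt_nonneg _)) ?_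
  refine (hk.stdGaussian_smallCriticalValue_le hχ hn hd hD (by positivity) hR0).trans_eq ?_
  rw [hρ]

end Tail

section Numerics

theorem tail_bound_le {n N : ℕ} {P D u : ℝ} (hn : 1 ≤ n) (hN : 2 ≤ N) (hP : 1 ≤ P)
    (hnP : 2 ≤ n ^ 2 * P) (hD : 1 ≤ D) (hu : 0 ≤ u) {ε : ℝ}
    (hε : ε = Real.exp (-4 - u) / (N ^ 2 * n ^ 4 * P ^ 2 * D)) :
    5 / 4 * (√(2 * Real.pi) * n * √P * √((N + 1 : ℕ) : ℝ) *
          √(8 * D * ε) + 2 * n * √P * (5 * (N + 1 : ℕ) * D * ε) *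
          (1 + 5 * (N + 1 : ℕ) * D * ε) ^ (n - 1)) ≤ Real.exp (-u / 2) := by
  set e := Real.exp (-2 - u / 2) with he
  have he0 : 0 < e := Real.exp_pos _
  have hee : Real.exp (-4 - u) = e ^ 2 := by
    rw [he, ← Real.exp_nat_mul]; congr 1; push_cast; ring
  have hexp1 : 2.718 < Real.exp 1 := by linarith [Real.exp_one_gt_d9]
  have hexp2 : Real.exp 2 = Real.exp 1 ^ 2 := by rw [← Real.exp_nat_mul]; norm_num
  have hexp2' : 7.38 < Real.exp 2 := by rw [hexp2]; nlinarith
  have heu : Real.exp (-u / 2) = Real.exp 2 * e := by rw [he, ← Real.exp_add]; congr 1; ring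
  have he1 : 7 * e ≤ 1 := by
    have h1 : Real.exp (-u / 2) ≤ 1 := Real.exp_le_one_iff.2 (by linarith)
    nlinarith
  have hN' : (2 : ℝ) ≤ N := by exact_mod_cast hN
  have hn' : (1 : ℝ) ≤ n := by exact_mod_cast hn
  have hmN : ((N + 1 : ℕ) : ℝ) ≤ 3 / 4 * (N : ℝ) ^ 2 := by push_cast; nlinarith
  set m : ℝ := ((N + 1 : ℕ) : ℝ)
  have hm0 : 0 ≤ m := Nat.cast_nonneg _
  have hnP0 : (0 : ℝ) < n ^ 2 * P := by positivity
  have hsP : √P ^ 2 = P := Real.sq_sqrt (by linarith)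
  have hsP1 : 1 ≤ √P := Real.one_le_sqrt.2 hP
  have hρ : 5 * m * D * ε = 5 * m * e ^ 2 / (N ^ 2 * n ^ 4 * P ^ 2) := by
    rw [hε, hee]; field_simp
  have hρle : 5 * m * D * ε ≤ 15 / 4 * e ^ 2 / (n ^ 2 * P) ^ 2 := by
    rw [hρ, div_le_div_iff₀ (by positivity) (by positivity)]
    calc 5 * m * e ^ 2 * (n ^ 2 * P) ^ 2 = m * (5 * e ^ 2 * (n ^ 2 * P) ^ 2) := by ring
      _ ≤ 3 / 4 * (N : ℝ) ^ 2 * (5 * e ^ 2 * (n ^ 2 * P) ^ 2) := by gcongr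
      _ = _ := by ring
  have hρ0 : 0 ≤ 5 * m * D * ε := by rw [hρ]; positivity
  set ρ := 5 * m * D * ε
  have hnsP : n * √P ≤ n ^ 2 * P := by
    have : 1 ≤ n * √P := by nlinarith
    calc n * √P = n * √P * 1 := by ring
      _ ≤ n * √P * (n * √P) := by gcongr
      _ = n ^ 2 * √P ^ 2 := by ring
      _ = n ^ 2 * P := by rw [hsP]
  have hnρ : n * √P * ρ ≤ 15 / 8 * e ^ 2 := by
    calc n * √P * ρ ≤ n ^ 2 * P * (15 / 4 * e ^ 2 / (n ^ 2 * P) ^ 2) := by gcongr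
      _ = 15 / 4 * e ^ 2 / (n ^ 2 * P) := by field_simp
      _ ≤ 15 / 4 * e ^ 2 / 2 := by gcongr
      _ = _ := by ring
  have hpow : (1 + ρ) ^ (n - 1) ≤ 2 := by
    have h1 : n * ρ ≤ 1 / 2 := by
      have : n * ρ ≤ n * √P * ρ := by
        have : (n : ℝ) * 1 ≤ n * √P := by gcongr
        nlinarith
      nlinarith
    calc (1 + ρ) ^ (n - 1) ≤ (1 + ρ) ^ n := pow_le_pow_right₀ (by linarith) (by omega)
      _ ≤ Real.exp ρ ^ n := by
          gcongr
          linarith [Real.add_one_le_exp ρ]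
      _ = Real.exp (n * ρ) := by rw [← Real.exp_nat_mul]
      _ ≤ Real.exp (1 / 2) := Real.exp_le_exp.2 h1
      _ ≤ 2 := by
          have h3 : Real.exp (1 / 2) ^ 2 = Real.exp 1 := by rw [← Real.exp_nat_mul]; norm_num
          refine abs_le_of_sq_le_sq' ?_ (by norm_num) |>.2
          rw [h3]
          linarith [Real.exp_one_lt_d9]
  have hterm2 : 2 * n * √P * ρ * (1 + ρ) ^ (n - 1) ≤ 1.08 * e := by
    calc 2 * n * √P * ρ * (1 + ρ) ^ (n - 1) ≤ 2 * n * √P * ρ * 2 := by gcongr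
      _ = 4 * (n * √P * ρ) := by ring
      _ ≤ 4 * (15 / 8 * e ^ 2) := by gcongr
      _ ≤ 1.08 * e := by nlinarith
  have hterm1 : √(2 * Real.pi) * n * √P * √m * √(8 * D * ε) ≤ 4.35 * e := by
    refine abs_le_of_sq_le_sq' ?_ (by positivity) |>.2
    have hε' : 0 ≤ 8 * D * ε := by rw [hε]; positivity
    rw [mul_pow, mul_pow, mul_pow, mul_pow, hsP, Real.sq_sqrt hε', Real.sq_sqrt hm0,
      Real.sq_sqrt (by positivity)]
    have hπ := Real.pi_lt_d2
    have hπ0 := Real.pi_pos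
    have h8 : 8 * D * ε * m = 8 * m * e ^ 2 / (N ^ 2 * n ^ 4 * P ^ 2) := by
      rw [hε, hee]; field_simp
    calc 2 * Real.pi * n ^ 2 * P * m * (8 * D * ε)
        = 2 * Real.pi * (n ^ 2 * P) * (8 * D * ε * m) := by ring
      _ = 16 * Real.pi * m * e ^ 2 / (N ^ 2 * (n ^ 2 * P)) := by rw [h8]; field_simp; ring
      _ ≤ 16 * Real.pi * (3 / 4 * N ^ 2) * e ^ 2 / (N ^ 2 * 2) := by gcongr
      _ = 6 * Real.pi * e ^ 2 := by field_simp; ring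
      _ ≤ 18.9 * e ^ 2 := by
          refine mul_le_mul_of_nonneg_right ?_ (sq_nonneg e)
          linarith
      _ ≤ (4.35 * e) ^ 2 := by
          rw [mul_pow]
          exact mul_le_mul_of_nonneg_right (by norm_num) (sq_nonneg e)
  rw [heu]
  have h7 := mul_le_mul_of_nonneg_right hexp2'.le he0.le
  linarith

end Numerics

/-- A random variable with an exponential upper tail beyond `c` has mean at most `c + 2`. -/
theorem integral_le_of_exp_tail {Ω : Type*} [MeasurableSpace Ω] {P : Measure Ω}
    [IsProbabilityMeasure P] {X : Ω → ℝ} {c : ℝ} (hc : 0 ≤ c + 2)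
    (h : ∀ u, 0 < u → P {ω | c + u < X ω} ≤ ENNReal.ofReal (Real.exp (-u / 2))) :
    ∫ ω, X ω ∂P ≤ c + 2 := by
  by_cases hX : Integrable X P
  swap
  · rwa [integral_undef hX]
  have hY : Integrable (fun ω => max (X ω - c) 0) P := (hX.sub (integrable_const c)).pos_part
  have hYle : ∫ ω, max (X ω - c) 0 ∂P ≤ 2 := by
    have hnn : 0 ≤ᵐ[P] fun ω => max (X ω - c) 0 :=
      Filter.Eventually.of_forall fun _ => le_max_right _ _
    rw [integral_eq_lintegral_of_nonneg_ae hnn hY.aestronglyMeasurable,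
      lintegral_eq_lintegral_meas_lt P hnn hY.aemeasurable]
    refine ENNReal.toReal_le_of_le_ofReal (by norm_num) ?_
    have hint : ∫ u in Set.Ioi (0 : ℝ), Real.exp (-(1 / 2) * u) = 2 := by
      rw [integral_exp_mul_Ioi (by norm_num)]
      norm_num
    rw [← hint, ofReal_integral_eq_lintegral_ofReal
      (integrableOn_exp_mul_Ioi (by norm_num) 0)
      (Filter.Eventually.of_forall fun _ => (Real.exp_pos _).le)]
    refine setLIntegral_mono' measurableSet_Ioi fun u hu => ?_
    have hu' : (0 : ℝ) < u := hu
    refine (measure_mono fun ω hω => ?_).trans ((h u hu).trans_eq ?_)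
    · rcases lt_max_iff.1 (show u < max (X ω - c) 0 from hω) with h' | h'
      · show c + u < X ω
        linarith
      · linarith
    · congr 2
      ring
  calc ∫ ω, X ω ∂P ≤ ∫ ω, (c + max (X ω - c) 0) ∂P :=
        integral_mono hX ((integrable_const c).add hY) fun ω => by
          show X ω ≤ c + max (X ω - c) 0
          linarith [le_max_left (X ω - c) 0]
    _ = c + ∫ ω, max (X ω - c) 0 ∂P := by
        rw [integral_add (integrable_const c) hY]
        simp
    _ ≤ c + 2 := by linarith

section BombieriWeyl

variable {m : ℕ}

theorem bwInner_eq_sum {p q : MvPolynomial (Fin m) ℝ} {S : Finset (Fin m →₀ ℕ)}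
    (hS : p.support ⊆ S) :
    bwInner p q = ∑ j ∈ S, p.coeff j * q.coeff j / (Nat.multinomial Finset.univ j : ℝ) := by
  classical
  have h : ∀ T : Finset (Fin m →₀ ℕ), p.support ⊆ T →
      ∑ j ∈ T, p.coeff j * q.coeff j / (Nat.multinomial Finset.univ j : ℝ) =
        ∑ j ∈ p.support, p.coeff j * q.coeff j / (Nat.multinomial Finset.univ j : ℝ) :=
    fun T hT => (Finset.sum_subset hT fun j _ hj => by
      rw [notMem_support_iff.1 hj, zero_mul, zero_div]).symm
  rw [h S hS, ← h _ subset_union_left]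
  unfold bwInner
  congr!

theorem bwInner_zero_right (p : MvPolynomial (Fin m) ℝ) : bwInner p 0 = 0 := by
  rw [bwInner_eq_sum subset_rfl]
  simp

theorem bwInner_self_nonneg (p : MvPolynomial (Fin m) ℝ) : 0 ≤ bwInner p p :=
  Finset.sum_nonneg fun _ _ => div_nonneg (mul_self_nonneg _) (Nat.cast_nonneg _)

theorem bwInner_add_self (p q : MvPolynomial (Fin m) ℝ) :
    bwInner (p + q) (p + q) = bwInner p p + 2 * bwInner p q + bwInner q q := by
  classical
  rw [bwInner_eq_sum (support_add (p := p) (q := q)),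
    bwInner_eq_sum (p := p) (q := p) (S := p.support ∪ q.support) subset_union_left,
    bwInner_eq_sum (p := p) (q := q) (S := p.support ∪ q.support) subset_union_left,
    bwInner_eq_sum (p := q) (q := q) (S := p.support ∪ q.support) subset_union_right,
    Finset.mul_sum, ← Finset.sum_add_distrib, ← Finset.sum_add_distrib]
  refine Finset.sum_congr rfl fun j _ => ?_
  rw [coeff_add]
  ring

/-- Reproducing property of the powers of linear forms. -/
theorem bwInner_pow_eq_eval {p : MvPolynomial (Fin m) ℝ} {e : ℕ} (hp : p.IsHomogeneous e)
    (x : Fin m → ℝ) : bwInner p ((∑ k, x k • X k) ^ e) = eval x p := by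
  rw [bwInner_eq_sum subset_rfl, eval_eq']
  refine Finset.sum_congr rfl fun j hj => ?_
  have hdeg : (j.sum fun _ a => a) = e := by
    by_contra h
    exact mem_support_iff.1 hj (hp.coeff_eq_zero h)
  have hmul : j.multinomial = Nat.multinomial Finset.univ j :=
    Finsupp.multinomial_eq_of_support_subset (subset_univ _)
  have hne : (Nat.multinomial Finset.univ j : ℝ) ≠ 0 := by
    exact_mod_cast (Nat.multinomial_pos _ _).ne'
  rw [coeff_linearCombination_X_pow_of_fintype, if_pos hdeg, hmul,
    Finsupp.prod_fintype _ _ fun _ => pow_zero _]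
  field_simp

theorem isHomogeneous_pow_linear (x : Fin m → ℝ) (e : ℕ) :
    ((∑ k, x k • X k : MvPolynomial (Fin m) ℝ) ^ e).IsHomogeneous e := by
  have : (∑ k, x k • X k : MvPolynomial (Fin m) ℝ).IsHomogeneous 1 :=
    IsHomogeneous.sum _ _ _ fun k _ => by
      rw [smul_eq_C_mul]
      exact isHomogeneous_C_mul_X _ _
  simpa using this.pow e

theorem hasFDerivAt_eval (p : MvPolynomial (Fin m) ℝ) (x : EuclideanSpace ℝ (Fin m)) :
    HasFDerivAt (fun x : EuclideanSpace ℝ (Fin m) => eval x.ofLp p)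
      (∑ k, eval x.ofLp (pderiv k p) • (EuclideanSpace.proj k : EuclideanSpace ℝ (Fin m) →L[ℝ] ℝ))
      x := by
  induction p using MvPolynomial.induction_on with
  | C a => simpa using hasFDerivAt_const a x
  | add p q hp hq =>
    simp only [map_add, add_smul, Finset.sum_add_distrib]
    exact hp.add hq
  | mul_X p i hp =>
    simp only [map_mul, eval_X]
    have h := hp.mul (EuclideanSpace.proj i : EuclideanSpace ℝ (Fin m) →L[ℝ] ℝ).hasFDerivAt
    refine HasFDerivAt.congr_fderiv h ?_
    ext v
    simp [Derivation.leibniz, pderiv_X, Pi.single_apply, add_mul, Finset.sum_add_distrib,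
      Finset.mul_sum]
    simp only [apply_ite (eval x.ofLp), map_zero, ite_mul, zero_mul, Finset.sum_ite_eq,
      Finset.mem_univ, if_true, mul_assoc]

theorem contDiff_eval (p : MvPolynomial (Fin m) ℝ) {r : WithTop ℕ∞} :
    ContDiff ℝ r fun x : EuclideanSpace ℝ (Fin m) => eval x.ofLp p := by
  induction p using MvPolynomial.induction_on with
  | C a => simpa using contDiff_const
  | add p q hp hq => simpa using hp.add hq
  | mul_X p i hp =>
    simp only [map_mul, eval_X]
    exact hp.mul (EuclideanSpace.proj i : EuclideanSpace ℝ (Fin m) →L[ℝ] ℝ).contDiff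

end BombieriWeyl

section Kernel

variable {n N : ℕ} {d : Fin n → ℕ}
  {φ : EuclideanSpace ℝ (Fin N) →ₗ[ℝ] (Fin n → MvPolynomial (Fin (n + 1)) ℝ)}

theorem sum_bwInner_eq_inner (hφiso : ∀ v, bwNormSys (φ v) = ‖v‖) (u v : EuclideanSpace ℝ (Fin N)) :
    ∑ i, bwInner (φ u i) (φ v i) = ⟪u, v⟫ := by
  have hsq : ∀ w, ∑ i, bwInner (φ w i) (φ w i) = ‖w‖ ^ 2 := fun w => by
    rw [← hφiso, bwNormSys, Real.sq_sqrt (Finset.sum_nonneg fun i _ => bwInner_self_nonneg _)]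
  have h := hsq (u + v)
  simp only [map_add, Pi.add_apply, bwInner_add_self, Finset.sum_add_distrib, hsq,
    ← Finset.mul_sum, norm_add_sq_real] at h
  linarith

/-- The space of systems has a reproducing kernel. -/
theorem exists_isKernel (hφsys : ∀ v, IsSystem d (φ v)) (hφiso : ∀ v, bwNormSys (φ v) = ‖v‖)
    (hφsurj : ∀ g, IsSystem d g → ∃ v, φ v = g) :
    ∃ k : Fin n → EuclideanSpace ℝ (Fin (n + 1)) → EuclideanSpace ℝ (Fin N), IsKernel d k ∧
      (∀ i x g, ⟪k i x, g⟫ = eval x.ofLp (φ g i)) ∧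
      ∀ i x v g, ⟪fderiv ℝ (k i) x v, g⟫ = ∑ l, eval x.ofLp (pderiv l (φ g i)) * v l := by
  classical
  have hsys : ∀ (i : Fin n) (x : EuclideanSpace ℝ (Fin (n + 1))),
      IsSystem d (Pi.single i ((∑ l, x l • X l) ^ d i)) := by
    intro i x j
    rcases eq_or_ne j i with rfl | h
    · rw [Pi.single_eq_same]
      exact isHomogeneous_pow_linear _ _
    · rw [Pi.single_eq_of_ne h]
      exact isHomogeneous_zero _ _ _
  choose k hk using fun i x => hφsurj _ (hsys i x)
  have hrep : ∀ i x g, ⟪k i x, g⟫ = eval x.ofLp (φ g i) := by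
    intro i x g
    rw [real_inner_comm, ← sum_bwInner_eq_inner hφiso, Finset.sum_eq_single i]
    · rw [hk, Pi.single_eq_same, bwInner_pow_eq_eval (hφsys g i)]
    · intro j _ hj
      rw [hk, Pi.single_eq_of_ne hj, bwInner_zero_right]
    · simp
  have hcd : ∀ i, ContDiff ℝ 2 (k i) := by
    intro i
    rw [contDiff_euclidean]
    intro l
    have : (fun x => k i x l) = fun x : EuclideanSpace ℝ (Fin (n + 1)) =>
        eval x.ofLp (φ (EuclideanSpace.single l 1) i) := by
      funext x
      rw [← hrep, EuclideanSpace.inner_single_right]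
      simp
    rw [this]
    exact contDiff_eval _
  refine ⟨k, ⟨hcd, fun i j x y => ?_⟩, hrep, fun i x v g => ?_⟩
  · rw [real_inner_comm, hrep, hk]
    rcases eq_or_ne i j with rfl | h
    · rw [Pi.single_eq_same, if_pos rfl, map_pow]
      congr 1
      simp [smul_eval, PiLp.inner_apply, mul_comm]
    · rw [Pi.single_eq_of_ne h.symm, if_neg h, map_zero]
  · have h1 : HasFDerivAt (fun x => ⟪k i x, g⟫) ((innerSL ℝ g).comp (fderiv ℝ (k i) x)) x := by
      have := (innerSL ℝ g).hasFDerivAt.comp x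
        ((hcd i).differentiable (by norm_num) x).hasFDerivAt
      refine this.congr_of_eventuallyEq (Filter.Eventually.of_forall fun y => ?_)
      simp [real_inner_comm]
    have h2 := hasFDerivAt_eval (φ g i) x
    simp only [hrep] at h1
    have h := congrArg (fun L => L v) (h1.unique h2)
    simpa [real_inner_comm, _root_.sum_apply] using h

end Kernel

theorem exists_unit_orthogonal {n : ℕ} (hn : 1 ≤ n) {x : EuclideanSpace ℝ (Fin (n + 1))}
    (hx : ‖x‖ = 1) : ∃ v : EuclideanSpace ℝ (Fin (n + 1)), ‖v‖ = 1 ∧ ⟪x, v⟫ = 0 := by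
  have : Fact (Module.finrank ℝ (EuclideanSpace ℝ (Fin (n + 1))) = n + 1) := ⟨by simp⟩
  have hx0 : x ≠ 0 := by rintro rfl; simp at hx
  have hrank := Submodule.finrank_orthogonal_span_singleton (𝕜 := ℝ) (n := n) hx0
  have : Nontrivial (ℝ ∙ x)ᗮ := Module.nontrivial_of_finrank_pos (R := ℝ) (by omega)
  obtain ⟨v, hv⟩ := exists_norm_eq (ℝ ∙ x)ᗮ zero_le_one
  exact ⟨v, hv, Submodule.mem_orthogonal_singleton_iff_inner_right.1 v.2⟩

section Condition

variable {n N : ℕ} {d : Fin n → ℕ}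
  {φ : EuclideanSpace ℝ (Fin N) →ₗ[ℝ] (Fin n → MvPolynomial (Fin (n + 1)) ℝ)}
  {k : Fin n → EuclideanSpace ℝ (Fin (n + 1)) → EuclideanSpace ℝ (Fin N)}

theorem mem_nearlySingular_of_lt_kappa (hn : 1 ≤ n) (hφiso : ∀ v, bwNormSys (φ v) = ‖v‖)
    (hkφ : ∀ i x g, ⟪k i x, g⟫ = eval x.ofLp (φ g i))
    (hkφ' : ∀ i x v g, ⟪fderiv ℝ (k i) x v, g⟫ = ∑ l, eval x.ofLp (pderiv l (φ g i)) * v l)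
    {g : EuclideanSpace ℝ (Fin N)} {t : ℝ} (ht : 0 < t)
    (h : ENNReal.ofReal t < kappa d (φ g)) : g ∈ nearlySingular d k t⁻¹ := by
  obtain ⟨x, hx⟩ := lt_iSup_iff.1 h
  obtain ⟨hxS, hx⟩ := lt_iSup_iff.1 hx
  have hnorm : ∀ y : Fin (n + 1) → ℝ, ∑ l, y l ^ 2 = 1 → ‖WithLp.toLp 2 y‖ = 1 := fun y hy => by
    rw [← sq_eq_sq₀ (norm_nonneg _) zero_le_one, EuclideanSpace.norm_sq_eq]
    simpa using hy
  have hx1 := hnorm x hxS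
  have hlt : t * Real.sqrt (sigmaMin d (φ g) x ^ 2 + ∑ i, (eval x (φ g i)) ^ 2) < ‖g‖ := by
    by_contra! hle
    refine hx.not_ge ?_
    rw [kappaAt, hφiso]
    refine ENNReal.div_le_of_le_mul ?_
    rw [← ENNReal.ofReal_mul ht.le]
    exact ENNReal.ofReal_le_ofReal hle
  have hsq : sigmaMin d (φ g) x ^ 2 + ∑ i, (eval x (φ g i)) ^ 2 < t⁻¹ ^ 2 * ‖g‖ ^ 2 := by
    rw [← mul_pow]
    refine Real.lt_sq_of_sqrt_lt ?_
    rw [inv_mul_eq_div, lt_div_iff₀ ht]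
    linarith
  have hσ : sigmaMin d (φ g) x <
      Real.sqrt (t⁻¹ ^ 2 * ‖g‖ ^ 2 - ∑ i, (eval x (φ g i)) ^ 2) :=
    Real.lt_sqrt_of_sq_lt (by linarith)
  obtain ⟨w, hw, hxw⟩ := exists_unit_orthogonal hn hx1
  obtain ⟨_, ⟨v, ⟨hvx, hv⟩, rfl⟩, hlt'⟩ := exists_lt_of_csInf_lt (by
    refine Set.Nonempty.image _ ⟨w.ofLp, ?_, ?_⟩
    · simpa [PiLp.inner_apply] using hxw
    · have h2 := EuclideanSpace.norm_sq_eq w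
      rw [hw] at h2
      simpa using h2.symm) hσ
  have hlt2 := (Real.sqrt_lt_sqrt_iff (Finset.sum_nonneg fun i _ => sq_nonneg _)).1 hlt'
  refine ⟨WithLp.toLp 2 x, WithLp.toLp 2 v, hx1, hnorm v hv, by simpa [PiLp.inner_apply] using hvx, ?_⟩
  simp only [hkφ, hkφ']
  linarith

/-- In the smallest case, a single linear form in two variables, nothing is nearly singular. -/
theorem IsKernel.nearlySingular_one_eq_empty {d : Fin 1 → ℕ} {V : Type*} [NormedAddCommGroup V]
    [InnerProductSpace ℝ V] [FiniteDimensional ℝ V]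
    {k : Fin 1 → EuclideanSpace ℝ (Fin 2) → V} (hk : IsKernel d k) (hd : d 0 = 1)
    (hV : Module.finrank ℝ V = 2) : nearlySingular d k 1 = ∅ := by
  rw [Set.eq_empty_iff_forall_notMem]
  rintro f ⟨x, v, hx, hv, hxv, hlt⟩
  have ho : Orthonormal ℝ ![k 0 x, fderiv ℝ (k 0) x v] := by
    have h1 := hk.inner_eq 0 0 x x
    have h2 := hk.inner_fderiv 0 0 x x v
    have h3 := hk.inner_fderiv_fderiv 0 0 (v := v) hx hxv
    simp only [if_true, hd, real_inner_self_eq_norm_sq, hx, hv, hxv] at h1 h2 h3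
    rw [orthonormal_iff_ite]
    intro i j
    have h2' := real_inner_comm (k 0 x) (fderiv ℝ (k 0) x v)
    fin_cases i <;> fin_cases j <;> simp_all
  have hspan : ⊤ ≤ Submodule.span ℝ (Set.range ![k 0 x, fderiv ℝ (k 0) x v]) :=
    (ho.linearIndependent.span_eq_top_of_card_eq_finrank (by simp [hV])).ge
  have h := (OrthonormalBasis.mk ho hspan).sum_sq_inner_right f
  simp [Fin.sum_univ_two] at h
  simp [hd] at hlt
  linarith

end Condition

end KappaAverage

/-- **Average analysis of `κ̃`, expectation bound.**  Identify `H_d` with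
`ℝ^{N+1}` (with the Bombieri–Weyl norm) via any linear isometry `φ`; the uniform
probability distribution on `ℙ(H_d)` is realized as the normalized uniform
(surface) measure on the unit sphere `S(H_d)`.  Then
`E_{g ∈ ℙ(H_d)}[ln κ̃(g)] ≤ 2 ln N + 4 ln n + 2 ln 𝒟 + ln D + 6`. -/
theorem average_analysis_kappa_expectation {n : ℕ} (hn : 1 ≤ n) (d : Fin n → ℕ)
    (hd : ∀ i, 1 ≤ d i) (N : ℕ) (hN : N + 1 = ∑ i, Nat.choose (d i + n) n)
    (φ : EuclideanSpace ℝ (Fin (N + 1)) →ₗ[ℝ] (Fin n → MvPolynomial (Fin (n + 1)) ℝ))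
    (hφsys : ∀ v, IsSystem d (φ v))
    (hφiso : ∀ v, bwNormSys (φ v) = ‖v‖)
    (hφsurj : ∀ g, IsSystem d g → ∃ v, φ v = g) :
    ⨍ g : Metric.sphere (0 : EuclideanSpace ℝ (Fin (N + 1))) 1,
        Real.log ((kappa d (φ g)).toReal)
        ∂(volume : Measure (EuclideanSpace ℝ (Fin (N + 1)))).toSphere
      ≤ 2 * Real.log N + 4 * Real.log n + 2 * Real.log (∏ i, (d i : ℝ)) +
          Real.log ((Finset.univ.sup d : ℕ) : ℝ) + 6 := by
  obtain ⟨k, hk, hkφ, hkφ'⟩ := KappaAverage.exists_isKernel hφsys hφiso hφsurj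
  have hmem := fun {g t} => KappaAverage.mem_nearlySingular_of_lt_kappa (d := d) (g := g) (t := t)
    hn hφiso hkφ hkφ'
  have hDle : ∀ i, d i ≤ Finset.univ.sup d := fun i => Finset.le_sup (Finset.mem_univ i)
  have hD1 : 1 ≤ Finset.univ.sup d := (hd ⟨0, hn⟩).trans (hDle _)
  have hP : (1 : ℝ) ≤ ∏ i, (d i : ℝ) :=
    Finset.one_le_prod fun i _ => by exact_mod_cast hd i
  have hN1 : n * (n + 1) ≤ N + 1 := by
    rw [hN]
    calc n * (n + 1) = ∑ _i : Fin n, (n + 1) := by simp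
      _ ≤ _ := Finset.sum_le_sum fun i _ => by
        calc n + 1 = (n + 1).choose n := (Nat.choose_succ_self_right n).symm
          _ ≤ _ := Nat.choose_le_choose n (by have := hd i; omega)
  have hNpos : 1 ≤ N := by nlinarith
  have hlogN : 0 ≤ Real.log N := Real.log_nonneg (by exact_mod_cast hNpos)
  have hlogn : 0 ≤ Real.log n := Real.log_nonneg (by exact_mod_cast hn)
  have hlogP := Real.log_nonneg hP
  have hlogD : 0 ≤ Real.log ((Finset.univ.sup d : ℕ) : ℝ) := Real.log_nonneg (by exact_mod_cast hD1)
  rcases hNpos.eq_or_lt with rfl | hN2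
  · obtain rfl : n = 1 := by nlinarith
    have hd0 : d 0 = 1 := by
      simp at hN
      omega
    refine le_trans (integral_nonpos fun g => ?_) (by positivity)
    refine Real.log_nonpos ENNReal.toReal_nonneg ?_
    refine ENNReal.toReal_le_of_le_ofReal zero_le_one ?_
    by_contra! h
    have := hmem one_pos h
    rw [inv_one, hk.nearlySingular_one_eq_empty hd0 (by simp)] at this
    exact this
  have hN2' : (2 : ℝ) ≤ N := by exact_mod_cast hN2
  have hn' : (1 : ℝ) ≤ n := by exact_mod_cast hn
  have hD1' : (1 : ℝ) ≤ (Finset.univ.sup d : ℕ) := by exact_mod_cast hD1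
  have hnP : (2 : ℝ) ≤ n ^ 2 * ∏ i, (d i : ℝ) := by
    rcases hn.eq_or_lt with rfl | hn2
    · simp at hN ⊢
      exact_mod_cast (by omega : 2 ≤ d 0)
    · have : (2 : ℝ) ≤ n := by exact_mod_cast hn2
      nlinarith
  set D : ℕ := Finset.univ.sup d
  set P : ℝ := ∏ i, (d i : ℝ) with hPdef
  have hK : 1 ≤ (N : ℝ) ^ 2 * n ^ 4 * P ^ 2 * D :=
    one_le_mul_of_one_le_of_one_le (one_le_mul_of_one_le_of_one_le (one_le_mul_of_one_le_of_one_le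
      (one_le_pow₀ (by linarith)) (one_le_pow₀ hn')) (one_le_pow₀ hP)) hD1'
  have hlogK : Real.log ((N : ℝ) ^ 2 * n ^ 4 * P ^ 2 * D) =
      2 * Real.log N + 4 * Real.log n + 2 * Real.log P + Real.log D := by
    rw [Real.log_mul (by positivity) (by positivity), Real.log_mul (by positivity) (by positivity),
      Real.log_mul (by positivity) (by positivity), Real.log_pow, Real.log_pow, Real.log_pow]
    norm_num
  set K : ℝ := (N : ℝ) ^ 2 * n ^ 4 * P ^ 2 * D with hKdef
  have hKpos : 0 < K := by linarith
  have : NeZero (volume : Measure (EuclideanSpace ℝ (Fin (N + 1)))).toSphere :=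
    ⟨Measure.toSphere_ne_zero _⟩
  have : IsProbabilityMeasure
      (((volume : Measure (EuclideanSpace ℝ (Fin (N + 1)))).toSphere Set.univ)⁻¹ •
        (volume : Measure (EuclideanSpace ℝ (Fin (N + 1)))).toSphere) := inferInstance
  rw [average]
  refine (KappaAverage.integral_le_of_exp_tail (c := Real.log K + 4)
    (by have := Real.log_nonneg hK; linarith) fun u hu => ?_).trans (by linarith)
  have hε : (Real.exp (Real.log K + 4 + u))⁻¹ = Real.exp (-4 - u) / K := by
    rw [← Real.exp_neg, show -(Real.log K + 4 + u) = (-4 - u) - Real.log K by ring, Real.exp_sub,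
      Real.exp_log hKpos]
  have hεD : 2 * (Real.exp (-4 - u) / K) ≤ D := by
    have h1 : Real.exp (-4 - u) ≤ 1 / 2 := by
      rw [show -4 - u = -(4 + u) by ring, Real.exp_neg, ← one_div]
      exact one_div_le_one_div_of_le (by norm_num) (by linarith [Real.add_one_le_exp (4 + u)])
    have h2 : Real.exp (-4 - u) / K ≤ Real.exp (-4 - u) := div_le_self (Real.exp_pos _).le hK
    linarith
  have htail := hk.uniform_nearlySingular_le hn hd hDle (ε := Real.exp (-4 - u) / K) (by positivity) hεD
  refine (measure_mono fun g hg => ?_).trans (htail.trans (ENNReal.ofReal_le_ofReal ?_))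
  · have hg' : Real.log K + 4 + u < Real.log ((kappa d (φ g)).toReal) := hg
    have hpos : 0 < (kappa d (φ g)).toReal := by
      refine ENNReal.toReal_nonneg.lt_of_ne fun h => ?_
      rw [← h, Real.log_zero] at hg'
      linarith [Real.log_nonneg hK]
    rw [Set.mem_preimage, ← hε]
    refine hmem (Real.exp_pos _) ?_
    rw [ENNReal.ofReal_lt_iff_lt_toReal (Real.exp_pos _).le (ENNReal.toReal_pos_iff.1 hpos).2.ne]
    exact (Real.lt_log_iff_exp_lt hpos).1 hg'
  · have hsqrt : ∏ i, Real.sqrt (d i : ℝ) = Real.sqrt P :=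
      (Real.sqrt_prod _ fun i _ => Nat.cast_nonneg _).symm
    rw [hsqrt, finrank_euclideanSpace, Fintype.card_fin]
    exact KappaAverage.tail_bound_le hn hN2 hP hnP hD1' hu.le rfl
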